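/- For all integers g ≥ 2 and k ≥ 1 there exists a polynomial S_{g,k} ∈ ℚ[t] of degree at most 3g − 3 + 3k such that for every integer ν ≥ 2 one has n_g((2ν)^k) = ( (2ν)! / ((ν+1)!·ν!) )^k · S_{g,k}(ν). (This establishes the polynomiality in ν of the normalized counts S_{g,k}(ν) of (2ν)-angulations, as conjectured by Gharakhloo–Latimer.) -/

import Mathlib

open PowerSeries

/-- The formal derivative `d/dx` on `ℚ⟦x⟧`. -/
noncomputable def D : PowerSeries ℚ → PowerSeries ℚ := PowerSeries.derivativeFun

/-- The permutation `σ₀` of `{0, …, b*k − 1}` whose cycles are the `k` consecutive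
blocks of length `b`. -/
def blockPerm (b k : ℕ) : Equiv.Perm (Fin (b * k)) :=
  (finProdFinEquiv.trans (finCongr (Nat.mul_comm k b))).permCongr
    ((Equiv.refl (Fin k)).prodCongr (finRotate b))

/-- The number of cycles of a permutation, counting fixed points as cycles of length 1. -/
noncomputable def cycleCount {n : ℕ} (σ : Equiv.Perm (Fin n)) : ℕ :=
  σ.cycleType.card + (n - σ.support.card)

/-- `nMap g b k` is the number of connected genus-`g` labelled ribbon graphs with `k` vertices
of valency `b`: the number of fixed-point-free involutions `α` of `{0, …, b*k − 1}` which,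
together with the block permutation `σ₀`, generate a transitive subgroup, and such that
`σ₀ ∘ α` has `2 − 2g − k + b*k/2` cycles (fixed points counting as cycles). -/
noncomputable def nMap (g b k : ℕ) : ℕ :=
  Nat.card {α : Equiv.Perm (Fin (b * k)) //
    α * α = 1 ∧ (∀ i, α i ≠ i) ∧
    (∀ i j : Fin (b * k), ∃ p ∈ Subgroup.closure
        ({blockPerm b k, α} : Set (Equiv.Perm (Fin (b * k)))), p i = j) ∧
    2 * (cycleCount (blockPerm b k * α) : ℤ) = 4 - 4 * g - 2 * k + b * k}

namespace RibbonGraph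

section Gaussian

lemma pderiv_comm {n : Type*} [DecidableEq n] (p q : n) (f : MvPolynomial n ℚ) :
    MvPolynomial.pderiv p (MvPolynomial.pderiv q f) =
      MvPolynomial.pderiv q (MvPolynomial.pderiv p f) := by
  have h : ⁅(MvPolynomial.pderiv p : Derivation ℚ (MvPolynomial (n) ℚ) (MvPolynomial (n) ℚ)),
      (MvPolynomial.pderiv q : Derivation ℚ (MvPolynomial (n) ℚ) (MvPolynomial (n) ℚ))⁆
      = 0 := by
    apply MvPolynomial.derivation_ext
    intro i
    simp only [Derivation.commutator_apply, MvPolynomial.pderiv_X, Pi.single_apply]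
    split_ifs <;> simp
  have := congrArg (fun d => d f) h
  simpa [Derivation.commutator_apply, sub_eq_zero] using this

variable {n : Type*} [Fintype n]

/-- The Laplacian `∑ ∂_{ij} ∂_{ji}` on polynomials in the entries of a matrix. -/
noncomputable def laplacian : Module.End ℚ (MvPolynomial (n × n) ℚ) :=
  ∑ p : n × n, (MvPolynomial.pderiv p).toLinearMap ∘ₗ (MvPolynomial.pderiv p.swap).toLinearMap

lemma laplacian_apply (f : MvPolynomial (n × n) ℚ) :
    laplacian f = ∑ p : n × n, MvPolynomial.pderiv p (MvPolynomial.pderiv p.swap f) := by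
  simp [laplacian]

variable [DecidableEq n]

lemma laplacian_pderiv (q : n × n) (f : MvPolynomial (n × n) ℚ) :
    laplacian (MvPolynomial.pderiv q f) = MvPolynomial.pderiv q (laplacian f) := by
  simp only [laplacian_apply, map_sum]
  refine Finset.sum_congr rfl fun p _ => ?_
  rw [pderiv_comm p.swap q, pderiv_comm p q]

lemma laplacian_pow_pderiv (q : n × n) (f : MvPolynomial (n × n) ℚ) (k : ℕ) :
    (laplacian ^ k) (MvPolynomial.pderiv q f) = MvPolynomial.pderiv q ((laplacian ^ k) f) := by
  induction k with
  | zero => simp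
  | succ k ih => rw [pow_succ', Module.End.mul_apply, ih, laplacian_pderiv, Module.End.mul_apply]

lemma laplacian_X_mul (q : n × n) (f : MvPolynomial (n × n) ℚ) :
    laplacian (MvPolynomial.X q * f) =
      MvPolynomial.X q * laplacian f + 2 * MvPolynomial.pderiv q.swap f := by
  have h : ∀ p : n × n, MvPolynomial.pderiv p (MvPolynomial.pderiv p.swap (MvPolynomial.X q * f)) =
      MvPolynomial.X q * MvPolynomial.pderiv p (MvPolynomial.pderiv p.swap f)
      + ((if p = q.swap then MvPolynomial.pderiv p f else 0)
        + (if p = q then MvPolynomial.pderiv p.swap f else 0)) := by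
    intro p
    have e : (p.swap = q) = (p = q.swap) := by
      rw [eq_iff_iff]; constructor
      · rintro rfl; simp
      · rintro rfl; simp
    simp only [Derivation.leibniz, MvPolynomial.pderiv_X, Pi.single_apply, smul_eq_mul, map_add,
      eq_comm (a := q), e]
    split_ifs <;> simp; ring
  rw [laplacian_apply, Finset.sum_congr rfl fun p _ => h p, Finset.sum_add_distrib,
    Finset.sum_add_distrib, ← Finset.mul_sum, ← laplacian_apply]
  simp
  ring

lemma laplacian_pow_X_mul (q : n × n) (f : MvPolynomial (n × n) ℚ) (k : ℕ) :
    (laplacian ^ (k + 1)) (MvPolynomial.X q * f) =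
      MvPolynomial.X q * (laplacian ^ (k + 1)) f
        + (2 * (k + 1) : ℚ) • (laplacian ^ k) (MvPolynomial.pderiv q.swap f) := by
  induction k with
  | zero =>
    simp [laplacian_X_mul, two_mul, two_smul]
  | succ k ih =>
    rw [pow_succ' laplacian (k + 1), Module.End.mul_apply, ih, map_add, laplacian_X_mul, map_smul,
      Module.End.mul_apply, ← laplacian_pow_pderiv, ← Module.End.mul_apply laplacian (laplacian ^ k),
      ← pow_succ', MvPolynomial.smul_eq_C_mul, MvPolynomial.smul_eq_C_mul]
    have h2 : (2 : MvPolynomial (n × n) ℚ) = MvPolynomial.C 2 :=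
      (map_ofNat MvPolynomial.C 2).symm
    have h : (2 * ((k + 1 : ℕ) + 1) : ℚ) = 2 + 2 * (k + 1) := by push_cast; ring
    rw [h, MvPolynomial.C_add, h2]
    ring

lemma exists_laplacian_pow_eq_zero (f : MvPolynomial (n × n) ℚ) :
    ∃ K, ∀ k, K ≤ k → (laplacian ^ k) f = 0 := by
  induction f using MvPolynomial.induction_on with
  | C a =>
    refine ⟨1, fun k hk => ?_⟩
    obtain ⟨k, rfl⟩ := Nat.exists_eq_add_of_le hk
    rw [add_comm, pow_succ, Module.End.mul_apply, laplacian_apply]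
    simp
  | add p q hp hq =>
    obtain ⟨K, hK⟩ := hp
    obtain ⟨L, hL⟩ := hq
    exact ⟨max K L, fun k hk => by
      rw [map_add, hK k (le_trans (le_max_left _ _) hk), hL k (le_trans (le_max_right _ _) hk),
        add_zero]⟩
  | mul_X p q hp' =>
    obtain ⟨K, hK⟩ := hp'
    refine ⟨K + 1, fun k hk => ?_⟩
    obtain ⟨k, rfl⟩ : ∃ j, k = j + 1 := ⟨k - 1, by omega⟩
    rw [mul_comm, laplacian_pow_X_mul, hK _ (by omega), laplacian_pow_pderiv,
      hK _ (by omega)]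
    simp

lemma gaussian_support_finite (s : ℚ) (f : MvPolynomial (n × n) ℚ) :
    (Function.support fun k : ℕ =>
      s ^ k / (2 ^ k * k.factorial) * MvPolynomial.constantCoeff ((laplacian ^ k) f)).Finite := by
  obtain ⟨K, hK⟩ := exists_laplacian_pow_eq_zero f
  refine (Set.finite_lt_nat K).subset fun k hk => ?_
  by_contra h
  exact hk (by simp [hK k (by simpa using h)])

/-- The expectation of a polynomial in the entries of a Gaussian Hermitian matrix whose covariance
is `E (X_{ij} X_{kl}) = s δ_{il} δ_{jk}`. -/
noncomputable def gaussian (s : ℚ) : MvPolynomial (n × n) ℚ →ₗ[ℚ] ℚ where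
  toFun f := ∑ᶠ k : ℕ,
    s ^ k / (2 ^ k * k.factorial) * MvPolynomial.constantCoeff ((laplacian ^ k) f)
  map_add' f g := by
    rw [← finsum_add_distrib (gaussian_support_finite s f) (gaussian_support_finite s g)]
    refine finsum_congr fun k => ?_
    rw [map_add, map_add, mul_add]
  map_smul' c f := by
    rw [RingHom.id_apply, smul_eq_mul, mul_finsum _ _]
    refine finsum_congr fun k => ?_
    rw [map_smul, MvPolynomial.smul_eq_C_mul, map_mul, MvPolynomial.constantCoeff_C]
    ring

lemma gaussian_apply (s : ℚ) (f : MvPolynomial (n × n) ℚ) :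
    gaussian s f = ∑ᶠ k : ℕ,
      s ^ k / (2 ^ k * k.factorial) * MvPolynomial.constantCoeff ((laplacian ^ k) f) := rfl

lemma gaussian_one (s : ℚ) : gaussian s (1 : MvPolynomial (n × n) ℚ) = 1 := by
  rw [gaussian_apply, finsum_eq_single _ 0]
  · simp
  · intro k hk
    obtain ⟨k, rfl⟩ : ∃ j, k = j + 1 := ⟨k - 1, by omega⟩
    rw [pow_succ laplacian, Module.End.mul_apply, laplacian_apply]
    simp

lemma gaussian_X_mul (s : ℚ) (q : n × n) (f : MvPolynomial (n × n) ℚ) :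
    gaussian s (MvPolynomial.X q * f) = s * gaussian s (MvPolynomial.pderiv q.swap f) := by
  obtain ⟨K, hK⟩ := exists_laplacian_pow_eq_zero (MvPolynomial.X q * f)
  obtain ⟨L, hL⟩ := exists_laplacian_pow_eq_zero (MvPolynomial.pderiv q.swap f)
  rw [gaussian_apply, gaussian_apply,
    finsum_eq_sum_of_support_subset (s := Finset.range (K + L + 1)),
    finsum_eq_sum_of_support_subset (s := Finset.range (K + L)), Finset.sum_range_succ',
    Finset.mul_sum]
  · simp only [pow_zero, Module.End.one_apply, map_mul, MvPolynomial.constantCoeff_X, zero_mul,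
      mul_zero, add_zero]
    refine Finset.sum_congr rfl fun k _ => ?_
    rw [laplacian_pow_X_mul, map_add, map_mul, MvPolynomial.constantCoeff_X,
      MvPolynomial.smul_eq_C_mul, map_mul, MvPolynomial.constantCoeff_C, Nat.factorial_succ]
    push_cast
    field_simp
    ring
  · intro k hk
    by_contra h
    simp only [Finset.coe_range, Set.mem_Iio, not_lt] at h
    exact hk (by simp [hL k (by omega)])
  · intro k hk
    by_contra h
    simp only [Finset.coe_range, Set.mem_Iio, not_lt] at h
    exact hk (by simp [hK k (by omega)])

/-- The generic matrix. -/
noncomputable def genericMatrix : Matrix n n (MvPolynomial (n × n) ℚ) :=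
  Matrix.of fun i j => MvPolynomial.X (i, j)

lemma pderiv_genericMatrix_pow (a b : n) (k : ℕ) (i j : n) :
    MvPolynomial.pderiv (a, b) ((genericMatrix ^ k) i j) =
      ∑ p ∈ Finset.range k, (genericMatrix ^ p) i a * (genericMatrix ^ (k - 1 - p)) b j := by
  induction k generalizing j with
  | zero => rw [pow_zero, Matrix.one_apply]; split_ifs <;> simp
  | succ k ih =>
    rw [pow_succ, Matrix.mul_apply, map_sum, Finset.sum_range_succ]
    simp only [Derivation.leibniz, smul_eq_mul, ih, Finset.sum_add_distrib]
    rw [add_comm]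
    congr 1
    · simp only [Finset.mul_sum]
      rw [Finset.sum_comm]
      refine Finset.sum_congr rfl fun p hp => ?_
      have : k + 1 - 1 - p = (k - 1 - p) + 1 := by have := Finset.mem_range.1 hp; omega
      rw [this, pow_succ, Matrix.mul_apply, Finset.mul_sum]
      exact Finset.sum_congr rfl fun c _ => by ring
    · rw [Finset.sum_eq_single a]
      · by_cases h : b = j
        · subst h; simp [genericMatrix]
        · simp [genericMatrix, MvPolynomial.pderiv_X, h, Ne.symm h]
      · intro c _ hc
        simp [genericMatrix, MvPolynomial.pderiv_X, hc]
      · simp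

lemma pderiv_trace_genericMatrix_pow (a b : n) (k : ℕ) :
    MvPolynomial.pderiv (a, b) (genericMatrix ^ k).trace =
      (k : MvPolynomial (n × n) ℚ) * (genericMatrix ^ (k - 1)) b a := by
  simp only [Matrix.trace, Matrix.diag_apply, map_sum, pderiv_genericMatrix_pow]
  rw [Finset.sum_comm]
  have : ∀ p ∈ Finset.range k, ∑ i, (genericMatrix ^ p) i a * (genericMatrix ^ (k - 1 - p)) b i
      = (genericMatrix ^ (k - 1)) b a := by
    intro p hp
    have h : k - 1 = (k - 1 - p) + p := by have := Finset.mem_range.1 hp; omega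
    conv_rhs => rw [h, pow_add, Matrix.mul_apply]
    exact Finset.sum_congr rfl fun c _ => mul_comm _ _
  rw [Finset.sum_congr rfl this]
  simp

lemma derivation_prod {ι R A : Type*} [DecidableEq ι] [CommSemiring R] [CommSemiring A]
    [Algebra R A] (d : Derivation R A A) (S : Finset ι) (f : ι → A) :
    d (∏ i ∈ S, f i) = ∑ j ∈ S, d (f j) * ∏ i ∈ S.erase j, f i := by
  induction S using Finset.induction_on with
  | empty => simp
  | insert a S ha ih =>
    rw [Finset.prod_insert ha, Derivation.leibniz, Finset.sum_insert ha, Finset.erase_insert ha, ih,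
      smul_eq_mul, smul_eq_mul, add_comm, mul_comm, Finset.mul_sum]
    congr 1
    refine Finset.sum_congr rfl fun j hj => ?_
    have hja : j ≠ a := fun h => ha (h ▸ hj)
    rw [Finset.erase_insert_of_ne hja.symm, Finset.prod_insert fun h => ha (Finset.mem_of_mem_erase h)]
    ring

/-- The Schwinger–Dyson equation for traces of powers of a Gaussian matrix. -/
lemma gaussian_trace_mul_prod (s : ℚ) (m : ℕ) (S : Finset ℕ) (μ : ℕ → ℕ) :
    gaussian s ((genericMatrix ^ (m + 1)).trace * ∏ i ∈ S, (genericMatrix (n := n) ^ μ i).trace) =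
      s * (∑ p ∈ Finset.range m, gaussian s ((genericMatrix ^ p).trace *
          (genericMatrix ^ (m - 1 - p)).trace * ∏ i ∈ S, (genericMatrix (n := n) ^ μ i).trace)
        + ∑ j ∈ S, (μ j : ℚ) * gaussian s ((genericMatrix ^ (m + μ j - 1)).trace *
          ∏ i ∈ S.erase j, (genericMatrix (n := n) ^ μ i).trace)) := by
  set F := ∏ i ∈ S, (genericMatrix (n := n) ^ μ i).trace with hF
  have h1 : (genericMatrix (n := n) ^ (m + 1)).trace * F =
      ∑ a, ∑ b, MvPolynomial.X (a, b) * ((genericMatrix ^ m) b a * F) := by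
    rw [pow_succ', Matrix.trace, Finset.sum_mul]
    refine Finset.sum_congr rfl fun a _ => ?_
    rw [Matrix.diag_apply, Matrix.mul_apply, Finset.sum_mul]
    exact Finset.sum_congr rfl fun b _ => by simp [genericMatrix, mul_assoc]
  have h2 : ∀ a b, MvPolynomial.pderiv (b, a) ((genericMatrix ^ m) b a * F) =
      (∑ p ∈ Finset.range m, (genericMatrix ^ p) b b * (genericMatrix ^ (m - 1 - p)) a a * F)
      + ∑ j ∈ S, (μ j : ℚ) • ((genericMatrix ^ m) b a * (genericMatrix ^ (μ j - 1)) a b *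
          ∏ i ∈ S.erase j, (genericMatrix (n := n) ^ μ i).trace) := by
    intro a b
    rw [Derivation.leibniz, add_comm, smul_eq_mul, smul_eq_mul, pderiv_genericMatrix_pow,
      Finset.mul_sum]
    congr 1
    · exact Finset.sum_congr rfl fun p _ => by ring
    · rw [hF, derivation_prod, Finset.mul_sum]
      refine Finset.sum_congr rfl fun j _ => ?_
      rw [pderiv_trace_genericMatrix_pow, MvPolynomial.smul_eq_C_mul, map_natCast]
      ring
  rw [h1]
  simp only [map_sum, gaussian_X_mul, Prod.swap_prod_mk, h2, map_add, map_smul, smul_eq_mul,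
    ← Finset.mul_sum, Finset.sum_add_distrib]
  congr 2
  · rw [Finset.sum_congr rfl fun _ _ => Finset.sum_comm, Finset.sum_comm]
    refine Finset.sum_congr rfl fun p _ => ?_
    simp only [← map_sum]
    congr 1
    simp only [Matrix.trace, Matrix.diag_apply, Finset.sum_mul, Finset.mul_sum]
  · rw [Finset.sum_congr rfl fun _ _ => Finset.sum_comm, Finset.sum_comm]
    refine Finset.sum_congr rfl fun j hj => ?_
    simp only [← Finset.mul_sum]
    rcases Nat.eq_zero_or_pos (μ j) with h0 | h0
    · simp [h0]
    congr 1
    simp only [← map_sum]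
    congr 1
    have : m + μ j - 1 = (μ j - 1) + m := by omega
    rw [this, pow_add]
    simp only [Matrix.trace, Matrix.diag_apply, Finset.sum_mul, Matrix.mul_apply]
    exact Finset.sum_congr rfl fun a _ => Finset.sum_congr rfl fun b _ => by ring

end Gaussian

section Cumulant

variable {A : Type*} [CommRing A] [Algebra ℚ A] (φ : A →ₗ[ℚ] ℚ) (τ : ℕ → A) (μ : ℕ → ℕ)

/-- The joint moment of `x` and the `τ (μ i)`, `i ∈ S`. -/
def moment (x : A) (S : Finset ℕ) : ℚ := φ (x * ∏ i ∈ S, τ (μ i))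

/-- The joint cumulant of `x` and the `τ (μ i)`, `i ∈ S`. -/
noncomputable def cumulant (x : A) (S : Finset ℕ) : ℚ :=
  moment φ τ μ x S -
    ∑ B ∈ S.ssubsets.attach, cumulant x B.1 * moment φ τ μ 1 (S \ B.1)
termination_by S.card
decreasing_by exact Finset.card_lt_card (Finset.mem_ssubsets.1 B.2)

variable {φ}

lemma sum_powerset_eq_sum_ssubsets_add {M : Type*} [AddCommMonoid M] (S : Finset ℕ)
    (f : Finset ℕ → M) : ∑ B ∈ S.powerset, f B = ∑ B ∈ S.ssubsets, f B + f S := by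
  rw [Finset.ssubsets, Finset.sum_erase_add _ _ (Finset.mem_powerset_self S)]

lemma sum_cumulant_mul_moment (hφ : φ 1 = 1) (x : A) (S : Finset ℕ) :
    ∑ B ∈ S.powerset, cumulant φ τ μ x B * moment φ τ μ 1 (S \ B) = moment φ τ μ x S := by
  have h1 : moment φ τ μ 1 ∅ = 1 := by simp [moment, hφ]
  rw [sum_powerset_eq_sum_ssubsets_add, Finset.sdiff_self, h1, mul_one]
  conv_lhs => rw [cumulant]
  rw [Finset.sum_attach S.ssubsets fun B => cumulant φ τ μ x B * moment φ τ μ 1 (S \ B)]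
  ring

lemma eq_cumulant (hφ : φ 1 = 1) (x : A) (f : Finset ℕ → ℚ) (S : Finset ℕ)
    (hf : ∀ T ⊆ S, ∑ B ∈ T.powerset, f B * moment φ τ μ 1 (T \ B) = moment φ τ μ x T) :
    f S = cumulant φ τ μ x S := by
  induction S using Finset.strongInduction with
  | H S ih =>
    have h1 : moment φ τ μ 1 ∅ = 1 := by simp [moment, hφ]
    have h2 := hf S subset_rfl
    rw [← sum_cumulant_mul_moment τ μ hφ, sum_powerset_eq_sum_ssubsets_add,
      sum_powerset_eq_sum_ssubsets_add, Finset.sdiff_self, h1, mul_one, mul_one] at h2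
    rw [Finset.sum_congr rfl fun B hB => by
      rw [ih B (Finset.mem_ssubsets.1 hB) fun T hT =>
        hf T (hT.trans (Finset.mem_ssubsets.1 hB).subset)]] at h2
    exact add_left_cancel h2

lemma moment_congr {ν : ℕ → ℕ} (x : A) (S : Finset ℕ) (h : ∀ i ∈ S, μ i = ν i) :
    moment φ τ μ x S = moment φ τ ν x S := by
  rw [moment, moment, Finset.prod_congr rfl fun i hi => by rw [h i hi]]

lemma cumulant_congr {ν : ℕ → ℕ} (hφ : φ 1 = 1) (x : A) (S : Finset ℕ) (h : ∀ i ∈ S, μ i = ν i) :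
    cumulant φ τ μ x S = cumulant φ τ ν x S := by
  refine eq_cumulant τ ν hφ x _ S fun T hT => ?_
  rw [← moment_congr τ μ x T fun i hi => h i (hT hi), ← sum_cumulant_mul_moment τ μ hφ]
  refine Finset.sum_congr rfl fun B hB => ?_
  rw [moment_congr τ μ 1 (T \ B) fun i hi => h i (hT (Finset.mem_sdiff.1 hi).1)]

lemma sum_powerset_powerset {M : Type*} [AddCommMonoid M] (S : Finset ℕ)
    (F : Finset ℕ → Finset ℕ → Finset ℕ → M) :
    ∑ B ∈ S.powerset, ∑ C ∈ B.powerset, F C (B \ C) (S \ B) =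
      ∑ C ∈ S.powerset, ∑ E ∈ (S \ C).powerset, F C E ((S \ C) \ E) := by
  rw [Finset.sum_sigma', Finset.sum_sigma']
  refine Finset.sum_bij' (fun x _ => ⟨x.2, x.1 \ x.2⟩) (fun x _ => ⟨x.1 ∪ x.2, x.1⟩) ?_ ?_ ?_ ?_ ?_
  · rintro ⟨B, C⟩ h
    simp only [Finset.mem_sigma, Finset.mem_powerset] at h ⊢
    exact ⟨h.2.trans h.1, Finset.sdiff_subset_sdiff h.1 subset_rfl⟩
  · rintro ⟨C, E⟩ h
    simp only [Finset.mem_sigma, Finset.mem_powerset] at h ⊢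
    exact ⟨Finset.union_subset h.1 (h.2.trans Finset.sdiff_subset), Finset.subset_union_left⟩
  · rintro ⟨B, C⟩ h
    simp only [Finset.mem_sigma, Finset.mem_powerset] at h
    simp [Finset.union_sdiff_of_subset h.2]
  · rintro ⟨C, E⟩ h
    simp only [Finset.mem_sigma, Finset.mem_powerset] at h
    have : Disjoint E C := (Finset.subset_sdiff.1 h.2).2
    simp [Finset.union_sdiff_cancel_left this.symm]
  · rintro ⟨B, C⟩ h
    simp only [Finset.mem_sigma, Finset.mem_powerset] at h
    rw [sdiff_sdiff_left, Finset.sup_eq_union, Finset.union_sdiff_of_subset h.2]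

lemma sum_powerset_sum_mem {M : Type*} [AddCommMonoid M] (S : Finset ℕ)
    (F : ℕ → Finset ℕ → Finset ℕ → M) :
    ∑ B ∈ S.powerset, ∑ j ∈ B, F j (B.erase j) (S \ B) =
      ∑ j ∈ S, ∑ C ∈ (S.erase j).powerset, F j C ((S.erase j) \ C) := by
  rw [Finset.sum_sigma', Finset.sum_sigma']
  refine Finset.sum_bij' (fun x _ => ⟨x.2, x.1.erase x.2⟩) (fun x _ => ⟨insert x.1 x.2, x.1⟩)
    ?_ ?_ ?_ ?_ ?_
  · rintro ⟨B, j⟩ h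
    simp only [Finset.mem_sigma, Finset.mem_powerset] at h ⊢
    exact ⟨h.1 h.2, Finset.erase_subset_erase _ h.1⟩
  · rintro ⟨j, C⟩ h
    simp only [Finset.mem_sigma, Finset.mem_powerset] at h ⊢
    exact ⟨Finset.insert_subset h.1 (h.2.trans (Finset.erase_subset _ _)), Finset.mem_insert_self _ _⟩
  · rintro ⟨B, j⟩ h
    simp only [Finset.mem_sigma, Finset.mem_powerset] at h
    simp [Finset.insert_erase h.2]
  · rintro ⟨j, C⟩ h
    simp only [Finset.mem_sigma, Finset.mem_powerset] at h
    have : j ∉ C := fun hj => (Finset.mem_erase.1 (h.2 hj)).1 rfl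
    simp [Finset.erase_insert this]
  · rintro ⟨B, j⟩ h
    simp only [Finset.mem_sigma, Finset.mem_powerset] at h
    have : S \ B = S.erase j \ B.erase j := by
      ext i
      simp only [Finset.mem_sdiff, Finset.mem_erase]
      by_cases hi : i = j
      · subst hi; simp [h.2]
      · simp [hi]
    rw [this]

/-- The cumulant of a product. -/
lemma cumulant_mul (hφ : φ 1 = 1) (p q i : ℕ) (S : Finset ℕ) (hi : i ∉ S) :
    cumulant φ τ μ (τ p * τ q) S =
      cumulant φ τ (Function.update μ i q) (τ p) (insert i S) +
        ∑ B ∈ S.powerset, cumulant φ τ μ (τ p) B * cumulant φ τ μ (τ q) (S \ B) := by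
  symm
  refine eq_cumulant τ μ hφ _ (fun S => cumulant φ τ (Function.update μ i q) (τ p) (insert i S) +
        ∑ B ∈ S.powerset, cumulant φ τ μ (τ p) B * cumulant φ τ μ (τ q) (S \ B)) S fun T hT => ?_
  have hiT : i ∉ T := fun h => hi (hT h)
  have hμ : ∀ B ⊆ T, ∀ j ∈ B, Function.update μ i q j = μ j := fun B hB j hj =>
    Function.update_of_ne (ne_of_mem_of_not_mem (hB hj) hiT) _ _
  have h1 : moment φ τ μ (τ p * τ q) T
      = moment φ τ (Function.update μ i q) (τ p) (insert i T) := by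
    rw [moment, moment, Finset.prod_insert hiT, Function.update_self, ← mul_assoc,
      Finset.prod_congr rfl fun j hj => by rw [← hμ T subset_rfl j hj]]
  rw [h1, ← sum_cumulant_mul_moment τ _ hφ, Finset.sum_powerset_insert hiT, add_comm]
  simp only [add_mul, Finset.sum_add_distrib, Finset.sum_mul]
  congr 1
  · refine Finset.sum_congr rfl fun B hB => ?_
    have hB := Finset.mem_powerset.1 hB
    rw [Finset.insert_sdiff_insert, Finset.sdiff_insert_of_notMem hiT,
      moment_congr τ _ 1 (T \ B) (hμ _ Finset.sdiff_subset)]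
  · rw [sum_powerset_powerset T fun B C E =>
      cumulant φ τ μ (τ p) B * cumulant φ τ μ (τ q) C * moment φ τ μ 1 E]
    refine Finset.sum_congr rfl fun B hB => ?_
    have hB := Finset.mem_powerset.1 hB
    rw [cumulant_congr τ _ hφ _ B (hμ _ hB)]
    simp only [mul_assoc, ← Finset.mul_sum]
    rw [sum_cumulant_mul_moment τ _ hφ, Finset.insert_sdiff_of_notMem _ fun h => hiT (hB h), moment, moment,
      Finset.prod_insert fun h => hiT (Finset.mem_sdiff.1 h).1, Function.update_self, one_mul,
      Finset.prod_congr rfl fun j hj => by rw [← hμ _ Finset.sdiff_subset j hj]]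

/-- The loop equation for cumulants, deduced from the Schwinger–Dyson equation for moments. -/
lemma cumulant_succ (hφ : φ 1 = 1) (c : ℚ) (m : ℕ)
    (h : ∀ S : Finset ℕ, φ (τ (m + 1) * ∏ i ∈ S, τ (μ i)) =
      c * ∑ p ∈ Finset.range m, φ (τ p * τ (m - 1 - p) * ∏ i ∈ S, τ (μ i)) +
        ∑ j ∈ S, (μ j : ℚ) * φ (τ (m + μ j - 1) * ∏ i ∈ S.erase j, τ (μ i)))
    (S : Finset ℕ) (i : ℕ) (hi : i ∉ S) :
    cumulant φ τ μ (τ (m + 1)) S =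
      ∑ j ∈ S, (μ j : ℚ) * cumulant φ τ μ (τ (m + μ j - 1)) (S.erase j) +
      c * ∑ p ∈ Finset.range m,
        (cumulant φ τ (Function.update μ i (m - 1 - p)) (τ p) (insert i S) +
          ∑ B ∈ S.powerset, cumulant φ τ μ (τ p) B * cumulant φ τ μ (τ (m - 1 - p)) (S \ B)) := by
  rw [Finset.sum_congr rfl fun p _ => (cumulant_mul τ μ hφ p (m - 1 - p) i S hi).symm]
  symm
  refine eq_cumulant τ μ hφ _ (fun S => ∑ j ∈ S, (μ j : ℚ) *
    cumulant φ τ μ (τ (m + μ j - 1)) (S.erase j) + c * ∑ p ∈ Finset.range m,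
        cumulant φ τ μ (τ p * τ (m - 1 - p)) S) S fun T _ => ?_
  rw [moment, h, add_comm]
  simp only [add_mul, Finset.sum_add_distrib, Finset.sum_mul, Finset.mul_sum]
  congr 1
  · rw [sum_powerset_sum_mem T fun j B C => (μ j : ℚ) *
      cumulant φ τ μ (τ (m + μ j - 1)) B * moment φ τ μ 1 C]
    refine Finset.sum_congr rfl fun j _ => ?_
    simp only [mul_assoc, ← Finset.mul_sum]
    rw [sum_cumulant_mul_moment τ _ hφ, moment]
  · rw [Finset.sum_comm]
    refine Finset.sum_congr rfl fun p _ => ?_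
    simp only [mul_assoc, ← Finset.mul_sum]
    rw [sum_cumulant_mul_moment τ _ hφ, moment, mul_assoc]

lemma cumulant_algebraMap (hφ : φ 1 = 1) (c : ℚ) (S : Finset ℕ) :
    cumulant φ τ μ (algebraMap ℚ A c) S = if S = ∅ then c else 0 := by
  symm
  refine eq_cumulant τ μ hφ _ (fun S => if S = ∅ then c else 0) S fun T _ => ?_
  rw [Finset.sum_eq_single ∅]
  · simp [moment, ← Algebra.smul_def]
  · intro B _ hB; simp [hB]
  · simp

end Cumulant

section GenusExpansion

/-- `N tr M^m`, for the generic `N × N` matrix `M`. -/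
noncomputable def scaledTrace (N m : ℕ) : MvPolynomial (Fin N × Fin N) ℚ :=
  (N : ℚ) • (genericMatrix ^ m).trace

/-- The normalised connected correlator of `tr M^m` and the `tr M^(μ i)`, `i ∈ S`. -/
noncomputable def correlator (N m : ℕ) (S : Finset ℕ) (μ : ℕ → ℕ) : ℚ :=
  cumulant (gaussian (N : ℚ)⁻¹) (scaledTrace N) μ (scaledTrace N m) S / N ^ 2

lemma correlator_zero (N : ℕ) (hN : N ≠ 0) (S : Finset ℕ) (μ : ℕ → ℕ) :
    correlator N 0 S μ = if S = ∅ then 1 else 0 := by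
  have h : scaledTrace N 0 = algebraMap ℚ _ ((N : ℚ) ^ 2) := by
    rw [scaledTrace, pow_zero, Matrix.trace_one, Algebra.smul_def]
    simp [sq]
  have : (N : ℚ) ≠ 0 := by exact_mod_cast hN
  rw [correlator, h, cumulant_algebraMap _ _ (gaussian_one _)]
  split_ifs
  · field_simp
  · simp

lemma gaussian_scaledTrace_mul_prod (N : ℕ) (hN : N ≠ 0) (m : ℕ) (S : Finset ℕ) (μ : ℕ → ℕ) :
    gaussian (N : ℚ)⁻¹ (scaledTrace N (m + 1) * ∏ i ∈ S, scaledTrace N (μ i)) =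
      (1 / (N : ℚ) ^ 2) * ∑ p ∈ Finset.range m, gaussian (N : ℚ)⁻¹
        (scaledTrace N p * scaledTrace N (m - 1 - p) * ∏ i ∈ S, scaledTrace N (μ i)) +
      ∑ j ∈ S, (μ j : ℚ) * gaussian (N : ℚ)⁻¹
        (scaledTrace N (m + μ j - 1) * ∏ i ∈ S.erase j, scaledTrace N (μ i)) := by
  have hN' : (N : ℚ) ≠ 0 := by exact_mod_cast hN
  simp only [scaledTrace, Finset.prod_smul, Finset.prod_const, smul_mul_assoc, mul_smul_comm,
    map_smul, smul_eq_mul, ← Finset.mul_sum]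
  rw [gaussian_trace_mul_prod, mul_add, mul_add, mul_add]
  congr 1
  · field_simp
  · simp only [Finset.mul_sum]
    refine Finset.sum_congr rfl fun j hj => ?_
    rw [Finset.card_erase_of_mem hj]
    obtain ⟨d, hd⟩ : ∃ d, S.card = d + 1 := ⟨S.card - 1, by
      have := Finset.card_pos.2 ⟨j, hj⟩; omega⟩
    rw [hd, pow_succ]
    field_simp
    simp only [Nat.add_sub_cancel]
    ring

lemma correlator_succ (N : ℕ) (hN : N ≠ 0) (m : ℕ) (S : Finset ℕ) (μ : ℕ → ℕ) (i : ℕ)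
    (hi : i ∉ S) :
    correlator N (m + 1) S μ = ∑ j ∈ S, (μ j : ℚ) * correlator N (m + μ j - 1) (S.erase j) μ +
      ∑ p ∈ Finset.range m, (1 / (N : ℚ) ^ 2 *
        correlator N p (insert i S) (Function.update μ i (m - 1 - p)) +
        ∑ B ∈ S.powerset, correlator N p B μ * correlator N (m - 1 - p) (S \ B) μ) := by
  have hN' : (N : ℚ) ≠ 0 := by exact_mod_cast hN
  simp only [correlator]
  rw [cumulant_succ _ _ (gaussian_one _) (1 / (N : ℚ) ^ 2) m
    (fun S => gaussian_scaledTrace_mul_prod N hN m S μ) S i hi, add_div, Finset.sum_div,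
    Finset.mul_sum, Finset.sum_div]
  congr 1
  · exact Finset.sum_congr rfl fun j _ => by ring
  · refine Finset.sum_congr rfl fun p _ => ?_
    rw [mul_add, add_div]
    congr 1
    · ring
    · rw [Finset.mul_sum, Finset.sum_div]
      exact Finset.sum_congr rfl fun B _ => by field_simp

lemma exists_notMem (S : Finset ℕ) : ∃ i, i ∉ S := Infinite.exists_notMem_finset S

lemma exists_correlator_eq_eval (m : ℕ) (S : Finset ℕ) (μ : ℕ → ℕ) :
    ∃ P : Polynomial ℚ, ∀ N : ℕ, N ≠ 0 → correlator N m S μ = P.eval (1 / (N : ℚ) ^ 2) := by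
  induction h : m + ∑ i ∈ S, μ i using Nat.strong_induction_on generalizing m S μ with
  | _ d ih =>
  subst h
  obtain _ | m := m
  · refine ⟨if S = ∅ then 1 else 0, fun N hN => ?_⟩
    rw [correlator_zero N hN]
    split_ifs <;> simp
  obtain ⟨i, hi⟩ := exists_notMem S
  have h1 : ∀ j ∈ S, ∃ P : Polynomial ℚ, ∀ N : ℕ, N ≠ 0 →
      (μ j : ℚ) * correlator N (m + μ j - 1) (S.erase j) μ = P.eval (1 / (N : ℚ) ^ 2) := by
    intro j hj
    rcases Nat.eq_zero_or_pos (μ j) with h0 | h0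
    · exact ⟨0, fun N _ => by simp [h0]⟩
    · have := Finset.add_sum_erase S μ hj
      obtain ⟨P, hP⟩ := ih _ (by omega) (m + μ j - 1) (S.erase j) μ rfl
      exact ⟨(μ j : Polynomial ℚ) * P, fun N hN => by rw [hP N hN]; simp⟩
  have h2 : ∀ p ∈ Finset.range m, ∃ P : Polynomial ℚ, ∀ N : ℕ, N ≠ 0 →
      correlator N p (insert i S) (Function.update μ i (m - 1 - p)) =
        P.eval (1 / (N : ℚ) ^ 2) := by
    intro p hp
    have hp := Finset.mem_range.1 hp
    refine ih _ ?_ _ _ _ rfl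
    rw [Finset.sum_insert hi, Function.update_self,
      Finset.sum_congr rfl fun j hj => Function.update_of_ne (ne_of_mem_of_not_mem hj hi) _ _]
    omega
  have h3 : ∀ p < m, ∀ B ⊆ S, ∃ P : Polynomial ℚ, ∀ N : ℕ, N ≠ 0 →
      correlator N p B μ = P.eval (1 / (N : ℚ) ^ 2) := by
    intro p hp B hB
    refine ih _ ?_ _ _ _ rfl
    have : ∑ i ∈ B, μ i ≤ ∑ i ∈ S, μ i := Finset.sum_le_sum_of_subset hB
    omega
  choose! P1 hP1 using h1
  choose! P2 hP2 using h2
  choose! P3 hP3 using h3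
  refine ⟨∑ j ∈ S, P1 j + ∑ p ∈ Finset.range m, (Polynomial.X * P2 p +
    ∑ B ∈ S.powerset, P3 p B * P3 (m - 1 - p) (S \ B)), fun N hN => ?_⟩
  rw [correlator_succ N hN m S μ i hi]
  simp only [Polynomial.eval_add, Polynomial.eval_finsetSum, Polynomial.eval_mul, Polynomial.eval_X]
  congr 1
  · exact Finset.sum_congr rfl fun j hj => hP1 j hj N hN
  · refine Finset.sum_congr rfl fun p hp => ?_
    rw [hP2 p hp N hN]
    have hp := Finset.mem_range.1 hp
    congr 1
    refine Finset.sum_congr rfl fun B hB => ?_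
    rw [hP3 p hp B (Finset.mem_powerset.1 hB) N hN,
      hP3 (m - 1 - p) (by omega) (S \ B) Finset.sdiff_subset N hN]

/-- The polynomial in `N⁻²` giving the normalised connected correlator. -/
noncomputable def genusPoly (m : ℕ) (S : Finset ℕ) (μ : ℕ → ℕ) : Polynomial ℚ :=
  (exists_correlator_eq_eval m S μ).choose

lemma correlator_eq_eval (m : ℕ) (S : Finset ℕ) (μ : ℕ → ℕ) (N : ℕ) (hN : N ≠ 0) :
    correlator N m S μ = (genusPoly m S μ).eval (1 / (N : ℚ) ^ 2) :=
  (exists_correlator_eq_eval m S μ).choose_spec N hN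

lemma polynomial_ext_inv_sq {P Q : Polynomial ℚ}
    (h : ∀ N : ℕ, N ≠ 0 → P.eval (1 / (N : ℚ) ^ 2) = Q.eval (1 / (N : ℚ) ^ 2)) : P = Q := by
  refine Polynomial.eq_of_infinite_eval_eq P Q
    (Set.Infinite.mono (s := Set.range fun N : ℕ => 1 / ((N + 1 : ℕ) : ℚ) ^ 2) ?_ ?_)
  · rintro _ ⟨N, rfl⟩
    exact h (N + 1) (by omega)
  · refine Set.infinite_range_of_injective fun a b hab => ?_
    simp only [one_div, inv_inj] at hab
    have := (sq_eq_sq₀ (Nat.cast_nonneg (α := ℚ) _) (Nat.cast_nonneg _)).1 hab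
    exact Nat.succ_injective (by exact_mod_cast this)

lemma genusPoly_zero (S : Finset ℕ) (μ : ℕ → ℕ) :
    genusPoly 0 S μ = if S = ∅ then 1 else 0 := by
  refine polynomial_ext_inv_sq fun N hN => ?_
  rw [← correlator_eq_eval _ _ _ N hN, correlator_zero N hN]
  split_ifs <;> simp

lemma genusPoly_succ (m : ℕ) (S : Finset ℕ) (μ : ℕ → ℕ) (i : ℕ) (hi : i ∉ S) :
    genusPoly (m + 1) S μ = ∑ j ∈ S, (μ j : ℚ) • genusPoly (m + μ j - 1) (S.erase j) μ +
      ∑ p ∈ Finset.range m, (Polynomial.X *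
        genusPoly p (insert i S) (Function.update μ i (m - 1 - p)) +
        ∑ B ∈ S.powerset, genusPoly p B μ * genusPoly (m - 1 - p) (S \ B) μ) := by
  refine polynomial_ext_inv_sq fun N hN => ?_
  simp only [Polynomial.eval_add, Polynomial.eval_finsetSum, Polynomial.eval_mul, Polynomial.eval_X,
    Polynomial.eval_smul, smul_eq_mul, ← correlator_eq_eval _ _ _ N hN]
  exact correlator_succ N hN m S μ i hi

end GenusExpansion

section Series

/-- The expansion of `(1 - 4 t ^ 2) ^ (-1 / 2)`. -/
noncomputable def invSqrt : ℚ⟦X⟧ :=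
  mk fun n => if Even n then (Nat.centralBinom (n / 2) : ℚ) else 0

/-- The expansion of `t / (1 - 2 ε t)`. -/
noncomputable def geom (ε : ℚ) : ℚ⟦X⟧ := X * mk fun n => (2 * ε) ^ n

lemma derivative_invSqrt_mul : d⁄dX ℚ invSqrt * (1 - 4 * X ^ 2) = 4 * X * invSqrt := by
  have key : d⁄dX ℚ invSqrt = X * (4 * invSqrt + 4 * (X * d⁄dX ℚ invSqrt)) := by
    ext n
    have h4 : (4 : ℚ⟦X⟧) = C 4 := (map_ofNat C 4).symm
    rcases n with _ | n
    · simp [coeff_derivative, invSqrt, coeff_mk]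
    · rw [coeff_succ_X_mul, map_add, h4, coeff_C_mul, coeff_C_mul, coeff_derivative]
      have hX : coeff n (X * d⁄dX ℚ invSqrt) = n * coeff n invSqrt := by
        rcases n with _ | n
        · simp
        · rw [coeff_succ_X_mul, coeff_derivative]; push_cast; ring
      rw [hX, invSqrt, coeff_mk, coeff_mk]
      rcases Nat.even_or_odd' n with ⟨a, rfl | rfl⟩
      · have h := Nat.succ_mul_centralBinom_succ a
        have h1 : (2 * a + 1 + 1) / 2 = a + 1 := by omega
        have h2 : Even (2 * a + 1 + 1) := ⟨a + 1, by ring⟩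
        simp only [h1, h2, if_true, even_two_mul]
        rw [Nat.mul_div_cancel_left _ two_pos]
        have h' : ((a : ℚ) + 1) * (a + 1).centralBinom = 2 * (2 * a + 1) * a.centralBinom := by
          exact_mod_cast h
        push_cast
        linear_combination 2 * h'
      · have h2 : ¬ Even (2 * a + 1 + 1 + 1) := by
          rw [Nat.not_even_iff_odd]; exact ⟨a + 1, by ring⟩
        simp [h2]
  linear_combination key

lemma invSqrt_sq_mul : invSqrt ^ 2 * (1 - 4 * X ^ 2) = 1 := by
  have h4 : (4 : ℚ⟦X⟧) = C 4 := (map_ofNat C 4).symm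
  refine derivative.ext ?_ ?_
  · have hd4 : d⁄dX ℚ (4 : ℚ⟦X⟧) = 0 := by rw [h4, derivative_C]
    simp only [Derivation.leibniz, map_sub, derivative_pow, derivative_one, derivative_X,
      smul_eq_mul, hd4]
    linear_combination (2 * invSqrt) * derivative_invSqrt_mul
  · simp [invSqrt, constantCoeff_mk]

lemma derivative_invSqrt : d⁄dX ℚ invSqrt = 4 * X * invSqrt ^ 3 := by
  linear_combination (invSqrt ^ 2) * derivative_invSqrt_mul - d⁄dX ℚ invSqrt * invSqrt_sq_mul

lemma geom_mul (ε : ℚ) : geom ε * (1 - 2 * C ε * X) = X := by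
  have : (mk fun n => (2 * ε) ^ n : ℚ⟦X⟧) = 1 + 2 * C ε * X * mk fun n => (2 * ε) ^ n := by
    ext n
    have h2 : (2 * C ε : ℚ⟦X⟧) = C (2 * ε) := by rw [map_mul, map_ofNat]
    rw [map_add, h2, mul_assoc, coeff_C_mul]
    rcases n with _ | n
    · simp
    · rw [coeff_succ_X_mul, coeff_mk, coeff_mk, coeff_one, if_neg n.succ_ne_zero]; ring
  rw [geom]
  linear_combination X * this

lemma isUnit_one_sub_mul_X (ε : ℚ) : IsUnit (1 - 2 * C ε * X : ℚ⟦X⟧) := by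
  rw [isUnit_iff_constantCoeff]
  simp

lemma sq_C {ε : ℚ} (hε : ε ^ 2 = 1) : (C ε : ℚ⟦X⟧) ^ 2 = 1 := by
  rw [← map_pow, hε, map_one]

lemma geom_sub_geom_neg (ε : ℚ) :
    geom ε - geom (-ε) = 4 * C ε * (geom ε * geom (-ε)) := by
  have h2 := geom_mul (-ε)
  rw [map_neg] at h2
  refine (isUnit_one_sub_mul_X ε).mul_left_cancel ((isUnit_one_sub_mul_X (-ε)).mul_left_cancel ?_)
  rw [map_neg]
  linear_combination (1 + 2 * C ε * X - 4 * C ε * geom (-ε) * (1 + 2 * C ε * X)) * geom_mul ε -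
    (1 - 2 * C ε * X + 4 * C ε * X) * h2

lemma geom_mul_geom_neg {ε : ℚ} (hε : ε ^ 2 = 1) :
    geom ε * geom (-ε) = X ^ 2 * invSqrt ^ 2 := by
  have h2 := geom_mul (-ε)
  rw [map_neg] at h2
  refine (isUnit_one_sub_mul_X ε).mul_left_cancel ((isUnit_one_sub_mul_X (-ε)).mul_left_cancel ?_)
  rw [map_neg]
  linear_combination (geom (-ε) * (1 + 2 * C ε * X)) * geom_mul ε + X * h2 -
    X ^ 2 * invSqrt_sq_mul + 4 * X ^ 4 * invSqrt ^ 2 * sq_C hε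

lemma mul_geom_pow_succ {ε : ℚ} (hε : ε ^ 2 = 1) (d : ℕ) :
    (geom ε * geom (-ε)) * geom ε ^ (d + 1) =
      C (ε / 4) * (geom ε ^ (d + 2) - (geom ε * geom (-ε)) * geom ε ^ d) := by
  have h4 : (4 : ℚ⟦X⟧) * C (ε / 4) = C ε := by
    rw [← map_ofNat C 4, ← map_mul]; congr 1; ring
  linear_combination -(C (ε / 4) * geom ε ^ (d + 1)) * geom_sub_geom_neg ε -
    (C ε * geom ε * geom (-ε) * geom ε ^ (d + 1)) * h4 -
    (geom ε * geom (-ε) * geom ε ^ (d + 1)) * sq_C hε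

/-- The span of the powers `(t / (1 ∓ 2 t)) ^ k` with `k ≤ D`. -/
noncomputable def geomSpan (D : ℕ) : Submodule ℚ ℚ⟦X⟧ :=
  Submodule.span ℚ {f | ∃ ε : ℚ, ∃ k : ℕ, ε ^ 2 = 1 ∧ k ≤ D ∧ f = geom ε ^ k}

lemma geom_pow_mem {ε : ℚ} (hε : ε ^ 2 = 1) {k D : ℕ} (h : k ≤ D) : geom ε ^ k ∈ geomSpan D :=
  Submodule.subset_span ⟨ε, k, hε, h, rfl⟩

lemma geomSpan_mono {D E : ℕ} (h : D ≤ E) : geomSpan D ≤ geomSpan E :=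
  Submodule.span_mono fun _ ⟨ε, k, hε, hk, hf⟩ => ⟨ε, k, hε, hk.trans h, hf⟩

lemma C_mul_mem {D : ℕ} (a : ℚ) {f : ℚ⟦X⟧} (hf : f ∈ geomSpan D) : C a * f ∈ geomSpan D := by
  rw [← smul_eq_C_mul]
  exact Submodule.smul_mem _ _ hf

lemma geom_pow_mul_geom_neg_pow_mem {ε : ℚ} (hε : ε ^ 2 = 1) (i j : ℕ) :
    geom ε ^ i * geom (-ε) ^ j ∈ geomSpan (i + j) := by
  have h4 : (4 : ℚ⟦X⟧) * C (ε / 4) = C ε := by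
    rw [← map_ofNat C 4, ← map_mul]; congr 1; ring
  induction hn : i + j using Nat.strong_induction_on generalizing i j with
  | _ n ih =>
    subst hn
    rcases i with _ | i
    · simpa using geom_pow_mem (ε := -ε) (by simpa using hε) le_rfl
    rcases j with _ | j
    · simpa using geom_pow_mem hε le_rfl
    have e : geom ε ^ (i + 1) * geom (-ε) ^ (j + 1) = C (ε / 4) *
        (geom ε ^ (i + 1) * geom (-ε) ^ j - geom ε ^ i * geom (-ε) ^ (j + 1)) := by
      linear_combination -(C (ε / 4) * geom ε ^ i * geom (-ε) ^ j) * geom_sub_geom_neg ε -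
        (C ε * geom ε * geom (-ε) * geom ε ^ i * geom (-ε) ^ j) * h4 -
        (geom ε * geom (-ε) * geom ε ^ i * geom (-ε) ^ j) * sq_C hε
    rw [e]
    exact C_mul_mem _ (Submodule.sub_mem _
      (geomSpan_mono (by omega) (ih (i + 1 + j) (by omega) _ _ rfl))
      (geomSpan_mono (by omega) (ih (i + (j + 1)) (by omega) _ _ rfl)))

lemma eq_or_eq_neg_of_sq {ε η : ℚ} (hε : ε ^ 2 = 1) (hη : η ^ 2 = 1) : η = ε ∨ η = -ε :=
  sq_eq_sq_iff_eq_or_eq_neg.1 (hη.trans hε.symm)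

lemma geomSpan_mul_mem {a b : ℕ} {f g : ℚ⟦X⟧} (hf : f ∈ geomSpan a) (hg : g ∈ geomSpan b) :
    f * g ∈ geomSpan (a + b) := by
  suffices geomSpan a * geomSpan b ≤ geomSpan (a + b) from this (Submodule.mul_mem_mul hf hg)
  rw [geomSpan, geomSpan, Submodule.span_mul_span, Submodule.span_le]
  rintro _ ⟨_, ⟨ε, i, hε, hi, rfl⟩, _, ⟨η, j, hη, hj, rfl⟩, rfl⟩
  rcases eq_or_eq_neg_of_sq hε hη with rfl | rfl
  · change geom η ^ i * geom η ^ j ∈ geomSpan (a + b)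
    rw [← pow_add]
    exact geom_pow_mem hε (by omega)
  · exact geomSpan_mono (by omega) (geom_pow_mul_geom_neg_pow_mem hε i j)

lemma X_sq_mul_invSqrt_sq_mem : X ^ 2 * invSqrt ^ 2 ∈ geomSpan 1 := by
  have hε : (1 : ℚ) ^ 2 = 1 := one_pow 2
  rw [← geom_mul_geom_neg hε, show geom 1 * geom (-1) = C (1 / 4) * (geom 1 ^ 1 - geom (-1) ^ 1) by
    have h4 : (4 : ℚ⟦X⟧) * C (1 / 4) = 1 := by
      rw [← map_ofNat C 4, ← map_mul, ← map_one C]; congr 1; norm_num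
    have := geom_sub_geom_neg 1
    rw [map_one] at this
    linear_combination -C (1 / 4) * this - geom 1 * geom (-1) * h4]
  exact C_mul_mem _ (Submodule.sub_mem _ (geom_pow_mem hε le_rfl)
    (geom_pow_mem (by norm_num) le_rfl))

end Series

section Bivariate

/-- The generating series in the first argument of `n * f (m + n - 2)`. -/
noncomputable def mergeSeries (n : ℕ) (f : ℚ⟦X⟧) : ℚ⟦X⟧ :=
  X * mk fun m => (n : ℚ) * coeff (m + n - 1) f

/-- The contribution to a stable generating series of merging with a vertex of valency `n`,
including the two-point unstable factor; `c` is the one-point planar series. -/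
noncomputable def mergeOp (c : ℚ⟦X⟧) (n : ℕ) (f : ℚ⟦X⟧) : ℚ⟦X⟧ :=
  invSqrt * (mergeSeries n f + 2 * X ^ 2 * (invSqrt * mergeSeries n c) * f)

/-- A series in the second of two variables. -/
noncomputable abbrev sndVar : ℚ⟦X⟧ →+* ℚ⟦X⟧⟦X⟧ := map C

lemma derivative_sndVar (f : ℚ⟦X⟧) : d⁄dX ℚ⟦X⟧ (sndVar f) = sndVar (d⁄dX ℚ f) := by
  ext1 n
  simp [coeff_derivative, coeff_map]

noncomputable def shiftSeries (f : ℚ⟦X⟧) : ℚ⟦X⟧⟦X⟧ := mk fun n => mk fun m => coeff (m + n) f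

lemma sub_mul_shiftSeries (f : ℚ⟦X⟧) :
    (C X - X) * shiftSeries f = C (X * f) - X * sndVar f := by
  ext1 n
  rw [sub_mul, map_sub, map_sub, coeff_C_mul]
  rcases n with _ | n
  · ext m
    rcases m with _ | m <;> simp [shiftSeries, coeff_succ_X_mul]
  · rw [coeff_succ_X_mul, coeff_succ_X_mul, coeff_C, if_neg n.succ_ne_zero, coeff_map]
    ext m
    rcases m with _ | m
    · simp [shiftSeries]
    · simp only [shiftSeries, coeff_mk, map_sub, coeff_succ_X_mul, coeff_C, map_zero]
      rw [if_neg m.succ_ne_zero, show m + (n + 1) = m + 1 + n by ring]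
      ring

lemma mk_mergeSeries (f : ℚ⟦X⟧) : (mk fun n => mergeSeries n f) =
    C X * X * (shiftSeries f + X * d⁄dX ℚ⟦X⟧ (shiftSeries f)) := by
  ext1 n
  rw [coeff_mk, mul_assoc, coeff_C_mul]
  rcases n with _ | n
  · simp [mergeSeries]
    ext; simp
  · rw [coeff_succ_X_mul, map_add, mergeSeries]
    congr 1
    have : coeff n (X * d⁄dX ℚ⟦X⟧ (shiftSeries f)) = n * coeff n (shiftSeries f) := by
      rcases n with _ | n
      · simp
      · rw [coeff_succ_X_mul, coeff_derivative]; push_cast; ring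
    rw [this, shiftSeries, coeff_mk]
    ext m
    have hn : (n : ℚ⟦X⟧) = C (n : ℚ) := (map_natCast C n).symm
    rw [hn, map_add, coeff_C_mul, coeff_mk, coeff_mk, ← add_assoc, Nat.add_sub_cancel]
    push_cast; ring

lemma sub_sq_mul_mk_mergeSeries (f : ℚ⟦X⟧) : (C X - X) ^ 2 * (mk fun n => mergeSeries n f) =
    C X * X * (C (X ^ 2 * f) - sndVar (X ^ 2 * f) - (C X - X) * sndVar (d⁄dX ℚ (X ^ 2 * f))) := by
  have h1 := sub_mul_shiftSeries f
  have h2 := congrArg (d⁄dX ℚ⟦X⟧) h1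
  simp only [Derivation.leibniz, map_sub, derivative_X, derivative_sndVar,
    smul_eq_mul, derivative_C, derivative_pow] at h2 ⊢
  rw [mk_mergeSeries]
  have hX : sndVar (X : ℚ⟦X⟧) = X := map_X _
  simp only [map_mul, map_add, map_pow, hX, map_one, map_natCast] at h1 h2 ⊢
  linear_combination (C X * X * (C X - X) + C X * X ^ 2) * h1 + C X * X ^ 2 * (C X - X) * h2

/-- The image `b` of a series `G` under the bidifferential that governs `mergeOp`. -/
def IsMergeKernel (G : ℚ⟦X⟧) (b : ℚ⟦X⟧⟦X⟧) : Prop :=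
  (C X - X) ^ 2 * b = C X * X * ((1 - 4 * C X * X) * (C G - sndVar G) -
    (C X - X) * (1 - 4 * X ^ 2) * sndVar (d⁄dX ℚ G))

lemma IsMergeKernel.add {G G' : ℚ⟦X⟧} {b b' : ℚ⟦X⟧⟦X⟧} (h : IsMergeKernel G b)
    (h' : IsMergeKernel G' b') : IsMergeKernel (G + G') (b + b') := by
  unfold IsMergeKernel at *
  simp only [map_add]
  linear_combination h + h'

lemma IsMergeKernel.C_mul {G : ℚ⟦X⟧} {b : ℚ⟦X⟧⟦X⟧} (a : ℚ) (h : IsMergeKernel G b) :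
    IsMergeKernel (C a * G) (C (C a) * b) := by
  unfold IsMergeKernel at *
  have : sndVar (C a) = C (C a) := map_C _ _
  simp only [map_mul, Derivation.leibniz, derivative_C, smul_eq_mul, mul_zero, add_zero, this]
  linear_combination C (C a) * h

lemma derivative_sqrt : d⁄dX ℚ ((1 - 4 * X ^ 2) * invSqrt) = -4 * X * invSqrt := by
  have hd4 : d⁄dX ℚ (4 : ℚ⟦X⟧) = 0 := by rw [← map_ofNat C 4, derivative_C]
  simp only [Derivation.leibniz, map_sub, derivative_pow, derivative_one, derivative_X,
      smul_eq_mul, hd4]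
  push_cast
  linear_combination derivative_invSqrt_mul

lemma mk_mergeOp_eq {c : ℚ⟦X⟧} (hc : 1 - 2 * X ^ 2 * c = (1 - 4 * X ^ 2) * invSqrt)
    {f G : ℚ⟦X⟧} (hf : X ^ 2 * f = (1 - 4 * X ^ 2) * invSqrt * G) {b : ℚ⟦X⟧⟦X⟧}
    (hb : IsMergeKernel G b) :
    (mk fun n => mergeOp c n f) = C invSqrt * sndVar invSqrt * b := by
  have hX : sndVar (X : ℚ⟦X⟧) = X := map_X _
  have h4 : sndVar 4 = 4 := map_ofNat _ 4
  have h4' : (C (4 : ℚ⟦X⟧) : ℚ⟦X⟧⟦X⟧) = 4 := map_ofNat _ 4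
  have hne : (C X - X : ℚ⟦X⟧⟦X⟧) ≠ 0 := fun h => by
    have := congrArg (coeff 1) h
    simp at this
  have e : (mk fun n => mergeOp c n f) = C invSqrt * ((mk fun n => mergeSeries n f) +
      2 * C X ^ 2 * (C invSqrt * mk fun n => mergeSeries n c) * C f) := by
    ext1 n
    rw [coeff_mk, coeff_C_mul, map_add, coeff_mk, show 2 * C X ^ 2 * (C invSqrt *
      mk fun n => mergeSeries n c) * C f = C (2 * X ^ 2 * invSqrt * f) *
      (mk fun n => mergeSeries n c) by simp only [map_mul, map_pow, map_ofNat]; ring, coeff_C_mul,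
      coeff_mk, mergeOp]
    ring
  refine mul_left_cancel₀ (pow_ne_zero 2 hne) ?_
  have hδ := congrArg (C (R := ℚ⟦X⟧)) invSqrt_sq_mul
  have h1 := sub_sq_mul_mk_mergeSeries f
  have h2 := sub_sq_mul_mk_mergeSeries c
  have hc' : X ^ 2 * c = C (1 / 2) * (1 - (1 - 4 * X ^ 2) * invSqrt) := by
    have : (2 : ℚ⟦X⟧) * C (1 / 2) = 1 := by
      rw [← map_ofNat C 2, ← map_mul, ← map_one C]; congr 1; norm_num
    linear_combination -C (1 / 2) * hc - X ^ 2 * c * this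
  have hh : (2 : ℚ⟦X⟧⟦X⟧) * C (C (1 / 2)) = 1 := by
    rw [← map_ofNat C 2, ← map_ofNat C 2, ← map_mul, ← map_mul, ← map_one C, ← map_one C]
    congr 2; norm_num
  have hs : sndVar (C (1 / 2)) = C (C (1 / 2)) := map_C _ _
  rw [hf, Derivation.leibniz, derivative_sqrt] at h1
  rw [hc', Derivation.leibniz, derivative_C, map_sub, derivative_one, derivative_sqrt] at h2
  have hf1 := congrArg (C (R := ℚ⟦X⟧)) hf
  unfold IsMergeKernel at hb
  simp only [smul_eq_mul, map_mul, map_sub, map_add, map_pow, hX, h4, h4', map_one, map_neg, map_zero, hs]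
    at h1 h2 hδ hf1
  rw [e]
  linear_combination (C invSqrt) * h1 + (2 * C X ^ 2 * C invSqrt ^ 2 * C f) * h2 -
    C invSqrt * sndVar invSqrt * hb - C X * X * C invSqrt ^ 2 * ((1 - 4 * C X ^ 2) * C invSqrt -
      (1 - 4 * C X * X) * sndVar invSqrt) *
      (2 * C (C (1 / 2)) * hf1 + (1 - 4 * C X ^ 2) * C invSqrt * C G * hh) -
    C X * X * C invSqrt * C G * ((1 - 4 * C X ^ 2) * C invSqrt -
      (1 - 4 * C X * X) * sndVar invSqrt) * hδ

end Bivariate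

section MergeKernel

/-- The merge kernel of `geom ε ^ k`. -/
noncomputable def geomKernel (ε : ℚ) : ℕ → ℚ⟦X⟧⟦X⟧
  | 0 => 0
  | k + 1 => C (geom ε) * geomKernel ε k +
      k * C (geom ε) * sndVar (geom ε) ^ k * (1 + 4 * C (C ε) * sndVar (geom ε)) +
      2 * C (C ε) * C (geom ε) * sndVar (geom ε) ^ (k + 1)

lemma derivative_geom (ε : ℚ) : d⁄dX ℚ (geom ε) = (1 + 2 * C ε * geom ε) ^ 2 := by
  have h := geom_mul ε
  have hd2 : d⁄dX ℚ (2 : ℚ⟦X⟧) = 0 := by rw [← map_ofNat C 2, derivative_C]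
  have h1 := congrArg (d⁄dX ℚ) h
  simp only [Derivation.leibniz, map_sub, derivative_one, derivative_X, smul_eq_mul, derivative_C,
    hd2] at h1
  linear_combination (1 + 2 * C ε * geom ε) * h1 - 2 * C ε * (d⁄dX ℚ (geom ε)) * h

lemma one_sub_mul_derivative_geom {ε : ℚ} (hε : ε ^ 2 = 1) :
    (1 - 4 * X ^ 2) * d⁄dX ℚ (geom ε) = 1 + 4 * C ε * geom ε := by
  have h := geom_mul ε
  have h2 := sq_C hε
  rw [derivative_geom]
  linear_combination (2 * C ε * (1 + 2 * C ε * X) * (1 + 2 * C ε * geom ε) - 2 * C ε) * h +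
    4 * X ^ 2 * (1 + 2 * C ε * geom ε) ^ 2 * h2

lemma isMergeKernel_geomKernel {ε : ℚ} (hε : ε ^ 2 = 1) (k : ℕ) :
    IsMergeKernel (geom ε ^ k) (geomKernel ε k) := by
  have hX : sndVar (X : ℚ⟦X⟧) = X := map_X _
  have hs : sndVar (C ε) = C (C ε) := map_C _ _
  have h1 := congrArg (C (R := ℚ⟦X⟧)) (geom_mul ε)
  have h2 := congrArg sndVar (geom_mul ε)
  have h3 := congrArg sndVar (one_sub_mul_derivative_geom hε)
  have he := congrArg (C (R := ℚ⟦X⟧)) (sq_C hε)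
  simp only [map_mul, map_add, map_sub, map_one, map_pow, hX, hs, map_ofNat] at h1 h2 h3 he
  induction k with
  | zero => simp [IsMergeKernel, geomKernel]
  | succ k ih =>
    unfold IsMergeKernel at *
    obtain ⟨Q, hQ, hQ'⟩ : ∃ Q : ℚ⟦X⟧⟦X⟧, Q * sndVar (geom ε) = k * sndVar (geom ε) ^ k ∧
        sndVar (d⁄dX ℚ (geom ε ^ k)) = Q * sndVar (d⁄dX ℚ (geom ε)) := by
      refine ⟨k * sndVar (geom ε) ^ (k - 1), ?_, ?_⟩
      · rcases k with _ | k
        · simp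
        · simp [pow_succ, mul_assoc]
      · rw [derivative_pow]; simp
    rw [hQ'] at ih
    have hk : sndVar (d⁄dX ℚ (geom ε ^ (k + 1))) =
        (k + 1) * sndVar (geom ε) ^ k * sndVar (d⁄dX ℚ (geom ε)) := by
      rw [derivative_pow]; simp
    rw [hk, geomKernel]
    simp only [map_pow] at ih ⊢
    have L1 : C X * X * (C (geom ε) - sndVar (geom ε)) =
        (C X - X) * C (geom ε) * sndVar (geom ε) := by
      linear_combination X * sndVar (geom ε) * h1 - C X * C (geom ε) * h2
    have L3 : (1 - 4 * C X * X) * C (geom ε) * sndVar (geom ε) =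
        C X * X * (1 + 2 * C (C ε) * (C (geom ε) + sndVar (geom ε))) := by
      linear_combination sndVar (geom ε) * h1 + C X * (1 + 2 * C (C ε) * C (geom ε)) * h2 +
        4 * C X * X * C (geom ε) * sndVar (geom ε) * he
    linear_combination C (geom ε) * ih -
      Q * ((C X - X) * (1 - 4 * X ^ 2) * sndVar (d⁄dX ℚ (geom ε)) * L1 +
        (C X - X) ^ 2 * C (geom ε) * sndVar (geom ε) * h3) +
      sndVar (geom ε) ^ k * (C X * X * (C X - X) * h3 - (1 - 4 * C X * X) * L1 -
        (C X - X) * (2 * C (C ε) * L1 + L3)) -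
      ((C X - X) ^ 2 * C (geom ε) * (1 + 4 * C (C ε) * sndVar (geom ε)) +
        C X * X * (C X - X) * (1 - 4 * X ^ 2) * sndVar (d⁄dX ℚ (geom ε))) * hQ

/-- The span of the functions `n ↦ ([tⁿ] δ u') δ u` for `u`, `u'` powers of `t / (1 ∓ 2 t)` of
total degree at most `D`, where `δ = (1 - 4 t ^ 2) ^ (-1 / 2)`. -/
noncomputable def mergeSpan (D : ℕ) : Submodule ℚ (ℕ → ℚ⟦X⟧) :=
  Submodule.span ℚ {F | ∃ ε η : ℚ, ∃ i j : ℕ, ε ^ 2 = 1 ∧ η ^ 2 = 1 ∧ i + j ≤ D ∧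
    F = fun n => coeff n (invSqrt * geom η ^ j) • (invSqrt * geom ε ^ i)}

/-- The coefficients in the second variable, after multiplication by `δ` in both variables. -/
noncomputable def coeffFun : ℚ⟦X⟧⟦X⟧ →ₗ[ℚ] (ℕ → ℚ⟦X⟧) where
  toFun b n := coeff n (C invSqrt * sndVar invSqrt * b)
  map_add' b b' := by ext1 n; simp [mul_add]
  map_smul' a b := by
    ext1 n
    simp only [mul_smul_comm, RingHom.id_apply, Pi.smul_apply]
    rfl

lemma coeffFun_apply (b : ℚ⟦X⟧⟦X⟧) (n : ℕ) :
    coeffFun b n = coeff n (C invSqrt * sndVar invSqrt * b) := rfl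

lemma coeffFun_mul (f g : ℚ⟦X⟧) (n : ℕ) :
    coeffFun (C f * sndVar g) n = coeff n (invSqrt * g) • (invSqrt * f) := by
  rw [coeffFun_apply, show C invSqrt * sndVar invSqrt * (C f * sndVar g) =
    C (invSqrt * f) * sndVar (invSqrt * g) by simp only [map_mul]; ring, coeff_C_mul, coeff_map,
    smul_eq_C_mul, mul_comm]

lemma coeffFun_C_C_mul (a : ℚ) (b : ℚ⟦X⟧⟦X⟧) : coeffFun (C (C a) * b) = a • coeffFun b := by
  ext1 n
  rw [coeffFun_apply, mul_left_comm, coeff_C_mul, Pi.smul_apply, smul_eq_C_mul, coeffFun_apply]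

lemma coeffFun_geomKernel_mem {ε : ℚ} (hε : ε ^ 2 = 1) (k : ℕ) :
    coeffFun (geomKernel ε k) ∈ mergeSpan (k + 1) := by
  suffices geomKernel ε k ∈ Submodule.span ℚ {b | ∃ i j : ℕ, i + j ≤ k + 1 ∧
      b = C (geom ε ^ i) * sndVar (geom ε ^ j)} by
    refine (Submodule.span_le.2 ?_ : _ ≤ (mergeSpan (k + 1)).comap coeffFun) this
    rintro _ ⟨i, j, hij, rfl⟩
    refine Submodule.subset_span ⟨ε, ε, i, j, hε, hε, hij, ?_⟩
    ext1 n
    exact coeffFun_mul _ _ n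
  induction k with
  | zero => exact Submodule.zero_mem _
  | succ k ih =>
    have mem (a : ℚ) (i j : ℕ) (h : i + j ≤ k + 1 + 1) : a • (C (geom ε ^ i) * sndVar (geom ε ^ j)) ∈
        Submodule.span ℚ {b | ∃ i j : ℕ, i + j ≤ k + 1 + 1 ∧
          b = C (geom ε ^ i) * sndVar (geom ε ^ j)} :=
      Submodule.smul_mem _ _ (Submodule.subset_span ⟨i, j, h, rfl⟩)
    have hsm (a : ℚ) (b : ℚ⟦X⟧⟦X⟧) : a • b = C (C a) * b := by
      ext1 n
      rw [coeff_C_mul, ← smul_eq_C_mul]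
      rfl
    have e : geomKernel ε (k + 1) = C (geom ε) * geomKernel ε k +
        ((k : ℚ) • (C (geom ε ^ 1) * sndVar (geom ε ^ k)) +
        (4 * k * ε) • (C (geom ε ^ 1) * sndVar (geom ε ^ (k + 1))) +
        (2 * ε) • (C (geom ε ^ 1) * sndVar (geom ε ^ (k + 1)))) := by
      rw [geomKernel, hsm, hsm, hsm]
      simp only [map_mul, map_pow, map_ofNat, map_natCast]
      ring
    rw [e]
    refine Submodule.add_mem _ ?_ (Submodule.add_mem _ (Submodule.add_mem _
      (mem _ _ _ (by omega)) (mem _ _ _ (by omega))) (mem _ _ _ (by omega)))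
    refine (Submodule.span_le.2 ?_ : _ ≤ (Submodule.span ℚ {b | ∃ i j : ℕ, i + j ≤ k + 1 + 1 ∧
          b = C (geom ε ^ i) * sndVar (geom ε ^ j)}).comap
          (LinearMap.mulLeft ℚ (C (geom ε)))) ih
    rintro _ ⟨i, j, hij, rfl⟩
    refine Submodule.subset_span ⟨i + 1, j, by omega, ?_⟩
    rw [LinearMap.mulLeft_apply, pow_succ', map_mul, mul_assoc]

lemma mergeSpan_mono {D E : ℕ} (h : D ≤ E) : mergeSpan D ≤ mergeSpan E :=
  Submodule.span_mono fun _ ⟨ε, η, i, j, hε, hη, hij, hF⟩ => ⟨ε, η, i, j, hε, hη, hij.trans h, hF⟩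

lemma exists_isMergeKernel {D : ℕ} {G : ℚ⟦X⟧} (hG : G ∈ geomSpan D) :
    ∃ b, IsMergeKernel G b ∧ coeffFun b ∈ mergeSpan (D + 1) := by
  induction hG using Submodule.span_induction with
  | mem G h =>
    obtain ⟨ε, k, hε, hk, rfl⟩ := h
    exact ⟨_, isMergeKernel_geomKernel hε k,
      mergeSpan_mono (by omega) (coeffFun_geomKernel_mem hε k)⟩
  | zero => exact ⟨0, by simp [IsMergeKernel], by simp⟩
  | add G G' _ _ h h' =>
    obtain ⟨b, hb, hm⟩ := h
    obtain ⟨b', hb', hm'⟩ := h'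
    exact ⟨b + b', hb.add hb', by rw [map_add]; exact Submodule.add_mem _ hm hm'⟩
  | smul a G _ h =>
    obtain ⟨b, hb, hm⟩ := h
    refine ⟨C (C a) * b, by rw [smul_eq_C_mul]; exact hb.C_mul a, ?_⟩
    rw [coeffFun_C_C_mul]
    exact Submodule.smul_mem _ _ hm

lemma mergeOp_eq_coeffFun {c : ℚ⟦X⟧} (hc : 1 - 2 * X ^ 2 * c = (1 - 4 * X ^ 2) * invSqrt)
    {G : ℚ⟦X⟧} {b : ℚ⟦X⟧⟦X⟧} (hb : IsMergeKernel (X ^ 2 * invSqrt ^ 2 * G) b) (n : ℕ) :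
    mergeOp c n (invSqrt * G) = coeffFun b n := by
  rw [coeffFun_apply, ← mk_mergeOp_eq hc _ hb, coeff_mk]
  linear_combination -(X ^ 2 * invSqrt * G) * invSqrt_sq_mul

lemma mergeOp_mem {c : ℚ⟦X⟧} (hc : 1 - 2 * X ^ 2 * c = (1 - 4 * X ^ 2) * invSqrt)
    {ε : ℚ} (hε : ε ^ 2 = 1) (d : ℕ) :
    (fun n => mergeOp c n (invSqrt * geom ε ^ d)) ∈ mergeSpan (d + 2) := by
  obtain ⟨b, hb, hm⟩ := exists_isMergeKernel
    (geomSpan_mul_mem X_sq_mul_invSqrt_sq_mem (geom_pow_mem hε (le_refl d)))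
  rw [show (fun n => mergeOp c n (invSqrt * geom ε ^ d)) = coeffFun b from
    funext fun n => mergeOp_eq_coeffFun hc hb n]
  exact mergeSpan_mono (by omega) hm

lemma coeffFun_geomKernel_one (ε : ℚ) (n : ℕ) : coeffFun (geomKernel ε 1) n =
    (2 * ε * coeff n (invSqrt * geom ε)) • (invSqrt * geom ε) := by
  rw [show geomKernel ε 1 = C (C (2 * ε)) * (C (geom ε) * sndVar (geom ε)) by
    simp only [geomKernel, map_mul, map_ofNat]; push_cast; ring, coeffFun_C_C_mul, Pi.smul_apply, coeffFun_mul, smul_smul]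

lemma coeffFun_geomKernel_two (ε : ℚ) (n : ℕ) : coeffFun (geomKernel ε 2) n =
    coeff n (invSqrt * geom ε) • (invSqrt * geom ε) +
    (2 * ε * coeff n (invSqrt * geom ε)) • (invSqrt * geom ε ^ 2) +
    (6 * ε * coeff n (invSqrt * geom ε ^ 2)) • (invSqrt * geom ε) := by
  rw [show geomKernel ε 2 = C (geom ε) * sndVar (geom ε) +
      C (C (2 * ε)) * (C (geom ε ^ 2) * sndVar (geom ε)) +
      C (C (6 * ε)) * (C (geom ε) * sndVar (geom ε ^ 2)) by
    simp only [geomKernel, map_mul, map_ofNat, map_pow]; push_cast; ring, map_add, map_add,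
    coeffFun_C_C_mul, coeffFun_C_C_mul, Pi.add_apply, Pi.add_apply, Pi.smul_apply, Pi.smul_apply,
    coeffFun_mul, coeffFun_mul, coeffFun_mul, smul_smul, smul_smul]

lemma X_sq_mul_invSqrt_sq {ε : ℚ} (hε : ε ^ 2 = 1) :
    X ^ 2 * invSqrt ^ 2 = C (ε / 4) * geom ε + C (-(ε / 4)) * geom (-ε) := by
  have h4 : (4 : ℚ⟦X⟧) * C (ε / 4) = C ε := by
    rw [← map_ofNat C 4, ← map_mul]; congr 1; ring
  rw [← geom_mul_geom_neg hε, map_neg]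
  linear_combination -C (ε / 4) * geom_sub_geom_neg ε -
    geom ε * geom (-ε) * (C ε * h4 + sq_C hε)

lemma mergeOp_invSqrt {c : ℚ⟦X⟧} (hc : 1 - 2 * X ^ 2 * c = (1 - 4 * X ^ 2) * invSqrt) (n : ℕ) :
    2 * mergeOp c n invSqrt = coeff n (invSqrt * geom 1) • (invSqrt * geom 1) +
      coeff n (invSqrt * geom (-1)) • (invSqrt * geom (-1)) := by
  have h1 : (1 : ℚ) ^ 2 = 1 := one_pow 2
  have hb := ((isMergeKernel_geomKernel h1 1).C_mul (1 / 4)).add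
    ((isMergeKernel_geomKernel (ε := -1) (by norm_num) 1).C_mul (-(1 / 4)))
  simp only [pow_one, ← X_sq_mul_invSqrt_sq h1] at hb
  have := mergeOp_eq_coeffFun hc (G := 1) (by rwa [mul_one]) n
  rw [mul_one] at this
  rw [this, map_add, coeffFun_C_C_mul, coeffFun_C_C_mul, Pi.add_apply, Pi.smul_apply,
    Pi.smul_apply, coeffFun_geomKernel_one, coeffFun_geomKernel_one, two_mul]
  module

lemma mergeOp_invSqrt_mul_geom {c : ℚ⟦X⟧}
    (hc : 1 - 2 * X ^ 2 * c = (1 - 4 * X ^ 2) * invSqrt) {ε : ℚ} (hε : ε ^ 2 = 1) (n : ℕ) :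
    mergeOp c n (invSqrt * geom ε) =
      (ε / 8 * coeff n (invSqrt * geom ε)) • (invSqrt * geom ε) +
      (1 / 2 * coeff n (invSqrt * geom ε)) • (invSqrt * geom ε ^ 2) +
      (3 / 2 * coeff n (invSqrt * geom ε ^ 2)) • (invSqrt * geom ε) -
      (ε / 8 * coeff n (invSqrt * geom (-ε))) • (invSqrt * geom (-ε)) := by
  have hb := ((isMergeKernel_geomKernel hε 2).C_mul (ε / 4)).add
    (((isMergeKernel_geomKernel hε 1).C_mul (-(1 / 16))).add
    ((isMergeKernel_geomKernel (ε := -ε) (by simpa using hε) 1).C_mul (1 / 16)))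
  have hG : X ^ 2 * invSqrt ^ 2 * geom ε = C (ε / 4) * geom ε ^ 2 + (C (-(1 / 16)) * geom ε ^ 1 +
      C (1 / 16) * geom (-ε) ^ 1) := by
    have h := X_sq_mul_invSqrt_sq hε
    have h' := mul_geom_pow_succ hε 0
    have h16 : (C (ε / 4) : ℚ⟦X⟧) * C (ε / 4) = C (1 / 16) := by
      rw [← map_mul]; congr 1; linear_combination hε / 16
    rw [geom_mul_geom_neg hε] at h'
    simp only [map_neg] at h ⊢
    linear_combination h' - C (ε / 4) * h + (geom (-ε) - geom ε) * h16
  rw [← hG] at hb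
  rw [mergeOp_eq_coeffFun hc hb, map_add, map_add, coeffFun_C_C_mul, coeffFun_C_C_mul,
    coeffFun_C_C_mul, Pi.add_apply, Pi.add_apply, Pi.smul_apply, Pi.smul_apply,
    Pi.smul_apply, coeffFun_geomKernel_one, coeffFun_geomKernel_one, coeffFun_geomKernel_two]
  match_scalars
  · linear_combination 3 / 2 * coeff n (invSqrt * geom ε ^ 2) * hε
  · linear_combination 1 / 2 * coeff n (invSqrt * geom ε) * hε
  · ring

end MergeKernel

section Recursion

open Finset.HasAntidiagonal (antidiagonal)

/-- The generating series, in the valency of the root vertex, of the genus `g` part. -/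
noncomputable def genusSeries (g : ℕ) (S : Finset ℕ) (μ : ℕ → ℕ) : ℚ⟦X⟧ :=
  mk fun m => (genusPoly m S μ).coeff g

/-- The generating series of the convolution of a two-argument function with itself. -/
noncomputable def splitSeries (F : ℕ → ℚ⟦X⟧) : ℚ⟦X⟧ :=
  mk fun n => ∑ p ∈ antidiagonal n, coeff p.1 (F p.2)

lemma genusSeries_eq (g : ℕ) (S : Finset ℕ) (μ : ℕ → ℕ) (i : ℕ) (hi : i ∉ S) :
    genusSeries g S μ = (if g = 0 ∧ S = ∅ then 1 else 0) +
      ∑ j ∈ S, mergeSeries (μ j) (genusSeries g (S.erase j) μ) +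
      X ^ 2 * (if g = 0 then 0 else
        splitSeries fun q => genusSeries (g - 1) (insert i S) (Function.update μ i q)) +
      X ^ 2 * ∑ a ∈ antidiagonal g, ∑ B ∈ S.powerset,
        genusSeries a.1 B μ * genusSeries a.2 (S \ B) μ := by
  ext m
  rcases m with _ | m
  · rw [genusSeries, coeff_mk, genusPoly_zero]
    simp only [mergeSeries, map_add, map_sum, coeff_zero_X_mul, Finset.sum_const_zero, add_zero,
      pow_succ' X 1, mul_assoc]
    by_cases hS : S = ∅ <;> by_cases hg : g = 0 <;> simp [hS, hg, Polynomial.coeff_one]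
  · rw [genusSeries, coeff_mk, genusPoly_succ m S μ i hi]
    simp only [map_add, map_sum, Polynomial.coeff_add, Polynomial.finsetSum_coeff,
      Polynomial.coeff_smul, mergeSeries, coeff_succ_X_mul, pow_two, mul_assoc, coeff_mk]
    have h0 : coeff (m + 1) (if g = 0 ∧ S = ∅ then (1 : ℚ⟦X⟧) else 0) = 0 := by
      split_ifs <;> simp [coeff_one]
    rw [h0, zero_add, add_assoc]
    congr 1
    · simp [genusSeries]
    rcases m with _ | m
    · split_ifs <;> simp
    · rw [coeff_succ_X_mul, coeff_succ_X_mul, Finset.sum_add_distrib]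
      congr 1
      · rcases g with _ | g
        · simp
        · simp only [Polynomial.coeff_X_mul, Nat.succ_ne_zero, if_false, splitSeries, coeff_mk,
            Nat.add_sub_cancel]
          rw [Finset.Nat.sum_antidiagonal_eq_sum_range_succ_mk]
          simp [genusSeries]
      · simp only [map_sum, coeff_mul, genusSeries, coeff_mk, Polynomial.coeff_mul]
        rw [Finset.sum_comm]
        simp only [Finset.sum_comm (s := antidiagonal g)]
        refine Finset.sum_congr rfl fun B _ => ?_
        rw [Finset.Nat.sum_antidiagonal_eq_sum_range_succ_mk _ m]
        simp

lemma genusSeries_zero_empty_eq (μ : ℕ → ℕ) :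
    genusSeries 0 ∅ μ = 1 + X ^ 2 * genusSeries 0 ∅ μ ^ 2 := by
  conv_lhs => rw [genusSeries_eq 0 ∅ μ 0 (Finset.notMem_empty 0)]
  simp [pow_two]

lemma one_sub_genusSeries (μ : ℕ → ℕ) :
    1 - 2 * X ^ 2 * genusSeries 0 ∅ μ = (1 - 4 * X ^ 2) * invSqrt := by
  have h : (1 - 2 * X ^ 2 * genusSeries 0 ∅ μ - (1 - 4 * X ^ 2) * invSqrt) *
      (1 - 2 * X ^ 2 * genusSeries 0 ∅ μ + (1 - 4 * X ^ 2) * invSqrt) = 0 := by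
    linear_combination -4 * X ^ 2 * genusSeries_zero_empty_eq μ -
      (1 - 4 * X ^ 2) * invSqrt_sq_mul
  rcases mul_eq_zero.1 h with h | h
  · exact sub_eq_zero.1 h
  · have := congrArg constantCoeff h
    simp [invSqrt, constantCoeff_mk] at this

/-- The one-point planar series. -/
noncomputable def planarSeries : ℚ⟦X⟧ := genusSeries 0 ∅ 0

lemma one_sub_planarSeries :
    1 - 2 * X ^ 2 * planarSeries = (1 - 4 * X ^ 2) * invSqrt := one_sub_genusSeries 0

lemma genusSeries_zero_empty (μ : ℕ → ℕ) : genusSeries 0 ∅ μ = planarSeries := by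
  have h : (2 : ℚ⟦X⟧) * X ^ 2 ≠ 0 := mul_ne_zero (fun h => by
    have := congrArg constantCoeff h
    rw [map_ofNat, map_zero] at this
    norm_num at this) (pow_ne_zero 2 X_ne_zero)
  refine mul_left_cancel₀ h ?_
  linear_combination one_sub_planarSeries - one_sub_genusSeries μ

lemma invSqrt_mul_sqrt : invSqrt * ((1 - 4 * X ^ 2) * invSqrt) = 1 := by
  linear_combination invSqrt_sq_mul

lemma genusSeries_zero_singleton (j : ℕ) (μ : ℕ → ℕ) :
    genusSeries 0 {j} μ = invSqrt * mergeSeries (μ j) planarSeries := by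
  have h := genusSeries_eq 0 {j} μ (j + 1) (by simp)
  simp only [Finset.singleton_ne_empty, and_false, if_false, zero_add, Finset.sum_singleton,
    Finset.erase_singleton, genusSeries_zero_empty, if_true, mul_zero, add_zero,
    Finset.Nat.antidiagonal_zero] at h
  rw [← insert_empty_eq j, Finset.sum_powerset_insert (Finset.notMem_empty j)] at h
  simp only [Finset.powerset_empty, Finset.sum_singleton, insert_empty_eq, Finset.sdiff_empty,
    sdiff_self, Finset.bot_eq_empty, genusSeries_zero_empty] at h
  linear_combination invSqrt * h - genusSeries 0 {j} μ * invSqrt_mul_sqrt -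
    invSqrt * genusSeries 0 {j} μ * one_sub_planarSeries

lemma sum_powerset_eq_of_card {M : Type*} [AddCommMonoid M] (S : Finset ℕ) (f : Finset ℕ → M)
    (hf : ∀ B, 2 ≤ B.card → f B = 0) : ∑ B ∈ S.powerset, f B = f ∅ + ∑ j ∈ S, f {j} := by
  induction S using Finset.induction_on with
  | empty => simp
  | insert a S ha ih =>
    rw [Finset.sum_powerset_insert ha, ih, Finset.sum_insert ha,
      Finset.sum_eq_single (∅ : Finset ℕ)]
    · simp only [insert_empty_eq]; abel
    · intro B hB hB'
      refine hf _ ?_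
      rw [Finset.card_insert_of_notMem fun h => ha (Finset.mem_powerset.1 hB h)]
      have := Finset.card_pos.2 (Finset.nonempty_iff_ne_empty.2 hB')
      omega
    · simp

lemma sum_unstable {R : Type*} [CommRing R] (f h : ℕ → Finset ℕ → R) (g : ℕ) (S : Finset ℕ)
    (hf : ∀ a B, 2 ≤ 2 * a + B.card → f a B = 0) :
    ∑ a ∈ antidiagonal g, ∑ B ∈ S.powerset, f a.1 B * h a.2 (S \ B) =
      f 0 ∅ * h g S + ∑ j ∈ S, f 0 {j} * h g (S.erase j) := by
  rw [Finset.sum_eq_single (0, g)]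
  · rw [sum_powerset_eq_of_card S fun B => f 0 B * h g (S \ B)]
    · simp [Finset.sdiff_singleton_eq_erase]
    · intro B hB
      rw [hf 0 B (by omega), zero_mul]
  · rintro ⟨a, b⟩ hab hne
    refine Finset.sum_eq_zero fun B _ => ?_
    have : a ≠ 0 := by
      rintro rfl
      simp at hab
      exact hne (by simp [hab])
    rw [hf a B (by omega), zero_mul]
  · simp

lemma sum_antidiagonal_powerset_symm {M : Type*} [AddCommMonoid M]
    (F : ℕ → Finset ℕ → ℕ → Finset ℕ → M) (g : ℕ) (S : Finset ℕ) :
    ∑ a ∈ antidiagonal g, ∑ B ∈ S.powerset, F a.1 B a.2 (S \ B) =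
      ∑ a ∈ antidiagonal g, ∑ B ∈ S.powerset, F a.2 (S \ B) a.1 B := by
  rw [← Finset.Nat.sum_antidiagonal_swap]
  refine Finset.sum_congr rfl fun a _ => ?_
  refine Finset.sum_nbij' (S \ ·) (S \ ·) ?_ ?_ ?_ ?_ ?_
  · simp
  · simp
  · intro B hB; simpa using Finset.mem_powerset.1 hB
  · intro B hB; simpa using Finset.mem_powerset.1 hB
  · intro B hB
    simp only [Prod.fst_swap, Prod.snd_swap]
    rw [Finset.sdiff_sdiff_eq_self (Finset.mem_powerset.1 hB)]

/-- The stable part of `genusSeries`. -/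
noncomputable def stableSeries (g : ℕ) (S : Finset ℕ) (μ : ℕ → ℕ) : ℚ⟦X⟧ :=
  if 2 ≤ 2 * g + S.card then genusSeries g S μ else 0

lemma genusSeries_stable (g : ℕ) (S : Finset ℕ) (μ : ℕ → ℕ) (i : ℕ) (hi : i ∉ S)
    (h : 3 ≤ 2 * g + S.card) :
    genusSeries g S μ = ∑ j ∈ S, mergeOp planarSeries (μ j) (genusSeries g (S.erase j) μ) +
      (if g = 0 then 0 else invSqrt * X ^ 2 *
        splitSeries fun q => genusSeries (g - 1) (insert i S) (Function.update μ i q)) +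
      ∑ a ∈ antidiagonal g, ∑ B ∈ S.powerset,
        invSqrt * X ^ 2 * (stableSeries a.1 B μ * stableSeries a.2 (S \ B) μ) := by
  set u : ℕ → Finset ℕ → ℚ⟦X⟧ := fun a B =>
    if 2 ≤ 2 * a + B.card then 0 else genusSeries a B μ with hu
  have hu0 (a B) (hab : 2 ≤ 2 * a + Finset.card B) : u a B = 0 := if_pos hab
  have hus (a B) : u a B = genusSeries a B μ - stableSeries a B μ := by
    simp only [hu, stableSeries]; split_ifs <;> simp
  have e := genusSeries_eq g S μ i hi
  have h0 : ¬ (g = 0 ∧ S = ∅) := by rintro ⟨rfl, rfl⟩; simp at h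
  have hprod : ∑ a ∈ antidiagonal g, ∑ B ∈ S.powerset,
        genusSeries a.1 B μ * genusSeries a.2 (S \ B) μ =
      2 * (planarSeries * genusSeries g S μ +
        ∑ j ∈ S, genusSeries 0 {j} μ * genusSeries g (S.erase j) μ) +
      ∑ a ∈ antidiagonal g, ∑ B ∈ S.powerset,
        stableSeries a.1 B μ * stableSeries a.2 (S \ B) μ := by
    have h1 := sum_unstable u (fun a B => genusSeries a B μ) g S hu0
    have h2 := sum_antidiagonal_powerset_symm (fun a B b B' => u a B * genusSeries b B' μ) g S
    have h3 := sum_unstable u u g S hu0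
    have hz : u 0 ∅ * u g S + ∑ j ∈ S, u 0 {j} * u g (S.erase j) = 0 := by
      rw [hu0 g S (by omega), mul_zero, zero_add]
      refine Finset.sum_eq_zero fun j hj => ?_
      rw [hu0 g (S.erase j) (by rw [Finset.card_erase_of_mem hj]; omega), mul_zero]
    have hu1 : u 0 ∅ = planarSeries := by simp [hu, genusSeries_zero_empty]
    have hu2 (j : ℕ) : u 0 {j} = genusSeries 0 {j} μ := by simp [hu]
    rw [hz] at h3
    rw [h1] at h2
    simp only [hu1, hu2] at h1 h2
    have key : ∑ a ∈ antidiagonal g, ∑ B ∈ S.powerset,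
        genusSeries a.1 B μ * genusSeries a.2 (S \ B) μ =
      ∑ a ∈ antidiagonal g, ∑ B ∈ S.powerset, u a.1 B * genusSeries a.2 (S \ B) μ +
      ∑ a ∈ antidiagonal g, ∑ B ∈ S.powerset, u a.2 (S \ B) * genusSeries a.1 B μ -
      ∑ a ∈ antidiagonal g, ∑ B ∈ S.powerset, u a.1 B * u a.2 (S \ B) +
      ∑ a ∈ antidiagonal g, ∑ B ∈ S.powerset,
        stableSeries a.1 B μ * stableSeries a.2 (S \ B) μ := by
      simp only [← Finset.sum_add_distrib, ← Finset.sum_sub_distrib]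
      refine Finset.sum_congr rfl fun a _ => Finset.sum_congr rfl fun B _ => ?_
      rw [hus, hus]
      ring
    rw [key, h1, h3, ← h2]
    ring
  rw [hprod, if_neg h0, zero_add] at e
  have em : ∑ j ∈ S, mergeOp planarSeries (μ j) (genusSeries g (S.erase j) μ) =
      invSqrt * (∑ j ∈ S, mergeSeries (μ j) (genusSeries g (S.erase j) μ) +
        2 * X ^ 2 * ∑ j ∈ S, genusSeries 0 {j} μ * genusSeries g (S.erase j) μ) := by
    rw [Finset.mul_sum, ← Finset.sum_add_distrib, Finset.mul_sum]
    refine Finset.sum_congr rfl fun j _ => ?_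
    rw [mergeOp, genusSeries_zero_singleton]
    ring
  have es : (if g = 0 then 0 else invSqrt * X ^ 2 *
        splitSeries fun q => genusSeries (g - 1) (insert i S) (Function.update μ i q)) =
      invSqrt * (X ^ 2 * (if g = 0 then 0 else
        splitSeries fun q => genusSeries (g - 1) (insert i S) (Function.update μ i q))) := by
    split_ifs <;> ring
  rw [em, es]
  simp only [← Finset.mul_sum]
  linear_combination invSqrt * e - genusSeries g S μ * invSqrt_mul_sqrt -
    invSqrt * genusSeries g S μ * one_sub_planarSeries

end Recursion

section BaseCases

open Finset.HasAntidiagonal (antidiagonal)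

lemma coeff_X_mul_derivative (f : ℚ⟦X⟧) (m : ℕ) : coeff m (X * d⁄dX ℚ f) = m * coeff m f := by
  rcases m with _ | m
  · simp
  · rw [coeff_succ_X_mul, coeff_derivative]; push_cast; ring

lemma mergeSeries_add (n : ℕ) (f g : ℚ⟦X⟧) :
    mergeSeries n (f + g) = mergeSeries n f + mergeSeries n g := by
  rw [mergeSeries, mergeSeries, mergeSeries, ← mul_add]
  congr 1
  ext m
  simp [mul_add]

lemma mergeSeries_smul (n : ℕ) (a : ℚ) (f : ℚ⟦X⟧) :
    mergeSeries n (a • f) = a • mergeSeries n f := by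
  rw [mergeSeries, mergeSeries, ← mul_smul_comm]
  congr 1
  ext m
  simp only [coeff_mk, map_smul, smul_eq_mul]
  ring

lemma mergeOp_add (c : ℚ⟦X⟧) (n : ℕ) (f g : ℚ⟦X⟧) :
    mergeOp c n (f + g) = mergeOp c n f + mergeOp c n g := by
  simp only [mergeOp, mergeSeries_add]
  ring

lemma mergeOp_smul (c : ℚ⟦X⟧) (n : ℕ) (a : ℚ) (f : ℚ⟦X⟧) :
    mergeOp c n (a • f) = a • mergeOp c n f := by
  simp only [mergeOp, mergeSeries_smul, mul_smul_comm, ← smul_add]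

lemma X_mul_derivative_mergeSeries (n : ℕ) (f : ℚ⟦X⟧) :
    X * d⁄dX ℚ (mergeSeries n f) + ((n : ℚ⟦X⟧) - 2) * mergeSeries n f = mergeSeries n (X * d⁄dX ℚ f) := by
  have hn : ((n : ℚ⟦X⟧) - 2) = C ((n : ℚ) - 2) := by rw [map_sub, map_natCast, map_ofNat]
  ext m
  rw [hn, map_add, coeff_C_mul, coeff_X_mul_derivative]
  rcases m with _ | m
  · simp [mergeSeries]
  · simp only [mergeSeries, coeff_succ_X_mul, coeff_mk, coeff_X_mul_derivative]
    rcases n with _ | n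
    · simp
    · rw [← add_assoc, Nat.add_sub_cancel]; push_cast; ring

lemma X_mul_derivative_planarSeries :
    X * d⁄dX ℚ planarSeries = (2 : ℚ) • invSqrt + (-2 : ℚ) • planarSeries := by
  have h := congrArg (d⁄dX ℚ) one_sub_planarSeries
  have hd2 : d⁄dX ℚ (2 : ℚ⟦X⟧) = 0 := by rw [← map_ofNat C 2, derivative_C]
  rw [derivative_sqrt] at h
  simp only [Derivation.leibniz, map_sub, derivative_pow, derivative_one, derivative_X,
      smul_eq_mul, hd2] at h
  push_cast at h
  rw [smul_eq_C_mul, smul_eq_C_mul, map_neg, map_ofNat]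
  have h2 : (2 : ℚ⟦X⟧) * X ≠ 0 := mul_ne_zero (fun h => by
    have := congrArg constantCoeff h
    rw [map_ofNat, map_zero] at this
    norm_num at this) X_ne_zero
  refine mul_left_cancel₀ h2 ?_
  linear_combination -h

/-- The two-point planar series. -/
noncomputable def twoPointSeries (n : ℕ) : ℚ⟦X⟧ := invSqrt * mergeSeries n planarSeries

lemma X_mul_derivative_twoPointSeries (n : ℕ) :
    X * d⁄dX ℚ (twoPointSeries n) + (n : ℚ⟦X⟧) * twoPointSeries n =
      coeff n (invSqrt * geom 1) • (invSqrt * geom 1) +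
      coeff n (invSqrt * geom (-1)) • (invSqrt * geom (-1)) := by
  rw [← mergeOp_invSqrt one_sub_planarSeries, twoPointSeries, Derivation.leibniz, smul_eq_mul,
    smul_eq_mul, derivative_invSqrt, mergeOp]
  have h := X_mul_derivative_mergeSeries n planarSeries
  rw [X_mul_derivative_planarSeries, mergeSeries_add, mergeSeries_smul, mergeSeries_smul,
    smul_eq_C_mul, smul_eq_C_mul, map_neg, map_ofNat] at h
  linear_combination invSqrt * h

lemma splitSeries_twoPointSeries : splitSeries twoPointSeries = X ^ 2 * invSqrt ^ 4 := by
  have h2 : d⁄dX ℚ (X ^ 2 * invSqrt ^ 4) * X = 2 * X ^ 2 * invSqrt ^ 4 + 16 * X ^ 4 * invSqrt ^ 6 := by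
    simp only [Derivation.leibniz, derivative_pow, smul_eq_mul, derivative_invSqrt, derivative_X]
    push_cast
    ring
  have h1 : d⁄dX ℚ (splitSeries twoPointSeries) * X =
      (invSqrt * geom 1) ^ 2 + (invSqrt * geom (-1)) ^ 2 := by
    ext n
    have hn : coeff n (d⁄dX ℚ (splitSeries twoPointSeries) * X) =
        n * coeff n (splitSeries twoPointSeries) := by
      rw [mul_comm, coeff_X_mul_derivative]
    rw [hn, splitSeries, coeff_mk, Finset.mul_sum, map_add, pow_two, pow_two, coeff_mul, coeff_mul,
      ← Finset.sum_add_distrib]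
    refine Finset.sum_congr rfl fun p hp => ?_
    have h := congrArg (coeff p.1) (X_mul_derivative_twoPointSeries p.2)
    rw [map_add, coeff_X_mul_derivative, ← map_natCast (C (R := ℚ)), coeff_C_mul, map_add, map_smul, map_smul, smul_eq_mul,
      smul_eq_mul] at h
    rw [← Finset.HasAntidiagonal.mem_antidiagonal.1 hp]
    push_cast
    linear_combination h
  have hs := geom_mul_geom_neg (one_pow 2 : (1 : ℚ) ^ 2 = 1)
  have hd := geom_sub_geom_neg 1
  rw [map_one] at hd
  refine derivative.ext (mul_right_cancel₀ X_ne_zero ?_) ?_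
  · rw [h1, h2]
    linear_combination invSqrt ^ 2 * (geom 1 - geom (-1) + 4 * geom 1 * geom (-1)) * hd +
      invSqrt ^ 2 * (2 + 16 * (geom 1 * geom (-1) + X ^ 2 * invSqrt ^ 2)) * hs
  · rw [← coeff_zero_eq_constantCoeff_apply, splitSeries, coeff_mk]
    simp [twoPointSeries, mergeSeries]

lemma genusSeries_one_empty (μ : ℕ → ℕ) :
    genusSeries 1 ∅ μ = invSqrt * (X ^ 2 * invSqrt ^ 2) ^ 2 := by
  have h := genusSeries_eq 1 ∅ μ 0 (Finset.notMem_empty 0)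
  have hs : (fun q => genusSeries 0 {0} (Function.update μ 0 q)) = twoPointSeries := by
    ext1 q
    rw [genusSeries_zero_singleton, Function.update_self, twoPointSeries]
  simp only [one_ne_zero, false_and, if_false, Finset.sum_empty, zero_add, Nat.sub_self,
    insert_empty_eq, hs, splitSeries_twoPointSeries, Finset.powerset_empty, Finset.sum_singleton,
    Finset.sdiff_empty, Finset.Nat.antidiagonal_succ, Finset.sum_cons, Finset.sum_map,
    Finset.Nat.antidiagonal_zero, genusSeries_zero_empty, Prod.map, Function.Embedding.prodMap,
    Function.Embedding.coeFn_mk, Function.Embedding.refl_apply] at h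
  simp at h
  linear_combination invSqrt * h - genusSeries 1 ∅ μ * invSqrt_mul_sqrt -
    invSqrt * genusSeries 1 ∅ μ * one_sub_planarSeries

lemma coeff_geom_relation {ε : ℚ} (hε : ε ^ 2 = 1) (n : ℕ) :
    n * coeff n (invSqrt * geom ε) = 3 / 4 * coeff n (invSqrt * geom ε) +
      1 / 4 * coeff n (invSqrt * geom (-ε)) + 3 * ε * coeff n (invSqrt * geom ε ^ 2) := by
  have hX : X * d⁄dX ℚ (invSqrt * geom ε) = C (3 / 4) * (invSqrt * geom ε) +
      C (1 / 4) * (invSqrt * geom (-ε)) + C (3 * ε) * (invSqrt * geom ε ^ 2) := by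
    have hs := X_sq_mul_invSqrt_sq hε
    have hg := geom_mul_geom_neg hε
    have h34 : (C (3 / 4) : ℚ⟦X⟧) = 1 - C (1 / 4) := by rw [← map_one C, ← map_sub]; norm_num
    have h14 : (4 : ℚ⟦X⟧) * C (1 / 4) = 1 := by
      rw [← map_ofNat C 4, ← map_mul, ← map_one C]; norm_num
    have he : (C (ε / 4) : ℚ⟦X⟧) = C ε * C (1 / 4) := by rw [← map_mul]; congr 1; ring
    rw [map_neg, he] at hs
    simp only [Derivation.leibniz, smul_eq_mul, derivative_invSqrt, derivative_geom, h34, map_mul,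
      map_ofNat]
    linear_combination -(invSqrt * (1 + 2 * C ε * geom ε)) * geom_mul ε +
      (4 * geom ε - C ε) * invSqrt * hs - C ε * invSqrt * hg +
      invSqrt * C ε * geom ε * (geom ε - geom (-ε)) * h14 -
      invSqrt * C (1 / 4) * (geom ε - geom (-ε)) * sq_C hε
  have := congrArg (coeff n) hX
  simp only [map_add, coeff_C_mul] at this
  rw [← this, coeff_X_mul_derivative]

end BaseCases

section BaseCases

lemma eq_zero_of_X_mul_derivative {f : ℚ⟦X⟧} {n : ℤ} (hf : X * d⁄dX ℚ f + C (n : ℚ) * f = 0)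
    (h : ∀ m : ℕ, (m : ℤ) + n = 0 → coeff m f = 0) : f = 0 := by
  ext m
  have := congrArg (coeff m) hf
  rw [map_add, coeff_X_mul_derivative, coeff_C_mul, map_zero, ← add_mul] at this
  rcases mul_eq_zero.1 this with h' | h'
  · exact h m (by exact_mod_cast h')
  · exact h'

lemma mergeSeries_zero (f : ℚ⟦X⟧) : mergeSeries 0 f = 0 := by
  ext m
  rcases m with _ | m <;> simp [mergeSeries, coeff_succ_X_mul]

lemma mergeSeries_apply_zero (n : ℕ) : mergeSeries n 0 = 0 := by
  simpa using mergeSeries_smul n 0 0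

lemma constantCoeff_mergeSeries (n : ℕ) (f : ℚ⟦X⟧) : constantCoeff (mergeSeries n f) = 0 := by
  simp [mergeSeries]

lemma constantCoeff_geom (ε : ℚ) : constantCoeff (geom ε) = 0 := by simp [geom]

lemma X_mul_derivative_geom {ε : ℚ} : X * d⁄dX ℚ (geom ε) = geom ε * (1 + 2 * C ε * geom ε) := by
  rw [derivative_geom]
  linear_combination -(1 + 2 * C ε * geom ε) * geom_mul ε

lemma genusSeries_zero_pair {i j : ℕ} (hij : i ≠ j) (μ : ℕ → ℕ) :
    genusSeries 0 {i, j} μ =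
      (1 / 2 * (coeff (μ i) (invSqrt * geom 1) * coeff (μ j) (invSqrt * geom 1))) •
        (invSqrt * geom 1) -
      (1 / 2 * (coeff (μ i) (invSqrt * geom (-1)) * coeff (μ j) (invSqrt * geom (-1)))) •
        (invSqrt * geom (-1)) := by
  obtain ⟨k, hk⟩ := exists_notMem ({i, j} : Finset ℕ)
  have hY := genusSeries_eq 0 {i, j} μ k hk
  have hi : ({i, j} : Finset ℕ).erase i = {j} := by ext x; simp; omega
  have hj : ({i, j} : Finset ℕ).erase j = {i} := by ext x; simp; omega
  have hi' : ({i, j} : Finset ℕ) \ {i} = {j} := by ext x; simp; omega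
  have hj' : ({i, j} : Finset ℕ) \ {j} = {i} := by ext x; simp; omega
  rw [Finset.sum_pair hij, hi, hj, if_neg (by simp), if_pos rfl, Finset.Nat.antidiagonal_zero,
    Finset.sum_singleton, Finset.sum_powerset_insert (by simpa using hij),
    ← insert_empty_eq j, Finset.sum_powerset_insert (Finset.notMem_empty j),
    Finset.sum_powerset_insert (Finset.notMem_empty j), Finset.powerset_empty,
    Finset.sum_singleton, Finset.sum_singleton, Finset.sum_singleton, Finset.sum_singleton] at hY
  simp only [insert_empty_eq, Finset.sdiff_empty, Finset.sdiff_self, hi', hj',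
    genusSeries_zero_empty, genusSeries_zero_singleton] at hY
  simp only [← show ∀ n, twoPointSeries n = invSqrt * mergeSeries n planarSeries from
    fun _ => rfl] at hY
  generalize μ i = n at *
  generalize μ j = l at *
  set Y := mergeSeries n (twoPointSeries l) + mergeSeries l (twoPointSeries n) +
    2 * X ^ 2 * twoPointSeries n * twoPointSeries l with hYdef
  have hr := invSqrt_mul_sqrt
  have hgs : (1 - 4 * X ^ 2) * invSqrt * genusSeries 0 {i, j} μ = Y := by
    rw [← one_sub_planarSeries, hYdef]
    linear_combination hY
  set p : ℕ → ℚ⟦X⟧ := fun n => coeff n (invSqrt * geom 1) • (invSqrt * geom 1) +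
      coeff n (invSqrt * geom (-1)) • (invSqrt * geom (-1)) with hp
  have hW (n : ℕ) : X * d⁄dX ℚ (twoPointSeries n) + (n : ℚ⟦X⟧) * twoPointSeries n = p n :=
    X_mul_derivative_twoPointSeries n
  have hM (n l : ℕ) : X * d⁄dX ℚ (mergeSeries n (twoPointSeries l)) +
      ((n : ℚ⟦X⟧) + (l : ℚ⟦X⟧) - 2) * mergeSeries n (twoPointSeries l) = mergeSeries n (p l) := by
    rw [← hW, mergeSeries_add, ← map_natCast (C (R := ℚ)) l, ← smul_eq_C_mul, mergeSeries_smul,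
      smul_eq_C_mul, ← X_mul_derivative_mergeSeries]
    ring
  have hop (n : ℕ) (f : ℚ⟦X⟧) : (1 - 4 * X ^ 2) * invSqrt * mergeOp planarSeries n f =
      mergeSeries n f + 2 * X ^ 2 * twoPointSeries n * f := by
    rw [mergeOp, twoPointSeries]
    linear_combination (mergeSeries n f + 2 * X ^ 2 * (invSqrt * mergeSeries n planarSeries) * f) * hr
  have hd2 : d⁄dX ℚ (2 : ℚ⟦X⟧) = 0 := by rw [← map_ofNat C 2, derivative_C]
  have hode : X * d⁄dX ℚ Y + ((n : ℚ⟦X⟧) + (l : ℚ⟦X⟧) - 2) * Y = (1 - 4 * X ^ 2) * invSqrt *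
      (mergeOp planarSeries n (p l) + mergeOp planarSeries l (p n)) := by
    rw [mul_add (_ * invSqrt), hop, hop, hYdef]
    simp only [map_add, Derivation.leibniz, derivative_pow, derivative_X, smul_eq_mul, hd2]
    push_cast
    linear_combination hM n l + hM l n + 2 * X ^ 2 * twoPointSeries n * hW l +
      2 * X ^ 2 * twoPointSeries l * hW n
  have hK : Y = C (1 / 2 * (coeff n (invSqrt * geom 1) * coeff l (invSqrt * geom 1))) * geom 1 -
      C (1 / 2 * (coeff n (invSqrt * geom (-1)) * coeff l (invSqrt * geom (-1)))) *
        geom (-1) := by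
    rw [← sub_eq_zero]
    by_cases hn : n = 0
    · subst hn
      simp [hYdef, mergeSeries_zero, mergeSeries_apply_zero, twoPointSeries, constantCoeff_geom]
    by_cases hl : l = 0
    · subst hl
      simp [hYdef, mergeSeries_zero, mergeSeries_apply_zero, twoPointSeries, constantCoeff_geom]
    refine eq_zero_of_X_mul_derivative (n := n + l - 2) ?_ fun m hm => ?_
    · have h1 : (1 : ℚ) ^ 2 = 1 := one_pow 2
      have h1' : (-1 : ℚ) ^ 2 = 1 := by norm_num
      rw [hp] at hode
      simp only [mergeOp_add, mergeOp_smul, mergeOp_invSqrt_mul_geom one_sub_planarSeries h1,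
        mergeOp_invSqrt_mul_geom one_sub_planarSeries h1', neg_neg] at hode
      have e1 := congrArg (C (R := ℚ)) (coeff_geom_relation h1 n)
      have e2 := congrArg (C (R := ℚ)) (coeff_geom_relation h1 l)
      have e3 := congrArg (C (R := ℚ)) (coeff_geom_relation h1' n)
      have e4 := congrArg (C (R := ℚ)) (coeff_geom_relation h1' l)
      have hu := X_mul_derivative_geom (ε := 1)
      have hv := X_mul_derivative_geom (ε := -1)
      have h8 : (8 : ℚ⟦X⟧) * C (1 / 8) = 1 := by
        rw [← map_ofNat C 8, ← map_mul, ← map_one C]; norm_num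
      have c1 : (C (1 / 2) : ℚ⟦X⟧) = 4 * C (1 / 8) := by
        rw [← map_ofNat C 4, ← map_mul]; norm_num
      have c2 : (C (3 / 2) : ℚ⟦X⟧) = 12 * C (1 / 8) := by
        rw [← map_ofNat C 12, ← map_mul]; norm_num
      have c3 : (C (3 / 4) : ℚ⟦X⟧) = 6 * C (1 / 8) := by
        rw [← map_ofNat C 6, ← map_mul]; norm_num
      have c4 : (C (1 / 4) : ℚ⟦X⟧) = 2 * C (1 / 8) := by
        rw [← map_ofNat C 2, ← map_mul]; norm_num
      have c5 : (C (-1 / 8) : ℚ⟦X⟧) = -C (1 / 8) := by rw [← map_neg]; norm_num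
      simp only [neg_neg, map_mul, map_add, map_natCast, map_ofNat, map_neg, map_one, c3, c4,
        smul_eq_C_mul, c1, c2, c5] at e1 e2 e3 e4 hu hv hode ⊢
      simp only [map_sub, Derivation.leibniz, smul_eq_mul, derivative_C, Int.cast_sub,
        Int.cast_add, Int.cast_natCast, Int.cast_ofNat, map_add, map_natCast, map_ofNat]
      have hd4 : d⁄dX ℚ (4 : ℚ⟦X⟧) = 0 := by rw [← map_ofNat C 4, derivative_C]
      rw [hd4]
      generalize (C (1 / 8) : ℚ⟦X⟧) = c at *
      generalize (C (coeff n (invSqrt * geom 1)) : ℚ⟦X⟧) = an at *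
      generalize (C (coeff l (invSqrt * geom 1)) : ℚ⟦X⟧) = al at *
      generalize (C (coeff n (invSqrt * geom (-1))) : ℚ⟦X⟧) = bn at *
      generalize (C (coeff l (invSqrt * geom (-1))) : ℚ⟦X⟧) = bl at *
      generalize (C (coeff n (invSqrt * geom 1 ^ 2)) : ℚ⟦X⟧) = an2 at *
      generalize (C (coeff l (invSqrt * geom 1 ^ 2)) : ℚ⟦X⟧) = al2 at *
      generalize (C (coeff n (invSqrt * geom (-1) ^ 2)) : ℚ⟦X⟧) = bn2 at *
      generalize (C (coeff l (invSqrt * geom (-1) ^ 2)) : ℚ⟦X⟧) = bl2 at *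
      clear_value Y
      linear_combination hode + (
        al * (c * an * geom 1 + 4 * c * an * geom 1 ^ 2 + 12 * c * an2 * geom 1 - c * bn * geom (-1)) +
        bl * (c * an * geom 1 + 4 * c * bn * geom (-1) ^ 2 + 12 * c * bn2 * geom (-1) -
          c * bn * geom (-1)) +
        an * (c * al * geom 1 + 4 * c * al * geom 1 ^ 2 + 12 * c * al2 * geom 1 - c * bl * geom (-1)) +
        bn * (c * al * geom 1 + 4 * c * bl * geom (-1) ^ 2 + 12 * c * bl2 * geom (-1) -
          c * bl * geom (-1))) * hr -
        c * (6 * an * al * geom 1 + (an * bl + al * bn) * geom 1 - 6 * bn * bl * geom (-1) -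
          (an * bl + al * bn) * geom (-1)) * h8 - 4 * c * al * geom 1 * e1 - 4 * c * an * geom 1 * e2 +
        4 * c * bl * geom (-1) * e3 + 4 * c * bn * geom (-1) * e4 -
        4 * c * an * al * hu + 4 * c * bn * bl * hv
    · obtain rfl : m = 0 := by omega
      simp [hYdef, constantCoeff_mergeSeries, twoPointSeries, constantCoeff_geom]
  rw [hK] at hgs
  rw [smul_eq_C_mul, smul_eq_C_mul]
  linear_combination invSqrt * hgs - genusSeries 0 {i, j} μ * hr

end BaseCases

section ProdSpan

open Finset.HasAntidiagonal (antidiagonal)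

/-- A product of one-variable coefficients indexed by a finite set. -/
noncomputable def coeffProd (S : Finset ℕ) (ε : ℕ → ℚ) (k : ℕ → ℕ) (μ : ℕ → ℕ) : ℚ :=
  ∏ i ∈ S, coeff (μ i) (invSqrt * geom (ε i) ^ k i)

/-- The span of the products of powers of the `u_ε`, one for each variable, of total degree at
most `D`; the variables indexed by `S` are replaced by their coefficients. -/
noncomputable def prodSpan (S : Finset ℕ) (D : ℕ) : Submodule ℚ ((ℕ → ℕ) → ℚ⟦X⟧) :=
  Submodule.span ℚ {F | ∃ (ε : ℕ → ℚ) (k : ℕ → ℕ) (η : ℚ) (d : ℕ), (∀ i, ε i ^ 2 = 1) ∧ η ^ 2 = 1 ∧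
    d + ∑ i ∈ S, k i ≤ D ∧ F = fun μ => coeffProd S ε k μ • (invSqrt * geom η ^ d)}

lemma coeffProd_smul_mem {S : Finset ℕ} {ε : ℕ → ℚ} {k : ℕ → ℕ} (hε : ∀ i, ε i ^ 2 = 1) {E D : ℕ}
    {G : ℚ⟦X⟧} (hG : G ∈ geomSpan E) (h : E + ∑ i ∈ S, k i ≤ D) :
    (fun μ => coeffProd S ε k μ • (invSqrt * G)) ∈ prodSpan S D := by
  induction hG using Submodule.span_induction with
  | mem G hG =>
    obtain ⟨η, d, hη, hd, rfl⟩ := hG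
    exact Submodule.subset_span ⟨ε, k, η, d, hε, hη, by omega, rfl⟩
  | zero =>
    simp only [mul_zero, smul_zero]
    exact (prodSpan S D).zero_mem
  | add f g _ _ hf hg =>
    simp only [mul_add, smul_add]
    exact (prodSpan S D).add_mem hf hg
  | smul a f _ hf =>
    convert (prodSpan S D).smul_mem a hf using 1
    ext1 μ
    rw [Pi.smul_apply, mul_smul_comm, smul_comm]

lemma mul_mem_prodSpan {B B' : Finset ℕ} (hB : Disjoint B B') {D D' : ℕ}
    {F F' : (ℕ → ℕ) → ℚ⟦X⟧} (hF : F ∈ prodSpan B D) (hF' : F' ∈ prodSpan B' D') :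
    (fun μ => invSqrt * X ^ 2 * (F μ * F' μ)) ∈ prodSpan (B ∪ B') (D + D' + 1) := by
  induction hF, hF' using Submodule.span_induction₂ with
  | mem_mem F F' hF hF' =>
    obtain ⟨ε, k, η, d, hε, hη, hd, rfl⟩ := hF
    obtain ⟨ε', k', η', d', hε', hη', hd', rfl⟩ := hF'
    have hG := geomSpan_mul_mem X_sq_mul_invSqrt_sq_mem
      (geomSpan_mul_mem (geom_pow_mem hη le_rfl) (geom_pow_mem hη' le_rfl) :
        geom η ^ d * geom η' ^ d' ∈ geomSpan (d + d'))
    have hm {i : ℕ} (hi : i ∈ B') : i ∉ B := fun h => Finset.disjoint_left.1 hB h hi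
    refine (congrArg (· ∈ prodSpan (B ∪ B') (D + D' + 1)) ?_).mp
      (coeffProd_smul_mem (S := B ∪ B') (ε := fun i => if i ∈ B then ε i else ε' i)
        (k := fun i => if i ∈ B then k i else k' i) (fun i => ?_) hG (D := D + D' + 1) ?_)
    · ext1 μ
      have h : coeffProd (B ∪ B') (fun i => if i ∈ B then ε i else ε' i)
          (fun i => if i ∈ B then k i else k' i) μ = coeffProd B ε k μ * coeffProd B' ε' k' μ := by
        simp only [coeffProd]
        rw [Finset.prod_union hB]
        congr 1
        · exact Finset.prod_congr rfl fun i hi => by rw [if_pos hi, if_pos hi]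
        · exact Finset.prod_congr rfl fun i hi => by rw [if_neg (hm hi), if_neg (hm hi)]
      rw [h]
      simp only [smul_eq_C_mul, map_mul]
      ring
    · split_ifs
      exacts [hε i, hε' i]
    · have h1 : ∑ i ∈ B, (if i ∈ B then k i else k' i) = ∑ i ∈ B, k i :=
        Finset.sum_congr rfl fun i hi => if_pos hi
      have h2 : ∑ i ∈ B', (if i ∈ B then k i else k' i) = ∑ i ∈ B', k' i :=
        Finset.sum_congr rfl fun i hi => if_neg (hm hi)
      rw [Finset.sum_union hB, h1, h2]
      omega
  | zero_left F' _ =>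
    simp only [mul_zero, zero_mul, Pi.zero_apply]
    exact Submodule.zero_mem _
  | zero_right F _ =>
    simp only [mul_zero, Pi.zero_apply]
    exact Submodule.zero_mem _
  | add_left F₁ F₂ F' _ _ _ h₁ h₂ =>
    simp only [Pi.add_apply, mul_add, add_mul]
    exact Submodule.add_mem _ h₁ h₂
  | add_right F F₁ F₂ _ _ _ h₁ h₂ =>
    simp only [Pi.add_apply, mul_add]
    exact Submodule.add_mem _ h₁ h₂
  | smul_left a F F' _ _ h =>
    simp only [Pi.smul_apply, smul_mul_assoc, mul_smul_comm]
    exact Submodule.smul_mem _ a h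
  | smul_right a F F' _ _ h =>
    simp only [Pi.smul_apply, mul_smul_comm]
    exact Submodule.smul_mem _ a h

lemma splitSeries_add (F G : ℕ → ℚ⟦X⟧) :
    splitSeries (fun q => F q + G q) = splitSeries F + splitSeries G := by
  ext n
  simp [splitSeries, Finset.sum_add_distrib]

lemma splitSeries_smul (a : ℚ) (F : ℕ → ℚ⟦X⟧) :
    splitSeries (fun q => a • F q) = a • splitSeries F := by
  ext n
  simp [splitSeries, Finset.mul_sum]

lemma splitSeries_coeff_smul (f h : ℚ⟦X⟧) : splitSeries (fun q => coeff q f • h) = h * f := by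
  ext n
  rw [splitSeries, coeff_mk, coeff_mul]
  exact Finset.sum_congr rfl fun p _ => by rw [map_smul, smul_eq_mul, mul_comm]

lemma split_mem_prodSpan {S : Finset ℕ} {i : ℕ} (hi : i ∉ S) {D : ℕ} {F : (ℕ → ℕ) → ℚ⟦X⟧}
    (hF : F ∈ prodSpan (insert i S) D) :
    (fun μ => invSqrt * X ^ 2 * splitSeries fun q => F (Function.update μ i q)) ∈
      prodSpan S (D + 1) := by
  induction hF using Submodule.span_induction with
  | mem F hF =>
    obtain ⟨ε, k, η, d, hε, hη, hd, rfl⟩ := hF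
    rw [Finset.sum_insert hi] at hd
    have hG := geomSpan_mul_mem X_sq_mul_invSqrt_sq_mem
      (geomSpan_mul_mem (geom_pow_mem hη le_rfl) (geom_pow_mem (hε i) le_rfl) :
        geom η ^ d * geom (ε i) ^ k i ∈ geomSpan (d + k i))
    refine (congrArg (· ∈ prodSpan S (D + 1)) ?_).mp (coeffProd_smul_mem (S := S) hε hG (k := k) ?_)
    · ext1 μ
      have h (q : ℕ) : coeffProd (insert i S) ε k (Function.update μ i q) =
          coeffProd S ε k μ * coeff q (invSqrt * geom (ε i) ^ k i) := by
        rw [coeffProd, Finset.prod_insert hi, Function.update_self, mul_comm, coeffProd]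
        congr 1
        refine Finset.prod_congr rfl fun j hj => ?_
        rw [Function.update_of_ne (ne_of_mem_of_not_mem hj hi)]
      simp only [h, mul_smul]
      rw [splitSeries_smul, splitSeries_coeff_smul, smul_eq_C_mul, smul_eq_C_mul]
      ring
    · omega
  | zero =>
    have h : splitSeries (fun _ => 0) = 0 := by ext; simp [splitSeries]
    simp only [Pi.zero_apply, h, mul_zero]
    exact Submodule.zero_mem _
  | add F G _ _ hF hG =>
    simp only [Pi.add_apply, splitSeries_add, mul_add]
    exact Submodule.add_mem _ hF hG
  | smul a F _ hF =>
    simp only [Pi.smul_apply, splitSeries_smul, mul_smul_comm]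
    exact Submodule.smul_mem _ a hF

lemma coeffProd_smul_mergeSpan_mem {S : Finset ℕ} {j : ℕ} (hj : j ∈ S) {ε : ℕ → ℚ} {k : ℕ → ℕ}
    (hε : ∀ i, ε i ^ 2 = 1) {E D : ℕ} {G : ℕ → ℚ⟦X⟧} (hG : G ∈ mergeSpan E)
    (h : E + ∑ i ∈ S.erase j, k i ≤ D) :
    (fun μ => coeffProd (S.erase j) ε k μ • G (μ j)) ∈ prodSpan S D := by
  induction hG using Submodule.span_induction with
  | mem G hG =>
    obtain ⟨θ, η, a, b, hθ, hη, hd, rfl⟩ := hG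
    have hm {i : ℕ} (hi : i ∈ S.erase j) : i ≠ j := Finset.ne_of_mem_erase hi
    refine Submodule.subset_span ⟨Function.update ε j η, Function.update k j b, θ, a, fun i => ?_,
      hθ, ?_, ?_⟩
    · rcases eq_or_ne i j with rfl | hi
      · rwa [Function.update_self]
      · rw [Function.update_of_ne hi, hε]
    · rw [← Finset.sum_erase_add _ _ hj, Function.update_self,
        Finset.sum_congr rfl fun i hi => Function.update_of_ne (hm hi) _ _]
      omega
    · ext1 μ
      rw [coeffProd, coeffProd, ← Finset.prod_erase_mul _ _ hj, Function.update_self,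
        Function.update_self, mul_smul]
      congr 1
      exact Finset.prod_congr rfl fun i hi => by
        rw [Function.update_of_ne (hm hi), Function.update_of_ne (hm hi)]
  | zero =>
    simp only [smul_zero, Pi.zero_apply]
    exact (prodSpan S D).zero_mem
  | add f g _ _ hf hg =>
    simp only [Pi.add_apply, smul_add]
    exact (prodSpan S D).add_mem hf hg
  | smul a f _ hf =>
    convert (prodSpan S D).smul_mem a hf using 1
    ext1 μ
    rw [Pi.smul_apply, Pi.smul_apply, smul_comm]

lemma merge_mem_prodSpan {S : Finset ℕ} {j : ℕ} (hj : j ∈ S) {D : ℕ} {F : (ℕ → ℕ) → ℚ⟦X⟧}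
    (hF : F ∈ prodSpan (S.erase j) D) :
    (fun μ => mergeOp planarSeries (μ j) (F μ)) ∈ prodSpan S (D + 2) := by
  induction hF using Submodule.span_induction with
  | mem F hF =>
    obtain ⟨ε, k, η, d, hε, hη, hd, rfl⟩ := hF
    simp only [mergeOp_smul]
    exact coeffProd_smul_mergeSpan_mem hj hε (mergeOp_mem one_sub_planarSeries hη d) (by omega)
  | zero =>
    simp only [Pi.zero_apply, mergeOp, mergeSeries_apply_zero, mul_zero, add_zero]
    exact Submodule.zero_mem _
  | add F G _ _ hF hG =>
    simp only [Pi.add_apply, mergeOp_add]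
    exact Submodule.add_mem _ hF hG
  | smul a F _ hF =>
    simp only [Pi.smul_apply, mergeOp_smul]
    exact Submodule.smul_mem _ a hF

lemma genusSeries_one_empty_mem : genusSeries 1 ∅ ∈ prodSpan ∅ 2 := by
  have h := geomSpan_mul_mem X_sq_mul_invSqrt_sq_mem X_sq_mul_invSqrt_sq_mem
  convert coeffProd_smul_mem (S := ∅) (ε := 1) (k := 0) (by simp) h (D := 2) (by simp) using 1
  ext1 μ
  rw [genusSeries_one_empty, coeffProd, Finset.prod_empty, one_smul, pow_two (_ * _)]

lemma genusSeries_zero_pair_mem {i j : ℕ} (hij : i ≠ j) :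
    genusSeries 0 {i, j} ∈ prodSpan {i, j} 3 := by
  have h (ε : ℚ) (hε : ε ^ 2 = 1) := coeffProd_smul_mem (S := {i, j}) (ε := fun _ => ε)
    (k := fun _ => 1) (fun _ => hε) (geom_pow_mem hε le_rfl : geom ε ^ 1 ∈ geomSpan 1) (D := 3)
    (by simp [Finset.sum_pair hij])
  convert Submodule.sub_mem _ (Submodule.smul_mem _ (1 / 2) (h 1 (by norm_num)))
    (Submodule.smul_mem _ (1 / 2) (h (-1) (by norm_num))) using 1
  ext1 μ
  simp only [genusSeries_zero_pair hij, coeffProd, Finset.prod_pair hij, pow_one, Pi.sub_apply,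
    Pi.smul_apply, smul_smul]

lemma genusSeries_mem_prodSpan (g : ℕ) (S : Finset ℕ) (h : 2 ≤ 2 * g + S.card) :
    genusSeries g S ∈ prodSpan S (3 * g + 2 * S.card - 1) := by
  induction hn : 2 * g + S.card using Nat.strong_induction_on generalizing g S with
  | _ n ih =>
  subst hn
  rcases h.eq_or_lt with h2 | h3
  · rcases g with _ | g
    · obtain ⟨i, j, hij, rfl⟩ := Finset.card_eq_two.1 (by omega : S.card = 2)
      rw [Finset.card_pair hij]
      exact genusSeries_zero_pair_mem hij
    · obtain rfl : S = ∅ := Finset.card_eq_zero.1 (by omega)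
      obtain rfl : g = 0 := by omega
      exact genusSeries_one_empty_mem
  obtain ⟨i, hi⟩ := exists_notMem S
  have heq : genusSeries g S = ∑ j ∈ S, (fun μ => mergeOp planarSeries (μ j)
      (genusSeries g (S.erase j) μ)) + (fun μ => if g = 0 then 0 else invSqrt * X ^ 2 *
        splitSeries fun q => genusSeries (g - 1) (insert i S) (Function.update μ i q)) +
      ∑ a ∈ antidiagonal g, ∑ B ∈ S.powerset, (fun μ => invSqrt * X ^ 2 *
        (stableSeries a.1 B μ * stableSeries a.2 (S \ B) μ)) := by
    ext1 μ
    simp only [Pi.add_apply, Finset.sum_apply]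
    exact genusSeries_stable g S μ i hi h3
  rw [heq]
  refine Submodule.add_mem _ (Submodule.add_mem _ (Submodule.sum_mem _ fun j hj => ?_) ?_)
    (Submodule.sum_mem _ fun a ha => Submodule.sum_mem _ fun B hB => ?_)
  · have hc := Finset.card_erase_add_one hj
    convert merge_mem_prodSpan hj (ih _ (by omega) g (S.erase j) (by omega) rfl) using 2
    omega
  · rcases g with _ | g
    · exact Submodule.zero_mem _
    · have hc := Finset.card_insert_of_notMem hi
      simp only [Nat.succ_ne_zero, if_false, Nat.add_sub_cancel]
      convert split_mem_prodSpan hi (ih _ (by omega) g (insert i S) (by omega) rfl) using 2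
      omega
  · have hc := Finset.card_sdiff_add_card_eq_card (Finset.mem_powerset.1 hB)
    have hg := Finset.HasAntidiagonal.mem_antidiagonal.1 ha
    by_cases hs : 2 ≤ 2 * a.1 + B.card ∧ 2 ≤ 2 * a.2 + (S \ B).card
    · simp only [stableSeries, if_pos hs.1, if_pos hs.2]
      have := mul_mem_prodSpan Finset.disjoint_sdiff (ih _ (by omega) a.1 B hs.1 rfl)
        (ih _ (by omega) a.2 (S \ B) hs.2 rfl)
      rw [Finset.union_sdiff_of_subset (Finset.mem_powerset.1 hB)] at this
      convert this using 2
      omega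
    · convert Submodule.zero_mem (prodSpan S (3 * g + 2 * S.card - 1)) using 1
      ext1 μ
      rcases not_and_or.1 hs with h | h
      · rw [stableSeries, if_neg h, zero_mul, mul_zero, Pi.zero_apply]
      · rw [mul_comm (stableSeries _ _ _), stableSeries, if_neg h, zero_mul, mul_zero, Pi.zero_apply]

end ProdSpan

section EvenCoefficients

/-- The even coefficients are central binomial coefficients times a polynomial. -/
def IsCentralBinomMul (D : ℕ) (f : ℚ⟦X⟧) : Prop :=
  ∃ q : Polynomial ℚ, q.natDegree ≤ D ∧
    ∀ ν : ℕ, coeff (2 * ν) f = Nat.centralBinom ν * q.eval (ν : ℚ)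

lemma IsCentralBinomMul.mono {D E : ℕ} {f : ℚ⟦X⟧} (h : IsCentralBinomMul D f) (hDE : D ≤ E) :
    IsCentralBinomMul E f :=
  let ⟨q, hq, hf⟩ := h
  ⟨q, hq.trans hDE, hf⟩

lemma IsCentralBinomMul.add {D : ℕ} {f g : ℚ⟦X⟧} (hf : IsCentralBinomMul D f)
    (hg : IsCentralBinomMul D g) : IsCentralBinomMul D (f + g) := by
  obtain ⟨p, hp, hf⟩ := hf
  obtain ⟨q, hq, hg⟩ := hg
  exact ⟨p + q, Polynomial.natDegree_add_le_of_degree_le hp hq, fun ν => by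
    rw [map_add, hf, hg, Polynomial.eval_add, mul_add]⟩

lemma IsCentralBinomMul.C_mul {D : ℕ} {f : ℚ⟦X⟧} (a : ℚ) (hf : IsCentralBinomMul D f) :
    IsCentralBinomMul D (C a * f) := by
  obtain ⟨p, hp, hf⟩ := hf
  exact ⟨Polynomial.C a * p, (Polynomial.natDegree_C_mul_le a p).trans hp, fun ν => by
    rw [coeff_C_mul, hf, Polynomial.eval_mul, Polynomial.eval_C]; ring⟩

lemma X_mul_derivative_invSqrt_mul (j : ℕ) :
    X * d⁄dX ℚ (invSqrt * (X ^ 2 * invSqrt ^ 2) ^ j) =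
      C (2 * (j : ℚ)) * (invSqrt * (X ^ 2 * invSqrt ^ 2) ^ j) +
        C (4 + 8 * (j : ℚ)) * (invSqrt * (X ^ 2 * invSqrt ^ 2) ^ (j + 1)) := by
  induction j with
  | zero =>
    simp only [pow_zero, mul_one, Nat.cast_zero, mul_zero, map_zero, zero_mul, add_zero,
      map_ofNat, derivative_invSqrt]
    ring
  | succ j ih =>
    rw [pow_succ _ j, ← mul_assoc, Derivation.leibniz]
    simp only [Derivation.leibniz, derivative_pow, derivative_X, smul_eq_mul, derivative_invSqrt,
      map_mul, map_add, map_ofNat, map_natCast, Nat.cast_add, Nat.cast_one, map_one] at ih ⊢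
    push_cast
    linear_combination (X ^ 2 * invSqrt ^ 2) * ih

lemma isCentralBinomMul_invSqrt_mul (j : ℕ) :
    IsCentralBinomMul j (invSqrt * (X ^ 2 * invSqrt ^ 2) ^ j) := by
  induction j with
  | zero => exact ⟨1, by simp, fun ν => by simp [invSqrt]⟩
  | succ j ih =>
    obtain ⟨q, hq, h⟩ := ih
    refine ⟨Polynomial.C (1 / (4 * (j : ℚ) + 2)) * (Polynomial.X - Polynomial.C (j : ℚ)) * q,
      ?_, fun ν => ?_⟩
    · refine Polynomial.natDegree_mul_le.trans ?_
      have := Polynomial.natDegree_C_mul_le (1 / (4 * (j : ℚ) + 2))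
        (Polynomial.X - Polynomial.C (j : ℚ))
      rw [Polynomial.natDegree_X_sub_C] at this
      omega
    · have := congrArg (coeff (2 * ν)) (X_mul_derivative_invSqrt_mul j)
      rw [coeff_X_mul_derivative, map_add, coeff_C_mul, coeff_C_mul, h] at this
      push_cast at this
      have h2 : (4 * (j : ℚ) + 2) ≠ 0 := by positivity
      simp only [Polynomial.eval_mul, Polynomial.eval_C, Polynomial.eval_sub, Polynomial.eval_X]
      field_simp
      linear_combination -(1 / 2) * this

lemma rescale_invSqrt : rescale (-1 : ℚ) invSqrt = invSqrt := by
  ext n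
  rw [coeff_rescale, invSqrt, coeff_mk]
  split_ifs with h
  · rw [h.neg_one_pow, one_mul]
  · rw [mul_zero]

lemma rescale_geom (ε : ℚ) : rescale (-1 : ℚ) (geom ε) = -geom (-ε) := by
  ext n
  rw [coeff_rescale, geom, geom, map_neg]
  rcases n with _ | n
  · simp
  · rw [coeff_succ_X_mul, coeff_succ_X_mul, coeff_mk, coeff_mk,
      show 2 * -ε = -1 * (2 * ε) by ring, mul_pow (-1)]
    ring

lemma isCentralBinomMul_sum_pow {ε : ℚ} (hε : ε ^ 2 = 1) (d j : ℕ) :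
    IsCentralBinomMul (j + d)
      (invSqrt * (X ^ 2 * invSqrt ^ 2) ^ j * (geom ε ^ d + (-geom (-ε)) ^ d)) := by
  induction d using Nat.twoStepInduction generalizing j with
  | zero =>
    rw [add_zero]
    convert (isCentralBinomMul_invSqrt_mul j).C_mul 2 using 1
    rw [map_ofNat]
    ring
  | one =>
    convert (isCentralBinomMul_invSqrt_mul (j + 1)).C_mul (4 * ε) using 1
    have h := X_sq_mul_invSqrt_sq hε
    rw [map_neg, show ε / 4 = 1 / 4 * ε by ring, map_mul C] at h
    have h4 : (4 : ℚ⟦X⟧) * C (1 / 4) = 1 := by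
      rw [← map_ofNat C 4, ← map_mul, ← map_one C]; norm_num
    rw [map_mul, map_ofNat]
    linear_combination -invSqrt * (X ^ 2 * invSqrt ^ 2) ^ j * (4 * C ε * h +
      (geom ε - geom (-ε)) * (4 * C (1 / 4) * sq_C hε + h4))
  | more d h0 h1 =>
    convert (((h1 (j + 1)).C_mul (4 * ε)).mono (by omega : _ ≤ j + (d + 2))).add
      ((h0 (j + 1)).mono (by omega : _ ≤ j + (d + 2))) using 1
    have hd := geom_sub_geom_neg ε
    have hs := geom_mul_geom_neg hε
    rw [hs] at hd
    rw [map_mul, map_ofNat]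
    linear_combination invSqrt * (X ^ 2 * invSqrt ^ 2) ^ j *
      ((geom ε ^ (d + 1) + (-geom (-ε)) ^ (d + 1)) * hd + (geom ε ^ d + (-geom (-ε)) ^ d) * hs)

lemma isCentralBinomMul_invSqrt_mul_geom {ε : ℚ} (hε : ε ^ 2 = 1) (d : ℕ) :
    IsCentralBinomMul d (invSqrt * geom ε ^ d) := by
  obtain ⟨q, hq, h⟩ := ((isCentralBinomMul_sum_pow hε d 0).C_mul (1 / 2)).mono (zero_add d).le
  refine ⟨q, hq, fun ν => ?_⟩
  rw [← h, coeff_C_mul, pow_zero, mul_one, mul_add, map_add]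
  have := coeff_rescale (invSqrt * geom ε ^ d) (-1 : ℚ) (2 * ν)
  rw [map_mul, map_pow, rescale_invSqrt, rescale_geom, (even_two_mul ν).neg_one_pow, one_mul] at this
  rw [this]
  ring

lemma exists_coeff_eq_of_mem_prodSpan {S : Finset ℕ} {D : ℕ} {F : (ℕ → ℕ) → ℚ⟦X⟧}
    (hF : F ∈ prodSpan S D) : ∃ q : Polynomial ℚ, q.natDegree ≤ D ∧ ∀ ν : ℕ,
      coeff (2 * ν) (F fun _ => 2 * ν) = Nat.centralBinom ν ^ (S.card + 1) * q.eval (ν : ℚ) := by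
  induction hF using Submodule.span_induction with
  | mem F hF =>
    obtain ⟨ε, k, η, d, hε, hη, hd, rfl⟩ := hF
    choose q hq h using fun i => isCentralBinomMul_invSqrt_mul_geom (hε i) (k i)
    obtain ⟨p, hp, h'⟩ := isCentralBinomMul_invSqrt_mul_geom hη d
    refine ⟨p * ∏ i ∈ S, q i, ?_, fun ν => ?_⟩
    · exact (Polynomial.natDegree_mul_le.trans (add_le_add hp ((Polynomial.natDegree_prod_le _ _).trans
        (Finset.sum_le_sum fun i _ => hq i)))).trans hd
    · simp only [map_smul, smul_eq_mul, coeffProd, h, h', Polynomial.eval_mul, Polynomial.eval_prod,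
        Finset.prod_mul_distrib, Finset.prod_const]
      ring
  | zero => exact ⟨0, by simp, fun ν => by simp⟩
  | add F G _ _ hF hG =>
    obtain ⟨p, hp, hF⟩ := hF
    obtain ⟨q, hq, hG⟩ := hG
    exact ⟨p + q, Polynomial.natDegree_add_le_of_degree_le hp hq, fun ν => by
      rw [Pi.add_apply, map_add, hF, hG, Polynomial.eval_add, mul_add]⟩
  | smul a F _ hF =>
    obtain ⟨p, hp, hF⟩ := hF
    exact ⟨Polynomial.C a * p, (Polynomial.natDegree_C_mul_le a p).trans hp, fun ν => by
      rw [Pi.smul_apply, map_smul, hF, Polynomial.eval_mul, Polynomial.eval_C, smul_eq_mul]; ring⟩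

lemma exists_genusPoly_coeff_eq (g : ℕ) (S : Finset ℕ) (h : 2 ≤ 2 * g + S.card) :
    ∃ q : Polynomial ℚ, q.natDegree ≤ 3 * g + 2 * S.card - 1 ∧ ∀ ν : ℕ,
      (genusPoly (2 * ν) S fun _ => 2 * ν).coeff g =
        Nat.centralBinom ν ^ (S.card + 1) * q.eval (ν : ℚ) := by
  obtain ⟨q, hq, hF⟩ := exists_coeff_eq_of_mem_prodSpan (genusSeries_mem_prodSpan g S h)
  exact ⟨q, hq, fun ν => by rw [← hF, genusSeries, coeff_mk]⟩

end EvenCoefficients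

section Pairings

lemma apply_apply_of_mul_self {X : Type*} {α : Equiv.Perm X} (h : α * α = 1) (x : X) : α (α x) = x := by
  rw [← Equiv.Perm.mul_apply, h, Equiv.Perm.one_apply]

variable {X : Type*} [Fintype X] [DecidableEq X]

/-- The fixed-point-free involutions of `S`, seen as permutations of the ambient type. -/
def pairings (S : Finset X) : Finset (Equiv.Perm X) :=
  Finset.univ.filter fun α => α * α = 1 ∧ α.support = S

lemma mem_pairings {S : Finset X} {α : Equiv.Perm X} :
    α ∈ pairings S ↔ α * α = 1 ∧ α.support = S := by
  simp [pairings]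

lemma apply_mem_of_mem_pairings {S : Finset X} {α : Equiv.Perm X} (h : α ∈ pairings S) {x : X} :
    α x ∈ S ↔ x ∈ S := by
  rw [← (mem_pairings.1 h).2, Equiv.Perm.apply_mem_support]

lemma apply_ne_of_mem_pairings {S : Finset X} {α : Equiv.Perm X} (h : α ∈ pairings S) {x : X}
    (hx : x ∈ S) : α x ≠ x := by
  rw [← (mem_pairings.1 h).2] at hx
  exact Equiv.Perm.mem_support.1 hx

lemma apply_eq_of_mem_pairings {S : Finset X} {α : Equiv.Perm X} (h : α ∈ pairings S) {x : X}
    (hx : x ∉ S) : α x = x := by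
  rw [← (mem_pairings.1 h).2] at hx
  exact Equiv.Perm.notMem_support.1 hx

lemma mem_pairings_iff {S : Finset X} {α : Equiv.Perm X} :
    α ∈ pairings S ↔ (∀ x, α (α x) = x) ∧ ∀ x, α x ≠ x ↔ x ∈ S := by
  rw [mem_pairings]
  refine and_congr ⟨fun h => apply_apply_of_mul_self h, fun h => Equiv.ext h⟩ ?_
  simp [Finset.ext_iff]

lemma pairings_empty : pairings (∅ : Finset X) = {1} := by
  ext α
  rw [mem_pairings, Equiv.Perm.support_eq_empty_iff, Finset.mem_singleton]
  exact ⟨fun h => h.2, fun h => by simp [h]⟩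

lemma swap_mul_mem_pairings {S : Finset X} {x y : X} (hx : x ∉ S) (hy : y ∉ S) (hxy : x ≠ y)
    {β : Equiv.Perm X} (hβ : β ∈ pairings S) :
    Equiv.swap x y * β ∈ pairings (insert x (insert y S)) := by
  have hx' := apply_eq_of_mem_pairings hβ hx
  have hy' := apply_eq_of_mem_pairings hβ hy
  rw [mem_pairings_iff] at hβ ⊢
  have key : ∀ z, z ≠ x → z ≠ y → (Equiv.swap x y * β) z = β z := by
    intro z hzx hzy
    rw [Equiv.Perm.mul_apply, Equiv.swap_apply_of_ne_of_ne]
    · intro h; apply hzx; rw [← hβ.1 z, h, hx']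
    · intro h; apply hzy; rw [← hβ.1 z, h, hy']
  have kx : (Equiv.swap x y * β) x = y := by simp [hx']
  have ky : (Equiv.swap x y * β) y = x := by simp [hy']
  constructor
  · intro z
    by_cases hzx : z = x
    · rw [hzx, kx, ky]
    by_cases hzy : z = y
    · rw [hzy, ky, kx]
    have h1 : β z ≠ x := fun h => hzx (by rw [← hβ.1 z, h, hx'])
    have h2 : β z ≠ y := fun h => hzy (by rw [← hβ.1 z, h, hy'])
    rw [key z hzx hzy, key _ h1 h2, hβ.1]
  · intro z
    by_cases hzx : z = x
    · rw [hzx, kx]; simp [hxy.symm]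
    by_cases hzy : z = y
    · rw [hzy, ky]; simp [hxy]
    rw [key z hzx hzy, hβ.2]; simp [hzx, hzy]

lemma swap_mul_mem_pairings_erase {S : Finset X} {x : X} (hx : x ∈ S)
    {α : Equiv.Perm X} (hα : α ∈ pairings S) :
    Equiv.swap x (α x) * α ∈ pairings ((S.erase x).erase (α x)) := by
  have hne := apply_ne_of_mem_pairings hα hx
  rw [mem_pairings_iff] at hα ⊢
  have key : ∀ z, z ≠ x → z ≠ α x → (Equiv.swap x (α x) * α) z = α z := by
    intro z hzx hzy
    rw [Equiv.Perm.mul_apply, Equiv.swap_apply_of_ne_of_ne]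
    · intro h; apply hzy; rw [← h, hα.1]
    · intro h; exact hzx (α.injective h)
  have kx : (Equiv.swap x (α x) * α) x = x := by simp
  have ky : (Equiv.swap x (α x) * α) (α x) = α x := by simp [hα.1]
  constructor
  · intro z
    by_cases hzx : z = x
    · rw [hzx, kx, kx]
    by_cases hzy : z = α x
    · rw [hzy, ky, ky]
    rw [key z hzx hzy, key, hα.1]
    · intro h; apply hzy; rw [← h, hα.1]
    · intro h; exact hzx (α.injective h)
  · intro z
    by_cases hzx : z = x
    · rw [hzx, kx]; simp
    by_cases hzy : z = α x
    · rw [hzy, ky]; simp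
    rw [key z hzx hzy, hα.2]; simp [hzx, hzy]

/-- Sums over pairings, organised by the partner of a given point. -/
lemma sum_pairings {M : Type*} [AddCommMonoid M] {S : Finset X} {x : X} (hx : x ∈ S)
    (F : Equiv.Perm X → M) :
    ∑ α ∈ pairings S, F α =
      ∑ j ∈ S.erase x, ∑ β ∈ pairings ((S.erase x).erase j), F (Equiv.swap x j * β) := by
  rw [Finset.sum_sigma']
  refine Finset.sum_bij' (fun α _ => ⟨α x, Equiv.swap x (α x) * α⟩)
    (fun y _ => Equiv.swap x y.1 * y.2) ?_ ?_ ?_ ?_ ?_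
  · intro α hα
    simp only [Finset.mem_sigma]
    exact ⟨Finset.mem_erase.2 ⟨apply_ne_of_mem_pairings hα hx, (apply_mem_of_mem_pairings hα).2 hx⟩,
      swap_mul_mem_pairings_erase hx hα⟩
  · rintro ⟨j, β⟩ h
    simp only [Finset.mem_sigma] at h
    have hj := Finset.mem_erase.1 h.1
    have := swap_mul_mem_pairings (x := x) (y := j) (by simp) (by simp) hj.1.symm h.2
    rwa [Finset.insert_erase h.1, Finset.insert_erase hx] at this
  · intro α hα
    simp [← mul_assoc]
  · rintro ⟨j, β⟩ h
    simp only [Finset.mem_sigma] at h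
    have : β x = x := apply_eq_of_mem_pairings h.2 (by simp)
    simp [this, ← mul_assoc]
  · intro α hα
    simp [← mul_assoc]

/-- The Wick formula. -/
lemma gaussian_prod_X {n : Type*} [Fintype n] [DecidableEq n] (s : ℚ) (S : Finset X)
    (p : X → n × n) :
    gaussian s (∏ x ∈ S, MvPolynomial.X (p x)) =
      ∑ α ∈ pairings S, if ∀ x ∈ S, p (α x) = (p x).swap then s ^ (S.card / 2) else 0 := by
  induction S using Finset.strongInduction with
  | H S ih =>
    obtain rfl | ⟨x, hx⟩ := S.eq_empty_or_nonempty
    · simp [pairings_empty, gaussian_one]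
    rw [sum_pairings hx, ← Finset.mul_prod_erase S _ hx, gaussian_X_mul, derivation_prod, map_sum,
      Finset.mul_sum]
    refine Finset.sum_congr rfl fun j hj => ?_
    have hj' := Finset.mem_erase.1 hj
    have hcard : S.card / 2 = ((S.erase x).erase j).card / 2 + 1 := by
      rw [Finset.card_erase_of_mem hj, Finset.card_erase_of_mem hx]
      have : 0 < (S.erase x).card := Finset.card_pos.2 ⟨j, hj⟩
      rw [Finset.card_erase_of_mem hx] at this
      omega
    have hiff : ∀ β ∈ pairings ((S.erase x).erase j),
        ((∀ y ∈ S, p ((Equiv.swap x j * β) y) = (p y).swap) ↔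
          p j = (p x).swap ∧ ∀ y ∈ (S.erase x).erase j, p (β y) = (p y).swap) := by
      intro β hβ
      have hβx : β x = x := apply_eq_of_mem_pairings hβ (by simp)
      have hβj : β j = j := apply_eq_of_mem_pairings hβ (by simp)
      have key : ∀ y ∈ (S.erase x).erase j, (Equiv.swap x j * β) y = β y := by
        intro y hy
        have h := (apply_mem_of_mem_pairings hβ).2 hy
        simp only [Finset.mem_erase] at h
        rw [Equiv.Perm.mul_apply, Equiv.swap_apply_of_ne_of_ne h.2.1 h.1]
      constructor
      · intro h
        refine ⟨by simpa [hβx] using h x hx, fun y hy => ?_⟩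
        rw [← key y hy]
        exact h y (Finset.mem_of_mem_erase (Finset.mem_of_mem_erase hy))
      · rintro ⟨h1, h2⟩ y hy
        by_cases hyx : y = x
        · subst hyx; simpa [hβx] using h1
        by_cases hyj : y = j
        · subst hyj; simp [hβj, h1]
        have hy' : y ∈ (S.erase x).erase j := by simp [hy, hyx, hyj]
        rw [key y hy', h2 y hy']
    rw [MvPolynomial.pderiv_X, Finset.sum_congr rfl fun β hβ => by rw [if_congr (hiff β hβ) rfl rfl]]
    by_cases hp : p j = (p x).swap
    · simp only [hp, true_and, Pi.single_eq_same, one_mul]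
      rw [ih _ ((Finset.erase_subset _ _).trans_ssubset (Finset.erase_ssubset hx)), Finset.mul_sum]
      refine Finset.sum_congr rfl fun β _ => ?_
      rw [hcard, pow_succ', mul_ite, mul_zero]
    · simp [hp]

end Pairings

section Colorings

/-- Entries of powers of a matrix as sums over walks. -/
lemma pow_mulVec_eq_sum {n R : Type*} [Fintype n] [DecidableEq n] [CommRing R] (M : Matrix n n R)
    (m : ℕ) (v : n → R) (i : n) :
    (M ^ m).mulVec v i = ∑ d : Fin m → n,
      (∏ x : Fin m, M ((Fin.cons i d : Fin (m + 1) → n) x.castSucc) (d x)) *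
        v ((Fin.cons i d : Fin (m + 1) → n) (Fin.last m)) := by
  induction m generalizing i with
  | zero => simp
  | succ m ih =>
    rw [pow_succ', ← Matrix.mulVec_mulVec, Matrix.mulVec, dotProduct,
      ← (Fin.consEquiv fun _ : Fin (m + 1) => n).sum_comp, Fintype.sum_prod_type]
    refine Finset.sum_congr rfl fun j _ => ?_
    rw [ih, Finset.mul_sum]
    refine Finset.sum_congr rfl fun d _ => ?_
    rw [Fin.prod_univ_succ, mul_assoc]
    simp [Fin.consEquiv, ← Fin.succ_last]

lemma trace_pow_eq_sum {n R : Type*} [Fintype n] [DecidableEq n] [CommRing R] (M : Matrix n n R)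
    {m : ℕ} (hm : m ≠ 0) :
    (M ^ m).trace = ∑ d : Fin m → n, ∏ x, M (d x) (d (finRotate m x)) := by
  obtain ⟨m, rfl⟩ := Nat.exists_eq_succ_of_ne_zero hm
  rw [← (Fin.consEquiv fun _ : Fin (m + 1) => n).sum_comp, Fintype.sum_prod_type, Matrix.trace]
  refine Finset.sum_congr rfl fun i _ => ?_
  have : (M ^ (m + 1)).diag i = (M ^ m).mulVec (fun l => M l i) i := by
    rw [Matrix.diag_apply, pow_succ, Matrix.mul_apply, Matrix.mulVec, dotProduct]
  rw [this, pow_mulVec_eq_sum]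
  refine Finset.sum_congr rfl fun d _ => ?_
  rw [Fin.prod_univ_castSucc]
  simp [Fin.consEquiv, Fin.coeSucc_eq_succ]

variable {X : Type*} [Fintype X] [DecidableEq X]

/-- The number of colourings of `X` by `N` colours in which `α x` and `σ x` have the same colour
for all `x ∈ S`. -/
def coloringCount (σ : Equiv.Perm X) (N : ℕ) (S : Finset X) (α : Equiv.Perm X) : ℕ :=
  (Finset.univ.filter fun c : X → Fin N => ∀ x ∈ S, c (α x) = c (σ x)).card

lemma sum_gaussian_prod (σ : Equiv.Perm X) (N : ℕ) (S : Finset X) (s : ℚ) :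
    ∑ c : X → Fin N, gaussian s (∏ x ∈ S, MvPolynomial.X (c x, c (σ x))) =
      s ^ (S.card / 2) * ∑ α ∈ pairings S, (coloringCount σ N S α : ℚ) := by
  simp_rw [gaussian_prod_X s S fun x => (_, _)]
  rw [Finset.sum_comm, Finset.mul_sum]
  refine Finset.sum_congr rfl fun α hα => ?_
  rw [coloringCount, Finset.card_filter, Nat.cast_sum, Finset.mul_sum]
  refine Finset.sum_congr rfl fun c _ => ?_
  have h1 := (mem_pairings_iff.1 hα).1
  have : (∀ x ∈ S, ((c (α x), c (σ (α x))) : Fin N × Fin N) = (c x, c (σ x)).swap) ↔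
      ∀ x ∈ S, c (α x) = c (σ x) := by
    simp only [Prod.swap_prod_mk, Prod.mk.injEq]
    refine ⟨fun h x hx => (h x hx).1, fun h x hx => ⟨h x hx, ?_⟩⟩
    rw [← h _ ((apply_mem_of_mem_pairings hα).2 hx), h1]
  rw [if_congr this rfl rfl]
  split_ifs <;> simp

end Colorings

section Fibers

variable {X : Type*} [Fintype X]

/-- The points of `X` lying over `T`. -/
def fiberSet (ver : X → ℕ) (T : Finset ℕ) : Finset X :=
  Finset.univ.filter fun x => ver x ∈ T

@[simp]
lemma mem_fiberSet {ver : X → ℕ} {T : Finset ℕ} {x : X} :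
    x ∈ fiberSet ver T ↔ ver x ∈ T := by
  simp [fiberSet]

/-- The identification of `Fin k × Fin b` with the union of `k` consecutive blocks of length `b`. -/
def blockEquiv (b k : ℕ) : Fin k × Fin b ≃ Fin (b * k) :=
  finProdFinEquiv.trans (finCongr (Nat.mul_comm k b))

/-- The block containing a point. -/
def blockIndex (b k : ℕ) (x : Fin (b * k)) : ℕ := ((blockEquiv b k).symm x).1

lemma blockIndex_blockEquiv (b k : ℕ) (y : Fin k × Fin b) :
    blockIndex b k (blockEquiv b k y) = y.1 := by
  simp [blockIndex]

lemma blockIndex_lt (b k : ℕ) (x : Fin (b * k)) : blockIndex b k x < k :=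
  Fin.is_lt _

lemma blockPerm_blockEquiv (b k : ℕ) (y : Fin k × Fin b) :
    blockPerm b k (blockEquiv b k y) = blockEquiv b k (y.1, finRotate b y.2) := by
  rw [blockPerm, ← blockEquiv, Equiv.permCongr_apply, Equiv.symm_apply_apply]
  rfl

lemma blockIndex_blockPerm (b k : ℕ) (x : Fin (b * k)) :
    blockIndex b k (blockPerm b k x) = blockIndex b k x := by
  obtain ⟨y, rfl⟩ := (blockEquiv b k).surjective x
  rw [blockPerm_blockEquiv, blockIndex_blockEquiv, blockIndex_blockEquiv]

lemma card_filter_mem {k : ℕ} {T : Finset ℕ} (hT : T ⊆ Finset.range k) :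
    (Finset.univ.filter fun i : Fin k => (i : ℕ) ∈ T).card = T.card := by
  rw [← Finset.card_map Fin.valEmbedding]
  congr 1
  ext i
  simp only [Finset.mem_map, Finset.mem_filter, Finset.mem_univ, true_and, Fin.valEmbedding_apply]
  exact ⟨by rintro ⟨j, hj, rfl⟩; exact hj,
    fun h => ⟨⟨i, Finset.mem_range.1 (hT h)⟩, h, rfl⟩⟩

lemma card_fiberSet_blockIndex (b : ℕ) {k : ℕ} {T : Finset ℕ} (hT : T ⊆ Finset.range k) :
    (fiberSet (blockIndex b k) T).card = b * T.card := by
  rw [fiberSet, Finset.card_filter, ← (blockEquiv b k).sum_comp, Fintype.sum_prod_type]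
  simp only [blockIndex_blockEquiv]
  rw [← card_filter_mem hT, Finset.card_filter, Finset.mul_sum]
  simp

lemma prod_scaledTrace (N b k : ℕ) (hb : b ≠ 0) {T : Finset ℕ} (hT : T ⊆ Finset.range k) :
    ((N : ℚ) ^ b) ^ (k - T.card) • ∏ _i ∈ T, scaledTrace N b =
      (N : ℚ) ^ T.card • ∑ c : Fin (b * k) → Fin N, ∏ x ∈ fiberSet (blockIndex b k) T,
        MvPolynomial.X (c x, c (blockPerm b k x)) := by
  have h1 : ∏ i : Fin k, (∑ d : Fin b → Fin N, ∏ a : Fin b, if (i : ℕ) ∈ T then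
      (MvPolynomial.X (d a, d (finRotate b a)) : MvPolynomial (Fin N × Fin N) ℚ) else 1) =
      ((genericMatrix ^ b).trace) ^ T.card * MvPolynomial.C (((N : ℚ) ^ b) ^ (k - T.card)) := by
    have : ∀ i : Fin k, (∑ d : Fin b → Fin N, ∏ a : Fin b, if (i : ℕ) ∈ T then
      (MvPolynomial.X (d a, d (finRotate b a)) : MvPolynomial (Fin N × Fin N) ℚ) else 1) =
      if (i : ℕ) ∈ T then (genericMatrix ^ b).trace else MvPolynomial.C ((N : ℚ) ^ b) := by
      intro i
      split_ifs
      · rw [trace_pow_eq_sum _ hb]; rfl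
      · simp
    rw [Finset.prod_congr rfl fun i _ => this i, Finset.prod_ite, Finset.prod_const,
      Finset.prod_const, card_filter_mem hT, ← MvPolynomial.C_pow]
    congr 4
    have := Finset.card_filter_add_card_filter_not (s := (Finset.univ : Finset (Fin k)))
      (fun i : Fin k => (i : ℕ) ∈ T)
    rw [card_filter_mem hT] at this
    simp at this
    omega
  have h2 : ∑ c : Fin (b * k) → Fin N, ∏ x ∈ fiberSet (blockIndex b k) T,
        (MvPolynomial.X (c x, c (blockPerm b k x)) : MvPolynomial (Fin N × Fin N) ℚ) =
      ∏ i : Fin k, (∑ d : Fin b → Fin N, ∏ a : Fin b, if (i : ℕ) ∈ T then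
      (MvPolynomial.X (d a, d (finRotate b a)) : MvPolynomial (Fin N × Fin N) ℚ) else 1) := by
    rw [Finset.prod_univ_sum, Fintype.piFinset_univ,
      ← ((Equiv.curry (Fin k) (Fin b) (Fin N)).symm.trans
        ((blockEquiv b k).arrowCongr (Equiv.refl _))).sum_comp]
    refine Finset.sum_congr rfl fun c _ => ?_
    rw [fiberSet, Finset.prod_filter, ← (blockEquiv b k).prod_comp, Fintype.prod_prod_type]
    simp [blockIndex_blockEquiv, blockPerm_blockEquiv, Equiv.arrowCongr]
  rw [h2, h1, Finset.prod_const, scaledTrace, smul_pow, MvPolynomial.smul_eq_C_mul,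
    MvPolynomial.smul_eq_C_mul, MvPolynomial.smul_eq_C_mul]
  ring

/-- The weight of a pairing of the half-edges over `T`. -/
noncomputable def pairingWeight (N ν k : ℕ) (T : Finset ℕ)
    (α : Equiv.Perm (Fin (2 * ν * k))) : ℚ :=
  ((N : ℚ) ^ (1 + ν)) ^ T.card *
    (coloringCount (blockPerm (2 * ν) k) N (fiberSet (blockIndex (2 * ν) k) T) α /
      (N : ℚ) ^ (2 * ν * k))

lemma gaussian_prod_scaledTrace {N ν k : ℕ} (hN : N ≠ 0) (hν : ν ≠ 0) {T : Finset ℕ}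
    (hT : T ⊆ Finset.range k) :
    gaussian (N : ℚ)⁻¹ (∏ _i ∈ T, scaledTrace N (2 * ν)) =
      ∑ α ∈ pairings (fiberSet (blockIndex (2 * ν) k) T), pairingWeight N ν k T α := by
  have hN' : (N : ℚ) ≠ 0 := Nat.cast_ne_zero.2 hN
  have h := congrArg (gaussian (N : ℚ)⁻¹) (prod_scaledTrace N (2 * ν) k (by omega) hT)
  have hk : T.card ≤ k := by simpa using Finset.card_le_card hT
  rw [map_smul, map_smul, map_sum, sum_gaussian_prod, card_fiberSet_blockIndex _ hT,
    mul_assoc, Nat.mul_div_cancel_left _ two_pos, smul_eq_mul, smul_eq_mul] at h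
  simp only [pairingWeight]
  rw [← Finset.mul_sum, ← Finset.sum_div]
  set c := ∑ α ∈ pairings (fiberSet (blockIndex (2 * ν) k) T),
    (coloringCount (blockPerm (2 * ν) k) N (fiberSet (blockIndex (2 * ν) k) T) α : ℚ)
  apply mul_left_cancel₀ (pow_ne_zero (k - T.card) (pow_ne_zero (2 * ν) hN'))
  rw [h]
  have e : (N : ℚ) ^ (2 * ν * k) = ((N : ℚ) ^ (2 * ν)) ^ (k - T.card) * ((N : ℚ) ^ (2 * ν)) ^ T.card := by
    rw [← pow_add, Nat.sub_add_cancel hk, ← pow_mul]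
  have e2 : (N : ℚ) ^ (2 * ν) = N ^ ν * N ^ ν := by rw [two_mul, pow_add]
  rw [e, e2, pow_add, mul_pow, inv_pow, pow_mul, mul_pow, mul_pow]
  have hM : (N : ℚ) ^ ν ≠ 0 := pow_ne_zero _ hN'
  generalize (N : ℚ) ^ ν = M at hM
  field_simp

end Fibers

section Decomposition

variable {X : Type*}

/-- The vertices reachable from `v` along the edges `{x, α x}`, where `ver x` is the vertex carrying
the half-edge `x`. -/
def component (ver : X → ℕ) (α : Equiv.Perm X) (v : ℕ) : Set ℕ :=
  {j | Relation.ReflTransGen (fun i j => ∃ x, ver x = i ∧ ver (α x) = j) v j}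

variable {ver : X → ℕ} {α β : Equiv.Perm X} {v : ℕ}

lemma self_mem_component : v ∈ component ver α v := Relation.ReflTransGen.refl

lemma apply_mem_component {x : X} (h : ver x ∈ component ver α v) :
    ver (α x) ∈ component ver α v :=
  Relation.ReflTransGen.tail h ⟨x, rfl, rfl⟩

lemma component_subset {C : Set ℕ} (hv : v ∈ C) (hC : ∀ x, ver x ∈ C → ver (α x) ∈ C) :
    component ver α v ⊆ C := by
  intro j hj
  induction hj with
  | refl => exact hv
  | tail _ h ih =>
    obtain ⟨x, rfl, rfl⟩ := h
    exact hC x ih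

lemma component_congr {C : Set ℕ} (hv : v ∈ C) (hC : ∀ x, ver x ∈ C → ver (α x) ∈ C)
    (h : ∀ x, ver x ∈ C → α x = β x) : component ver α v = component ver β v := by
  have hC' : ∀ x, ver x ∈ C → ver (β x) ∈ C := fun x hx => h x hx ▸ hC x hx
  refine Set.Subset.antisymm (fun j hj => ?_) (fun j hj => ?_)
  · refine (component_subset (C := component ver β v ∩ C) ⟨self_mem_component, hv⟩ ?_ hj).1
    exact fun x hx => ⟨by rw [h x hx.2]; exact apply_mem_component hx.1, hC x hx.2⟩
  · refine (component_subset (C := component ver α v ∩ C) ⟨self_mem_component, hv⟩ ?_ hj).1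
    exact fun x hx => ⟨by rw [← h x hx.2]; exact apply_mem_component hx.1, hC' x hx.2⟩

variable [Fintype X] [DecidableEq X]

lemma component_subset_of_mem_pairings {T : Finset ℕ} (hv : v ∈ T)
    (hα : α ∈ pairings (fiberSet ver T)) : component ver α v ⊆ T :=
  component_subset (Finset.mem_coe.2 hv) fun x hx => by
    rw [Finset.mem_coe, ← mem_fiberSet] at hx ⊢
    exact (apply_mem_of_mem_pairings hα).2 hx

lemma mul_apply_of_mem_left {S T : Finset ℕ} (h : Disjoint S T)
    (hβ : β ∈ pairings (fiberSet ver T)) {x : X} (hx : ver x ∈ S) : (α * β) x = α x := by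
  rw [Equiv.Perm.mul_apply, apply_eq_of_mem_pairings hβ]
  rw [mem_fiberSet]
  exact Finset.disjoint_left.1 h hx

lemma mul_apply_of_notMem_left {S : Finset ℕ} {T : Finset ℕ} (h : Disjoint S T)
    (hα : α ∈ pairings (fiberSet ver S)) (hβ : β ∈ pairings (fiberSet ver T)) {x : X}
    (hx : ver x ∉ S) : (α * β) x = β x := by
  rw [Equiv.Perm.mul_apply, apply_eq_of_mem_pairings hα]
  rw [mem_fiberSet]
  by_cases hx' : ver x ∈ T
  · have := (apply_mem_of_mem_pairings hβ).2 (mem_fiberSet.2 hx')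
    exact Finset.disjoint_right.1 h (mem_fiberSet.1 this)
  · rwa [apply_eq_of_mem_pairings hβ (by rwa [mem_fiberSet])]

lemma mul_mem_pairings {S T : Finset ℕ} (h : Disjoint S T)
    (hα : α ∈ pairings (fiberSet ver S)) (hβ : β ∈ pairings (fiberSet ver T)) :
    α * β ∈ pairings (fiberSet ver (S ∪ T)) := by
  have hα' := mem_pairings_iff.1 hα
  have hβ' := mem_pairings_iff.1 hβ
  have h1 : ∀ x, ver x ∈ S → (α * β) x = α x := fun x hx => mul_apply_of_mem_left h hβ hx
  have h2 : ∀ x, ver x ∉ S → (α * β) x = β x := fun x hx => mul_apply_of_notMem_left h hα hβ hx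
  rw [mem_pairings_iff]
  constructor
  · intro x
    by_cases hx : ver x ∈ S
    · have := (apply_mem_of_mem_pairings hα).2 (mem_fiberSet.2 hx)
      rw [h1 x hx, h1 _ (mem_fiberSet.1 this), hα'.1]
    · rw [h2 x hx]
      by_cases hx' : ver x ∈ T
      · have := (apply_mem_of_mem_pairings hβ).2 (mem_fiberSet.2 hx')
        rw [h2 _ (Finset.disjoint_right.1 h (mem_fiberSet.1 this)), hβ'.1]
      · have := apply_eq_of_mem_pairings hβ (by rwa [mem_fiberSet])
        rw [this, h2 x hx, this]
  · intro x
    rw [mem_fiberSet, Finset.mem_union]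
    by_cases hx : ver x ∈ S
    · rw [h1 x hx, hα'.2, mem_fiberSet]; simp [hx]
    · rw [h2 x hx, hβ'.2, mem_fiberSet]; simp [hx]

/-- The restriction of an involution to a union of orbits is a pairing. -/
lemma exists_mem_pairings_eq {T U : Finset ℕ} (hα : α ∈ pairings (fiberSet ver T)) (hU : U ⊆ T)
    (hc : ∀ x, ver x ∈ U ↔ ver (α x) ∈ U) :
    ∃ β ∈ pairings (fiberSet ver U), ∀ x, ver x ∈ U → β x = α x := by
  have hα' := mem_pairings_iff.1 hα
  have hinv : Function.Involutive fun x => if ver x ∈ U then α x else x := by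
    intro x
    by_cases hx : ver x ∈ U
    · have := (hc x).1 hx
      simp [hx, this, hα'.1]
    · simp [hx]
  refine ⟨hinv.toPerm, ?_, fun x hx => by simp [hx]⟩
  rw [mem_pairings_iff]
  refine ⟨hinv, fun x => ?_⟩
  by_cases hx : ver x ∈ U
  · have := (hα'.2 x).2 (mem_fiberSet.2 (hU hx))
    simp [hx, this]
  · simp [hx]

lemma exists_mul_eq_of_component_eq {T U : Finset ℕ} (hα : α ∈ pairings (fiberSet ver T))
    (hU : U ⊆ T) (hα_comp : component ver α v = U) :
    ∃ α₁ ∈ pairings (fiberSet ver U), ∃ α₂ ∈ pairings (fiberSet ver (T \ U)), α₁ * α₂ = α := by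
  have hinv := (mem_pairings_iff.1 hα).1
  have hc : ∀ x, ver x ∈ U ↔ ver (α x) ∈ U := by
    have : ∀ x, ver x ∈ U → ver (α x) ∈ U := fun x hx => by
      rw [← Finset.mem_coe, ← hα_comp] at hx ⊢
      exact apply_mem_component hx
    exact fun x => ⟨this x, fun h => by simpa only [hinv] using this _ h⟩
  have hc' : ∀ x, ver x ∈ T \ U ↔ ver (α x) ∈ T \ U := fun x => by
    have := apply_mem_of_mem_pairings hα (x := x)
    rw [mem_fiberSet, mem_fiberSet] at this
    rw [Finset.mem_sdiff, Finset.mem_sdiff, ← hc, this]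
  obtain ⟨α₁, h₁, e₁⟩ := exists_mem_pairings_eq hα hU hc
  obtain ⟨α₂, h₂, e₂⟩ := exists_mem_pairings_eq hα Finset.sdiff_subset hc'
  refine ⟨α₁, h₁, α₂, h₂, Equiv.ext fun x => ?_⟩
  by_cases hx : ver x ∈ U
  · rw [mul_apply_of_mem_left Finset.disjoint_sdiff h₂ hx, e₁ x hx]
  · rw [mul_apply_of_notMem_left Finset.disjoint_sdiff h₁ h₂ hx]
    by_cases hx' : ver x ∈ T
    · exact e₂ x (Finset.mem_sdiff.2 ⟨hx', hx⟩)
    · rw [apply_eq_of_mem_pairings h₂, apply_eq_of_mem_pairings hα]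
      · rwa [mem_fiberSet]
      · simp [hx']

lemma component_mul {S T : Finset ℕ} (h : Disjoint S T) (hα : α ∈ pairings (fiberSet ver S))
    (hβ : β ∈ pairings (fiberSet ver T)) (hv : v ∈ S) :
    component ver (α * β) v = component ver α v := by
  symm
  refine component_congr (C := S) hv (fun x hx => ?_) fun x hx =>
    (mul_apply_of_mem_left h hβ hx).symm
  exact mem_fiberSet.1 ((apply_mem_of_mem_pairings hα).2 (mem_fiberSet.2 hx))

open scoped Classical in
/-- The pairings of the half-edges over `T` for which the component of `v` is all of `T`. -/
noncomputable def connectedPairings (ver : X → ℕ) (v : ℕ) (T : Finset ℕ) :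
    Finset (Equiv.Perm X) :=
  (pairings (fiberSet ver T)).filter fun α => component ver α v = T

lemma mem_connectedPairings {T : Finset ℕ} :
    α ∈ connectedPairings ver v T ↔
      α ∈ pairings (fiberSet ver T) ∧ component ver α v = T := by
  simp [connectedPairings]

open scoped Classical in
lemma sum_filter_component_eq {M : Type*} [AddCommMonoid M] {T U : Finset ℕ} (hU : U ⊆ T)
    (hv : v ∈ U) (F : Equiv.Perm X → M) :
    ∑ α ∈ (pairings (fiberSet ver T)).filter (fun α => component ver α v = U), F α =
      ∑ α ∈ connectedPairings ver v U, ∑ β ∈ pairings (fiberSet ver (T \ U)), F (α * β) := by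
  rw [← Finset.sum_product']
  symm
  have hd : Disjoint U (T \ U) := Finset.disjoint_sdiff
  refine Finset.sum_nbij (fun x => x.1 * x.2) ?_ ?_ ?_ fun _ _ => rfl
  · rintro ⟨α, β⟩ h
    rw [Finset.mem_product, mem_connectedPairings] at h
    rw [Finset.mem_filter]
    have := mul_mem_pairings hd h.1.1 h.2
    rw [Finset.union_sdiff_of_subset hU] at this
    exact ⟨this, (component_mul hd h.1.1 h.2 hv).trans h.1.2⟩
  · rintro ⟨α, β⟩ h ⟨α', β'⟩ h' e
    rw [Finset.mem_coe, Finset.mem_product, mem_connectedPairings] at h h'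
    have e' : α * β = α' * β' := e
    suffices h3 : α = α' by
      subst h3
      rw [mul_left_cancel e']
    ext1 x
    by_cases hx : ver x ∈ U
    · rw [← mul_apply_of_mem_left hd h.2 hx, e', mul_apply_of_mem_left hd h'.2 hx]
    · rw [apply_eq_of_mem_pairings h.1.1 (by rwa [mem_fiberSet]),
        apply_eq_of_mem_pairings h'.1.1 (by rwa [mem_fiberSet])]
  · intro α h
    rw [Finset.mem_coe, Finset.mem_filter] at h
    obtain ⟨α₁, h₁, α₂, h₂, rfl⟩ := exists_mul_eq_of_component_eq h.1 hU h.2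
    refine ⟨(α₁, α₂), ?_, rfl⟩
    rw [Finset.mem_coe, Finset.mem_product, mem_connectedPairings]
    exact ⟨⟨h₁, (component_mul hd h₁ h₂ hv).symm.trans h.2⟩, h₂⟩

/-- Sums over pairings, organised by the component of `v`. -/
lemma sum_pairings_eq_sum_connectedPairings {M : Type*} [AddCommMonoid M] {T : Finset ℕ}
    (hv : v ∉ T) (F : Equiv.Perm X → M) :
    ∑ α ∈ pairings (fiberSet ver (insert v T)), F α =
      ∑ B ∈ T.powerset, ∑ α ∈ connectedPairings ver v (insert v B),
        ∑ β ∈ pairings (fiberSet ver (T \ B)), F (α * β) := by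
  classical
  rw [← Finset.sum_fiberwise_of_maps_to (t := T.powerset)
    (g := fun α => T.filter fun j => j ∈ component ver α v)
    fun α _ => Finset.mem_powerset.2 (Finset.filter_subset _ _)]
  refine Finset.sum_congr rfl fun B hB => ?_
  have hB := Finset.mem_powerset.1 hB
  have h1 := sum_filter_component_eq (ver := ver) (Finset.insert_subset_insert v hB)
    (Finset.mem_insert_self v B) F
  rw [Finset.insert_sdiff_insert, Finset.sdiff_insert_of_notMem hv] at h1
  rw [← h1]
  refine Finset.sum_congr (Finset.filter_congr fun α hα => ?_) fun _ _ => rfl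
  have h2 := component_subset_of_mem_pairings (Finset.mem_insert_self v T) hα
  constructor
  · rintro rfl
    ext j
    simp only [Finset.coe_insert, Finset.coe_filter, Set.mem_insert_iff, Set.mem_ofPred_eq]
    constructor
    · intro hj
      have := Finset.mem_insert.1 (Finset.mem_coe.1 (h2 hj))
      tauto
    · rintro (rfl | hj)
      · exact self_mem_component
      · exact hj.2
  · intro h
    ext j
    rw [h]
    simp only [Finset.mem_filter, Finset.coe_insert, Set.mem_insert_iff, Finset.mem_coe]
    constructor
    · rintro ⟨hj, rfl | hj'⟩
      · exact absurd hj hv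
      · exact hj'
    · exact fun hj => ⟨hB hj, Or.inr hj⟩

lemma coloringCount_mul {σ : Equiv.Perm X} (hσ : ∀ x, ver (σ x) = ver x) (N : ℕ)
    {S T : Finset ℕ} (h : Disjoint S T) (hα : α ∈ pairings (fiberSet ver S))
    (hβ : β ∈ pairings (fiberSet ver T)) :
    coloringCount σ N (fiberSet ver (S ∪ T)) (α * β) * N ^ Fintype.card X =
      coloringCount σ N (fiberSet ver S) α * coloringCount σ N (fiberSet ver T) β := by
  have hN : N ^ Fintype.card X = (Finset.univ : Finset (X → Fin N)).card := by simp
  have hα' : ∀ x, ver x ∈ S → ver (α x) ∈ S := fun x hx =>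
    mem_fiberSet.1 ((apply_mem_of_mem_pairings hα).2 (mem_fiberSet.2 hx))
  have hβ' : ∀ x, ver x ∈ T → ver (β x) ∈ T := fun x hx =>
    mem_fiberSet.1 ((apply_mem_of_mem_pairings hβ).2 (mem_fiberSet.2 hx))
  have hST : ∀ x, ver x ∈ T → ver x ∉ S := fun x hx => Finset.disjoint_right.1 h hx
  have h1 : ∀ x, ver x ∈ S → (α * β) x = α x := fun x hx => mul_apply_of_mem_left h hβ hx
  have h2 : ∀ x, ver x ∈ T → (α * β) x = β x := fun x hx =>
    mul_apply_of_notMem_left h hα hβ (hST x hx)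
  rw [hN, coloringCount, coloringCount, coloringCount, ← Finset.card_product, ← Finset.card_product]
  refine Finset.card_bij'
    (fun p _ => (fun x => if ver x ∈ S then p.1 x else p.2 x,
      fun x => if ver x ∈ S then p.2 x else p.1 x))
    (fun p _ => (fun x => if ver x ∈ S then p.1 x else p.2 x,
      fun x => if ver x ∈ S then p.2 x else p.1 x)) ?_ ?_ ?_ ?_
  · rintro ⟨c, d⟩ hc
    simp only [Finset.mem_product, Finset.mem_filter, Finset.mem_univ, true_and, and_true,
      mem_fiberSet, Finset.mem_union, hσ] at hc ⊢
    constructor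
    · intro x hx
      simpa [hx, hα' x hx, h1 x hx] using hc x (Or.inl hx)
    · intro x hx
      simpa [hST x hx, hST _ (hβ' x hx), h2 x hx] using hc x (Or.inr hx)
  · rintro ⟨c, d⟩ hc
    simp only [Finset.mem_product, Finset.mem_filter, Finset.mem_univ, true_and, and_true,
      mem_fiberSet, Finset.mem_union, hσ] at hc ⊢
    rintro x (hx | hx)
    · simpa [hx, hα' x hx, h1 x hx] using hc.1 x hx
    · simpa [hST x hx, hST _ (hβ' x hx), h2 x hx] using hc.2 x hx
  all_goals
    rintro ⟨c, d⟩ -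
    refine Prod.ext (funext fun x => ?_) (funext fun x => ?_) <;>
    · dsimp only
      split_ifs <;> rfl

end Decomposition

section CycleCount

lemma apply_eq_of_sameCycle {X Y : Type*} [Finite X] {π : Equiv.Perm X} {c : X → Y}
    (hc : ∀ x, c (π x) = c x) {x y : X} (h : π.SameCycle x y) : c x = c y := by
  obtain ⟨i, -, rfl⟩ := h.exists_pow_eq'
  induction i with
  | zero => rfl
  | succ i ih => rw [pow_succ', Equiv.Perm.mul_apply, hc, ← ih ⟨i, by simp⟩]

variable {X : Type*} [Fintype X] [DecidableEq X]

lemma card_invariant_colorings (π : Equiv.Perm X) (N : ℕ) :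
    (Finset.univ.filter fun c : X → Fin N => ∀ x, c (π x) = c x).card =
      N ^ Nat.card (Quotient (Equiv.Perm.SameCycle.setoid π)) := by
  classical
  have e : {c : X → Fin N // ∀ x, c (π x) = c x} ≃
      (Quotient (Equiv.Perm.SameCycle.setoid π) → Fin N) :=
    { toFun := fun c => Quotient.lift c.1 fun a b h => apply_eq_of_sameCycle c.2 h
      invFun := fun d => ⟨fun x => d (Quotient.mk _ x), fun x => by
        refine congrArg d ?_
        refine Quotient.sound (s := Equiv.Perm.SameCycle.setoid π) ?_
        exact Equiv.Perm.sameCycle_apply_left.2 (Equiv.Perm.SameCycle.refl _ _)⟩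
      left_inv := fun c => rfl
      right_inv := fun d => funext fun q => by
        induction q using Quotient.inductionOn
        rfl }
  rw [← Fintype.card_subtype, Fintype.card_congr e, Fintype.card_fun, Fintype.card_fin,
    Nat.card_eq_fintype_card]

lemma card_quotient_sameCycle (π : Equiv.Perm X) :
    Nat.card (Quotient (Equiv.Perm.SameCycle.setoid π)) =
      π.cycleType.card + (Fintype.card X - π.support.card) := by
  classical
  let f : X → Equiv.Perm X ⊕ X := fun x => if x ∈ π.support then Sum.inl (π.cycleOf x) else Sum.inr x
  have hf : Equiv.Perm.SameCycle.setoid π = Setoid.ker f := by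
    ext x y
    change π.SameCycle x y ↔ f x = f y
    by_cases hx : x ∈ π.support <;> by_cases hy : y ∈ π.support
    · simp only [f, if_pos hx, if_pos hy, Sum.inl.injEq]
      exact Equiv.Perm.sameCycle_iff_cycleOf_eq_of_mem_support hx hy
    · simp only [f, if_pos hx, if_neg hy, reduceCtorEq, iff_false]
      intro h
      rw [Equiv.Perm.mem_support] at hx hy
      exact hx (h.apply_eq_self_iff.2 (not_not.1 hy))
    · simp only [f, if_neg hx, if_pos hy, reduceCtorEq, iff_false]
      intro h
      rw [Equiv.Perm.mem_support] at hx hy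
      exact hy (h.apply_eq_self_iff.1 (not_not.1 hx))
    · simp only [f, if_neg hx, if_neg hy, Sum.inr.injEq]
      rw [Equiv.Perm.notMem_support] at hx
      exact ⟨fun h => h.eq_of_left hx, fun h => h ▸ Equiv.Perm.SameCycle.refl _ _⟩
  have hr : Set.range f = (π.cycleFactorsFinset.disjSum π.supportᶜ : Finset _) := by
    ext z
    rw [Finset.mem_coe, Set.mem_range]
    constructor
    · rintro ⟨x, rfl⟩
      by_cases hx : x ∈ π.support
      · simp only [f, if_pos hx, Finset.inl_mem_disjSum]
        exact Equiv.Perm.cycleOf_mem_cycleFactorsFinset_iff.2 hx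
      · simp only [f, if_neg hx, Finset.inr_mem_disjSum]
        exact Finset.mem_compl.2 hx
    · rcases z with c | x
      · rw [Finset.inl_mem_disjSum]
        intro hc
        obtain ⟨x, hx⟩ : c.support.Nonempty := by
          rw [Finset.nonempty_iff_ne_empty, Ne, Equiv.Perm.support_eq_empty_iff]
          exact (Equiv.Perm.mem_cycleFactorsFinset_iff.1 hc).1.ne_one
        refine ⟨x, ?_⟩
        rw [Equiv.Perm.cycle_is_cycleOf hx hc]
        exact if_pos (Equiv.Perm.mem_cycleFactorsFinset_support_le hc hx)
      · rw [Finset.inr_mem_disjSum, Finset.mem_compl]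
        exact fun hx => ⟨x, if_neg hx⟩
  rw [hf, Nat.card_congr (Setoid.quotientKerEquivRange f), hr]
  simp [Equiv.Perm.cycleType_def, Finset.card_compl]

lemma coloringCount_univ {n : ℕ} (σ : Equiv.Perm (Fin n)) (N : ℕ) {α : Equiv.Perm (Fin n)}
    (hα : α * α = 1) : coloringCount σ N Finset.univ α = N ^ cycleCount (σ * α) := by
  have := card_quotient_sameCycle (σ * α)
  rw [Fintype.card_fin] at this
  rw [cycleCount, ← this, ← card_invariant_colorings, coloringCount]
  congr 1
  ext c
  simp only [Finset.mem_filter, Finset.mem_univ, true_and, forall_const]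
  constructor
  · intro h x
    rw [Equiv.Perm.mul_apply, ← h, apply_apply_of_mul_self hα]
  · intro h x
    rw [← h (α x), Equiv.Perm.mul_apply, apply_apply_of_mul_self hα]

end CycleCount

section Transitivity

variable {b k : ℕ}

lemma sameCycle_blockPerm (hb : 2 ≤ b) {x y : Fin (b * k)}
    (h : blockIndex b k x = blockIndex b k y) : (blockPerm b k).SameCycle x y := by
  obtain ⟨⟨i, a⟩, rfl⟩ := (blockEquiv b k).surjective x
  obtain ⟨⟨j, c⟩, rfl⟩ := (blockEquiv b k).surjective y
  rw [blockIndex_blockEquiv, blockIndex_blockEquiv] at h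
  obtain rfl : i = j := Fin.ext h
  have hpow : ∀ m : ℕ, (blockPerm b k ^ m) (blockEquiv b k (i, a)) =
      blockEquiv b k (i, (finRotate b ^ m) a) := by
    intro m
    induction m with
    | zero => rfl
    | succ m ih =>
      rw [pow_succ', Equiv.Perm.mul_apply, ih, blockPerm_blockEquiv, pow_succ',
        Equiv.Perm.mul_apply]
  have hmem : ∀ a : Fin b, finRotate b a ≠ a := fun a => by
    have := support_finRotate_of_le hb
    rw [← Equiv.Perm.mem_support, this]
    exact Finset.mem_univ _
  obtain ⟨m, -, hm⟩ := ((isCycle_finRotate_of_le hb).sameCycle (hmem a) (hmem c)).exists_pow_eq'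
  exact ⟨m, by rw [zpow_natCast, hpow, hm]⟩

/-- The permutations `σ₀` and `α` generate a transitive group iff the graph is connected. -/
lemma transitive_iff_component_eq (hb : 2 ≤ b) (hk : 1 ≤ k) {α : Equiv.Perm (Fin (b * k))}
    (hα : α * α = 1) :
    (∀ i j : Fin (b * k), ∃ p ∈ Subgroup.closure
        ({blockPerm b k, α} : Set (Equiv.Perm (Fin (b * k)))), p i = j) ↔
      component (blockIndex b k) α 0 = (Finset.range k : Finset ℕ) := by
  set H := Subgroup.closure ({blockPerm b k, α} : Set (Equiv.Perm (Fin (b * k))))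
  have hσH : blockPerm b k ∈ H := Subgroup.subset_closure (by simp)
  have hαH : α ∈ H := Subgroup.subset_closure (by simp)
  have h0b : 0 < b := by omega
  constructor
  · intro h
    refine Set.Subset.antisymm (component_subset (by simpa using Nat.pos_of_ne_zero (by omega)) fun x _ => ?_) fun j hj => ?_
    · simpa using blockIndex_lt b k (α x)
    · rw [Finset.mem_coe, Finset.mem_range] at hj
      have key : ∀ p ∈ H, ∀ x, blockIndex b k (p x) ∈ component (blockIndex b k) α 0 ↔
          blockIndex b k x ∈ component (blockIndex b k) α 0 := by
        intro p hp
        induction hp using Subgroup.closure_induction with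
        | mem p hp =>
          intro x
          obtain rfl | rfl := hp
          · rw [blockIndex_blockPerm]
          · refine ⟨fun h => ?_, apply_mem_component⟩
            simpa only [apply_apply_of_mul_self hα] using apply_mem_component h
        | one => exact fun x => Iff.rfl
        | mul p q _ _ hp hq => exact fun x => (hp (q x)).trans (hq x)
        | inv p _ hp => exact fun x => by rw [← hp (p⁻¹ x), ← Equiv.Perm.mul_apply, mul_inv_cancel, Equiv.Perm.one_apply]
      obtain ⟨p, hp, e⟩ := h (blockEquiv b k (⟨0, hk⟩, ⟨0, h0b⟩))
        (blockEquiv b k (⟨j, hj⟩, ⟨0, h0b⟩))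
      have := (key p hp (blockEquiv b k (⟨0, hk⟩, ⟨0, h0b⟩))).2 (by
        rw [blockIndex_blockEquiv]; exact self_mem_component)
      rwa [e, blockIndex_blockEquiv] at this
  · intro h
    have hfib : ∀ x y, blockIndex b k x = blockIndex b k y → ∃ p ∈ H, p x = y := fun x y hxy => by
      obtain ⟨m, hm⟩ := sameCycle_blockPerm hb hxy
      exact ⟨_, H.zpow_mem hσH m, hm⟩
    have key : ∀ j ∈ component (blockIndex b k) α 0, ∀ y, blockIndex b k y = j →
        ∃ p ∈ H, p (blockEquiv b k (⟨0, hk⟩, ⟨0, h0b⟩)) = y := by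
      intro j hj
      induction hj with
      | refl => exact fun y hy => hfib _ _ (by rw [blockIndex_blockEquiv, hy])
      | tail _ h ih =>
        obtain ⟨x, hx, hx'⟩ := h
        intro y hy
        obtain ⟨p, hp, rfl⟩ := ih x hx
        obtain ⟨q, hq, rfl⟩ := hfib _ y (hx'.trans hy.symm)
        exact ⟨q * (α * p), H.mul_mem hq (H.mul_mem hαH hp), rfl⟩
    have key' : ∀ y, ∃ p ∈ H, p (blockEquiv b k (⟨0, hk⟩, ⟨0, h0b⟩)) = y := fun y =>
      key _ (by rw [h]; simpa using blockIndex_lt b k y) y rfl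
    intro i j
    obtain ⟨p, hp, rfl⟩ := key' i
    obtain ⟨q, hq, rfl⟩ := key' j
    exact ⟨q * p⁻¹, H.mul_mem hq (H.inv_mem hp), by simp⟩

end Transitivity

section Assembly

lemma pairingWeight_mul {N ν k : ℕ} (hN : N ≠ 0) {S T : Finset ℕ} (h : Disjoint S T)
    {α β : Equiv.Perm (Fin (2 * ν * k))}
    (hα : α ∈ pairings (fiberSet (blockIndex (2 * ν) k) S))
    (hβ : β ∈ pairings (fiberSet (blockIndex (2 * ν) k) T)) :
    pairingWeight N ν k (S ∪ T) (α * β) = pairingWeight N ν k S α * pairingWeight N ν k T β := by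
  have hN' : (N : ℚ) ≠ 0 := Nat.cast_ne_zero.2 hN
  have h1 := coloringCount_mul (blockIndex_blockPerm (2 * ν) k) N h hα hβ
  rw [Fintype.card_fin] at h1
  have h2 := congrArg (Nat.cast : ℕ → ℚ) h1
  push_cast at h2
  simp only [pairingWeight]
  rw [Finset.card_union_of_disjoint h, pow_add, mul_mul_mul_comm, div_mul_div_comm, ← h2,
    mul_div_mul_right _ _ (pow_ne_zero _ hN')]

lemma sum_connectedPairings_eq_cumulant {N ν k : ℕ} (hN : N ≠ 0) (hν : ν ≠ 0) (hk : 1 ≤ k) :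
    ∑ α ∈ connectedPairings (blockIndex (2 * ν) k) 0 (Finset.range k),
      pairingWeight N ν k (Finset.range k) α =
      cumulant (gaussian (N : ℚ)⁻¹) (scaledTrace N) (fun _ => 2 * ν) (scaledTrace N (2 * ν))
        ((Finset.range k).erase 0) := by
  have h0 : 0 ∈ Finset.range k := Finset.mem_range.2 hk
  rw [← eq_cumulant (scaledTrace N) (fun _ => 2 * ν) (gaussian_one _) (scaledTrace N (2 * ν))
    (fun B => ∑ α ∈ connectedPairings (blockIndex (2 * ν) k) 0 (insert 0 B),
      pairingWeight N ν k (insert 0 B) α) ((Finset.range k).erase 0), Finset.insert_erase h0]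
  intro T hT
  have h0T : 0 ∉ T := fun h => (Finset.mem_erase.1 (hT h)).1 rfl
  have hTk : T ⊆ Finset.range k := hT.trans (Finset.erase_subset _ _)
  have hk' : insert 0 T ⊆ Finset.range k := Finset.insert_subset h0 hTk
  rw [moment, ← Finset.prod_insert (f := fun _ => scaledTrace N (2 * ν)) h0T,
    gaussian_prod_scaledTrace hN hν hk', sum_pairings_eq_sum_connectedPairings h0T]
  refine Finset.sum_congr rfl fun B hB => ?_
  have hB := Finset.mem_powerset.1 hB
  rw [moment, one_mul, gaussian_prod_scaledTrace hN hν (Finset.sdiff_subset.trans hTk),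
    Finset.sum_mul_sum]
  have hd : Disjoint (insert 0 B) (T \ B) := by
    rw [Finset.disjoint_insert_left]
    exact ⟨fun h => h0T (Finset.mem_sdiff.1 h).1, Finset.disjoint_sdiff⟩
  have hu : insert 0 B ∪ T \ B = insert 0 T := by
    rw [Finset.insert_union, Finset.union_sdiff_of_subset hB]
  refine Finset.sum_congr rfl fun α hα => Finset.sum_congr rfl fun β hβ => ?_
  rw [← pairingWeight_mul hN hd (mem_connectedPairings.1 hα).1 hβ, hu]

lemma fiberSet_blockIndex_range (b k : ℕ) :
    fiberSet (blockIndex b k) (Finset.range k) = Finset.univ := by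
  ext x
  simp [blockIndex_lt]

lemma sum_pow_cycleCount_eq {N ν k : ℕ} (hN : N ≠ 0) (hν : ν ≠ 0) (hk : 1 ≤ k) :
    ∑ α ∈ connectedPairings (blockIndex (2 * ν) k) 0 (Finset.range k),
      (N : ℚ) ^ (cycleCount (blockPerm (2 * ν) k * α) + k) =
      (N : ℚ) ^ (2 + ν * k) *
        (genusPoly (2 * ν) ((Finset.range k).erase 0) fun _ => 2 * ν).eval (1 / (N : ℚ) ^ 2) := by
  have hN' : (N : ℚ) ≠ 0 := Nat.cast_ne_zero.2 hN
  have h := sum_connectedPairings_eq_cumulant hN hν hk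
  rw [← correlator_eq_eval _ _ _ _ hN, correlator, ← h, add_comm 2, pow_add _ _ 2,
    mul_assoc ((N : ℚ) ^ (ν * k)), mul_div_cancel₀ _ (pow_ne_zero 2 hN'), Finset.mul_sum]
  refine Finset.sum_congr rfl fun α hα => ?_
  have hα' := (mem_pairings.1 (mem_connectedPairings.1 hα).1).1
  have e : (N : ℚ) ^ (2 * ν * k) = N ^ (ν * k) * N ^ (ν * k) := by
    rw [← pow_add]; congr 1; ring
  rw [pairingWeight, fiberSet_blockIndex_range, coloringCount_univ _ _ hα', Finset.card_range,
    ← pow_mul, add_mul, one_mul, pow_add, pow_add, e]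
  push_cast
  field_simp

/-- Extraction of a coefficient from values at all positive integers. -/
lemma card_filter_eq_coeff {ι : Type*} (s : Finset ι) (e : ι → ℕ) (m : ℕ) (P : Polynomial ℚ)
    (h : ∀ N : ℕ, N ≠ 0 → ∑ i ∈ s, (N : ℚ) ^ e i = (N : ℚ) ^ m * P.eval (1 / (N : ℚ) ^ 2))
    (g : ℕ) : ((s.filter fun i => e i + 2 * g = m).card : ℚ) = P.coeff g := by
  obtain ⟨G, hPG, hgG⟩ : ∃ G, P.natDegree ≤ G ∧ g ≤ G :=
    ⟨max P.natDegree g, le_max_left _ _, le_max_right _ _⟩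
  have key : ∑ i ∈ s, (Polynomial.X : Polynomial ℚ) ^ (e i + 2 * G) =
      ∑ j ∈ Finset.range (G + 1), Polynomial.C (P.coeff j) * Polynomial.X ^ (m + 2 * (G - j)) := by
    refine Polynomial.eq_of_infinite_eval_eq _ _ (Set.Infinite.mono ?_
      (Set.infinite_range_of_injective (f := fun N : ℕ => ((N + 1 : ℕ) : ℚ))
        fun a b hab => by simpa using hab))
    rintro _ ⟨N, rfl⟩
    have hN : ((N + 1 : ℕ) : ℚ) ≠ 0 := Nat.cast_ne_zero.2 N.succ_ne_zero
    have := h (N + 1) N.succ_ne_zero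
    simp only [Set.mem_ofPred_eq, Polynomial.eval_finsetSum, Polynomial.eval_mul,
      Polynomial.eval_pow, Polynomial.eval_X, Polynomial.eval_C]
    generalize ((N + 1 : ℕ) : ℚ) = x at hN this ⊢
    simp only [pow_add _ _ (2 * G)]
    rw [← Finset.sum_mul, this, Polynomial.eval_eq_sum_range' (Nat.lt_succ_of_le hPG),
      Finset.mul_sum, Finset.sum_mul]
    refine Finset.sum_congr rfl fun j hj => ?_
    obtain ⟨d, rfl⟩ := Nat.exists_eq_add_of_le (Finset.mem_range_succ_iff.1 hj)
    rw [Nat.add_sub_cancel_left, mul_add, pow_add, pow_add, pow_mul x 2 j, one_div, inv_pow]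
    field_simp
  have hc := congrArg (fun q => Polynomial.coeff q (m + 2 * (G - g))) key
  simp only [Polynomial.finsetSum_coeff, Polynomial.coeff_X_pow, Polynomial.coeff_C_mul] at hc
  rw [Finset.sum_eq_single_of_mem g (Finset.mem_range_succ_iff.2 hgG)] at hc
  · rw [if_pos rfl, mul_one, Finset.sum_boole] at hc
    rw [← hc]
    congr 2
    ext i
    simp only [Finset.mem_filter]
    exact and_congr_right fun _ => by omega
  · intro j hj hjg
    rw [if_neg, mul_zero]
    have := Finset.mem_range_succ_iff.1 hj
    omega

lemma nMap_eq_coeff {g ν k : ℕ} (hν : ν ≠ 0) (hk : 1 ≤ k) :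
    (nMap g (2 * ν) k : ℚ) =
      (genusPoly (2 * ν) ((Finset.range k).erase 0) fun _ => 2 * ν).coeff g := by
  classical
  rw [← card_filter_eq_coeff _ _ _ _ (fun N hN => sum_pow_cycleCount_eq hN hν hk) g, nMap,
    ← Nat.card_eq_finsetCard]
  congr 1
  refine Nat.card_congr (Equiv.subtypeEquivRight fun α => ?_)
  rw [Finset.mem_filter, mem_connectedPairings, mem_pairings, fiberSet_blockIndex_range,
    and_assoc, and_assoc]
  refine and_congr_right fun hα => ?_
  rw [transitive_iff_component_eq (by omega) hk hα]
  refine and_congr ?_ (and_congr_right fun _ => ?_)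
  · simp [Finset.eq_univ_iff_forall]
  · push_cast
    rw [← Nat.cast_inj (R := ℤ)]
    push_cast
    constructor <;> intro h <;> linarith

lemma centralBinom_eq_succ_mul (ν : ℕ) : (Nat.centralBinom ν : ℚ) =
    ((2 * ν).factorial : ℚ) / ((ν + 1).factorial * ν.factorial) * (ν + 1) := by
  rw [Nat.centralBinom_eq_two_mul_choose, Nat.cast_choose ℚ (by omega : ν ≤ 2 * ν),
    show 2 * ν - ν = ν by omega, Nat.factorial_succ]
  have := Nat.cast_ne_zero (R := ℚ).2 ν.factorial_ne_zero
  push_cast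
  field_simp

end Assembly

end RibbonGraph

theorem stmt18 (g k : ℕ) (hg : 2 ≤ g) (hk : 1 ≤ k) :
    ∃ S : Polynomial ℚ, S.natDegree ≤ 3 * g - 3 + 3 * k ∧
      ∀ ν : ℕ, 2 ≤ ν →
        (nMap g (2 * ν) k : ℚ) =
          (((2 * ν).factorial : ℚ) / ((ν + 1).factorial * ν.factorial)) ^ k
            * S.eval (ν : ℚ) := by
  have hcard : ((Finset.range k).erase 0).card = k - 1 := by
    rw [Finset.card_erase_of_mem (Finset.mem_range.2 hk), Finset.card_range]
  obtain ⟨q, hq, h⟩ := RibbonGraph.exists_genusPoly_coeff_eq g ((Finset.range k).erase 0) (by omega)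
  rw [hcard] at hq
  refine ⟨(Polynomial.X + 1) ^ k * q, ?_, fun ν hν => ?_⟩
  · have h1 : ((Polynomial.X + 1 : Polynomial ℚ) ^ k).natDegree ≤ k := by
      simpa using Polynomial.natDegree_pow_le_of_le k
        (Polynomial.natDegree_X_add_C (1 : ℚ)).le
    have := Polynomial.natDegree_mul_le_of_le h1 hq
    omega
  · rw [RibbonGraph.nMap_eq_coeff (by omega) hk, h, hcard, Nat.sub_add_cancel hk,
      RibbonGraph.centralBinom_eq_succ_mul]
    simp only [Polynomial.eval_mul, Polynomial.eval_pow, Polynomial.eval_add, Polynomial.eval_X,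
      Polynomial.eval_one, mul_pow]
    ring
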